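/- Let v be a (2,2,1,1)-vertex or a (1,1,1)-vertex in a smallest counterexample G. If v is not contained in any 5-cycle, then v has at most one friend that has degree 3, is joined to v by a 1-string, and is not contained in any 5-cycle. -/

import Mathlib

open SimpleGraph

/-- The degree of a vertex, as the cardinality of its neighbor set. -/
noncomputable def deg {V : Type} (G : SimpleGraph V) (v : V) : ℕ :=
  (G.neighborSet v).ncard

/-- The potential of a finite graph: `5 n(G) - 4 e(G)`. -/
noncomputable def pot {V : Type} [Fintype V] (G : SimpleGraph V) : ℤ :=
  5 * (Fintype.card V : ℤ) - 4 * (G.edgeSet.ncard : ℤ)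

/-- A graph is 5/2-critical if it has no homomorphism to the 5-cycle
but every proper subgraph has one. -/
def Critical52 {V : Type} (G : SimpleGraph V) : Prop :=
  IsEmpty (G →g cycleGraph 5) ∧
  ∀ H : G.Subgraph, H ≠ ⊤ → Nonempty (H.coe →g cycleGraph 5)

/-- The exceptional graph `E₁`: a 9-cycle `0 1 2 3 4 5 6 7 8` together
with a vertex `9` adjacent to `0`, `3` and `6`. -/
def E1 : SimpleGraph (Fin 10) := SimpleGraph.fromEdgeSet
  {s(0,1), s(1,2), s(2,3), s(3,4), s(4,5), s(5,6), s(6,7), s(7,8), s(8,0),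
   s(9,0), s(9,3), s(9,6)}

/-- The exceptional graph `E₂`: two 5-cycles `0 1 2 3 4` and `0 1 5 6 7`
sharing exactly the edge `01`, together with a path `3 8 9 6`. -/
def E2 : SimpleGraph (Fin 10) := SimpleGraph.fromEdgeSet
  {s(0,1), s(1,2), s(2,3), s(3,4), s(4,0),
   s(1,5), s(5,6), s(6,7), s(7,0),
   s(3,8), s(8,9), s(9,6)}

/-- A smallest counterexample: a 5/2-critical graph, not isomorphic to `C₃`, `E₁`, `E₂`,
with potential at least 2, such that every smaller 5/2-critical graph not isomorphic
to `C₃`, `E₁`, `E₂` has potential at most 1. -/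
def SmallestCex {V : Type} [Fintype V] (G : SimpleGraph V) : Prop :=
  Critical52 G ∧ IsEmpty (G ≃g cycleGraph 3) ∧ IsEmpty (G ≃g E1) ∧ IsEmpty (G ≃g E2) ∧
  2 ≤ pot G ∧
  ∀ (m : ℕ) (H : SimpleGraph (Fin m)), Critical52 H →
    IsEmpty (H ≃g cycleGraph 3) → IsEmpty (H ≃g E1) → IsEmpty (H ≃g E2) →
    m < Fintype.card V → pot H ≤ 1

/-- A string: a path of positive length whose endvertices have degree at least 3
and whose internal vertices have degree 2. A `k`-string is a string of length `k+1`. -/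
def IsString {V : Type} (G : SimpleGraph V) {u v : V} (p : G.Walk u v) : Prop :=
  p.IsPath ∧ 0 < p.length ∧ 3 ≤ deg G u ∧ 3 ≤ deg G v ∧
  ∀ w ∈ p.support, w ≠ u → w ≠ v → deg G w = 2

/-- `v` lies on a 5-cycle of `G`. -/
def InFiveCycle {V : Type} (G : SimpleGraph V) (v : V) : Prop :=
  ∃ (w : V) (c : G.Walk w w), c.IsCycle ∧ c.length = 5 ∧ v ∈ c.support

/-- `v` is a `(k₁,k₂,k₃)`-vertex: it has degree 3 and is the end of a `k₁`-string,
a `k₂`-string and a `k₃`-string leaving `v` through its three distinct edges. -/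
def IsVertex3 {V : Type} (G : SimpleGraph V) (v : V) (k1 k2 k3 : ℕ) : Prop :=
  deg G v = 3 ∧ ∃ (u1 u2 u3 : V) (p1 : G.Walk v u1) (p2 : G.Walk v u2) (p3 : G.Walk v u3),
    IsString G p1 ∧ IsString G p2 ∧ IsString G p3 ∧
    p1.getVert 1 ≠ p2.getVert 1 ∧ p1.getVert 1 ≠ p3.getVert 1 ∧ p2.getVert 1 ≠ p3.getVert 1 ∧
    p1.length = k1 + 1 ∧ p2.length = k2 + 1 ∧ p3.length = k3 + 1

/-- `v` is a `(k₁,k₂,k₃,k₄)`-vertex: it has degree 4 and is the end of strings of the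
corresponding lengths leaving `v` through its four distinct edges. -/
def IsVertex4 {V : Type} (G : SimpleGraph V) (v : V) (k1 k2 k3 k4 : ℕ) : Prop :=
  deg G v = 4 ∧ ∃ (u1 u2 u3 u4 : V) (p1 : G.Walk v u1) (p2 : G.Walk v u2)
    (p3 : G.Walk v u3) (p4 : G.Walk v u4),
    IsString G p1 ∧ IsString G p2 ∧ IsString G p3 ∧ IsString G p4 ∧
    p1.getVert 1 ≠ p2.getVert 1 ∧ p1.getVert 1 ≠ p3.getVert 1 ∧ p1.getVert 1 ≠ p4.getVert 1 ∧
    p2.getVert 1 ≠ p3.getVert 1 ∧ p2.getVert 1 ≠ p4.getVert 1 ∧ p3.getVert 1 ≠ p4.getVert 1 ∧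
    p1.length = k1 + 1 ∧ p2.length = k2 + 1 ∧ p3.length = k3 + 1 ∧ p4.length = k4 + 1

/-- `H` contains at least two distinct cycles, where cycles are counted as subgraphs,
i.e. two cycles are distinct if their edge sets differ. -/
def TwoDistinctCycles {V : Type} (H : SimpleGraph V) : Prop :=
  ∃ (v1 v2 : V) (c1 : H.Walk v1 v1) (c2 : H.Walk v2 v2),
    c1.IsCycle ∧ c2.IsCycle ∧ {e | e ∈ c1.edges} ≠ {e | e ∈ c2.edges}

/-- The degree of a 5-cycle (cell) `c` in `G`: the number of strings not contained in `c`
that intersect `c`, strings being counted by their edge sets. -/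
noncomputable def cellDegree {V : Type} (G : SimpleGraph V) {w : V} (c : G.Walk w w) : ℕ :=
  {S : Set (Sym2 V) | ∃ (u v : V) (p : G.Walk u v), IsString G p ∧ S = {e | e ∈ p.edges} ∧
    ¬ S ⊆ {e | e ∈ c.edges} ∧ ∃ x ∈ p.support, x ∈ c.support}.ncard

/-! ### Colourings by the 5-cycle -/

/-- adjacency in the 5-cycle -/
def adj5 (x y : Fin 5) : Prop := x = y + 1 ∨ y = x + 1

instance : DecidableRel adj5 := fun x y => by unfold adj5; infer_instance

theorem adj5_iff (x y : Fin 5) : (cycleGraph 5).Adj x y ↔ adj5 x y := by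
  rw [cycleGraph_adj]
  revert x y; decide

theorem adj5_symm {x y : Fin 5} (h : adj5 x y) : adj5 y x := Or.symm h

/-- `g` respects the edges of `G`. -/
def IsCol {V : Type} (G : SimpleGraph V) (g : V → Fin 5) : Prop :=
  ∀ a b, G.Adj a b → adj5 (g a) (g b)

def HasCol {V : Type} (G : SimpleGraph V) : Prop := ∃ g : V → Fin 5, IsCol G g

theorem hasCol_iff {V : Type} (G : SimpleGraph V) : HasCol G ↔ Nonempty (G →g cycleGraph 5) := by
  constructor
  · rintro ⟨g, hg⟩
    exact ⟨⟨g, fun {a b} h => (adj5_iff _ _).2 (hg a b h)⟩⟩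
  · rintro ⟨f⟩
    exact ⟨f, fun a b h => (adj5_iff _ _).1 (f.map_adj h)⟩

theorem HasCol.mono {V W : Type} {G : SimpleGraph V} {H : SimpleGraph W} (f : V → W)
    (hf : ∀ a b, G.Adj a b → H.Adj (f a) (f b)) (h : HasCol H) : HasCol G := by
  obtain ⟨g, hg⟩ := h
  exact ⟨g ∘ f, fun a b hab => hg _ _ (hf a b hab)⟩

/-- edge-wise form of criticality -/
structure Crit {V : Type} (G : SimpleGraph V) : Prop where
  no : ¬ HasCol G
  sub : ∀ G' : SimpleGraph V, G' < G → HasCol G'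
  ni : ∀ v, ∃ w, G.Adj v w

theorem crit_iff {V : Type} (G : SimpleGraph V) : Critical52 G ↔ Crit G := by
  classical
  constructor
  · rintro ⟨h1, h2⟩
    have hno : ¬ HasCol G := fun h => by
      rw [hasCol_iff] at h; exact h1.false h.some
    refine ⟨hno, ?_, ?_⟩
    · intro G' hG'
      have := h2 (toSubgraph G' hG'.le) (by
        intro h
        apply hG'.ne
        ext a b
        have : (toSubgraph G' hG'.le).Adj a b ↔ (⊤ : G.Subgraph).Adj a b := by rw [h]
        simpa using this)
      rw [← hasCol_iff] at this
      exact this.mono (fun a => ⟨a, trivial⟩) (fun a b h => h)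
    · intro v
      by_contra hv
      push Not at hv
      have hne : (⊤ : G.Subgraph).deleteVerts {v} ≠ ⊤ := by
        intro h
        have : v ∈ ((⊤ : G.Subgraph).deleteVerts {v}).verts := by rw [h]; trivial
        simp at this
      have := h2 _ hne
      rw [← hasCol_iff] at this
      obtain ⟨g, hg⟩ := this
      apply hno
      have hm : ∀ a, a ≠ v → a ∈ ((⊤ : G.Subgraph).deleteVerts {v}).verts := by
        intro a ha; simp [ha]
      refine ⟨fun a => if h : a ≠ v then g ⟨a, hm a h⟩ else 0, fun a b hab => ?_⟩
      have ha : a ≠ v := by rintro rfl; exact hv _ hab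
      have hb : b ≠ v := by rintro rfl; exact hv _ hab.symm
      simp only [ha, hb, ne_eq, not_false_eq_true, dif_pos]
      apply hg
      simp [ha, hb, hab]
  · intro h
    refine ⟨⟨fun f => h.no ((hasCol_iff G).2 ⟨f⟩)⟩, fun H hH => ?_⟩
    rw [← hasCol_iff]
    by_cases hs : H.spanningCoe = G
    · exfalso
      apply hH
      apply Subgraph.ext
      · ext v
        obtain ⟨w, hw⟩ := h.ni v
        have : H.Adj v w := by
          rw [← hs] at hw; exact hw
        simp [H.edge_vert this]
      · ext a b
        have : H.spanningCoe.Adj a b ↔ G.Adj a b := by rw [hs]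
        simpa using this
    · have : H.spanningCoe < G := lt_of_le_of_ne (Subgraph.spanningCoe_le H) hs
      exact (h.sub _ this).mono (fun a => a.1) (fun a b hab => hab)

/-- extraction of a critical subgraph -/
theorem exists_crit {W : Type} [Finite W] (Q : SimpleGraph W) (h : ¬ HasCol Q) :
    ∃ (m : ℕ) (K : SimpleGraph (Fin m)) (f : Fin m → W), Crit K ∧ Function.Injective f ∧
      ∀ a b, K.Adj a b → Q.Adj (f a) (f b) := by
  classical
  have hfin : {Q' : SimpleGraph W | Q' ≤ Q ∧ ¬ HasCol Q'}.Finite := Set.toFinite _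
  obtain ⟨Q', hmin⟩ := hfin.exists_minimal ⟨Q, le_refl _, h⟩
  obtain ⟨⟨hle, hno⟩, hm⟩ := hmin
  let Sp : Set W := {w | ∃ w', Q'.Adj w w'}
  obtain ⟨m, ⟨e⟩⟩ := Finite.exists_equiv_fin Sp
  let f : Fin m → W := fun k => (e.symm k).1
  have hf : Function.Injective f := fun a b hab => e.symm.injective (Subtype.ext hab)
  have hr : ∀ w w', Q'.Adj w w' → ∃ k, f k = w := fun w w' hw => ⟨e ⟨w, w', hw⟩, by simp [f]⟩
  refine ⟨m, Q'.comap f, f, ⟨?_, ?_, ?_⟩, hf, fun a b hab => hle hab⟩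
  · rintro ⟨g, hg⟩
    apply hno
    refine ⟨fun w => if hw : ∃ k, f k = w then g hw.choose else 0, fun a b hab => ?_⟩
    have ha := hr _ _ hab
    have hb := hr _ _ hab.symm
    simp only [ha, hb, dif_pos]
    apply hg
    rw [comap_adj, ha.choose_spec, hb.choose_spec]
    exact hab
  · intro K' hK'
    by_contra hc
    have hle' : K'.map (⟨f, hf⟩ : Fin m ↪ W) ≤ Q' := by
      rw [map_le_iff_le_comap]; exact hK'.le
    have h2 := hm (y := K'.map (⟨f, hf⟩ : Fin m ↪ W)) ⟨hle'.trans hle, fun hcol => hc (hcol.mono f (by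
      intro a b hab; rw [map_adj]; exact ⟨a, b, hab, rfl, rfl⟩))⟩ hle'
    apply hK'.not_ge
    intro a b hab
    have := h2 hab
    rw [map_adj] at this
    obtain ⟨a', b', h1, h3, h4⟩ := this
    have := hf h3; have := hf h4; subst_vars; exact h1
  · intro k
    obtain ⟨w', hw'⟩ := (e.symm k).2
    obtain ⟨k', hk'⟩ := hr _ _ hw'.symm
    exact ⟨k', by rw [comap_adj, hk']; exact hw'⟩

section basic
variable {V : Type} {G : SimpleGraph V}

/-- Deleting all edges that meet a property yields a colouring, as soon as one edge is deleted. -/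
theorem Crit.del (hG : Crit G) (P : V → V → Prop) {a b : V} (hab : G.Adj a b) (hP : P a b) :
    ∃ g : V → Fin 5, ∀ c d, G.Adj c d → ¬ P c d → ¬ P d c → adj5 (g c) (g d) := by
  let G' : SimpleGraph V := ⟨fun c d => G.Adj c d ∧ ¬ P c d ∧ ¬ P d c,
    ⟨fun c d h => ⟨h.1.symm, h.2.2, h.2.1⟩⟩, ⟨fun c h => G.irrefl h.1⟩⟩
  have hlt : G' < G := by
    refine lt_of_le_of_ne (fun c d h => h.1) (fun h => ?_)
    have : G'.Adj a b := by rw [h]; exact hab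
    exact this.2.1 hP
  obtain ⟨g, hg⟩ := hG.sub G' hlt
  exact ⟨g, fun c d h1 h2 h3 => hg c d ⟨h1, h2, h3⟩⟩

theorem Crit.two (hG : Crit G) (v : V) : ∃ a b, a ≠ b ∧ G.Adj v a ∧ G.Adj v b := by
  classical
  obtain ⟨a, ha⟩ := hG.ni v
  by_contra hc
  push Not at hc
  obtain ⟨g, hg⟩ := hG.del (fun c _ => c = v) ha rfl
  apply hG.no
  have huniq : ∀ b, G.Adj v b → b = a := fun b hb => by
    by_contra hne; exact hc a b (Ne.symm hne) ha hb
  refine ⟨Function.update g v (g a + 1), fun c d hcd => ?_⟩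
  by_cases h1 : c = v
  · subst h1
    have := huniq d hcd; subst this
    have hne : d ≠ c := hcd.ne'
    simp [Function.update_of_ne hne, adj5]
  · by_cases h2 : d = v
    · subst h2
      have := huniq c hcd.symm; subst this
      simp [Function.update_of_ne h1, adj5]
    · rw [Function.update_of_ne h1, Function.update_of_ne h2]
      exact hg c d hcd h1 h2

theorem Crit.surj (hG : Crit G) {m : Type} {K : SimpleGraph m} (hK : ¬ HasCol K) (f : m → V)
    (hf : Function.Injective f) (hom : ∀ a b, K.Adj a b → G.Adj (f a) (f b)) :
    Function.Surjective f ∧ ∀ a b, G.Adj (f a) (f b) → K.Adj a b := by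
  have hle : K.map (⟨f, hf⟩ : m ↪ V) ≤ G := by
    rw [map_le_iff_le_comap]; exact fun a b h => hom a b h
  have heq : K.map (⟨f, hf⟩ : m ↪ V) = G := by
    by_contra hne
    have := hG.sub _ (lt_of_le_of_ne hle hne)
    exact hK (this.mono f (by intro a b hab; rw [map_adj]; exact ⟨a, b, hab, rfl, rfl⟩))
  constructor
  · intro v
    obtain ⟨w, hw⟩ := hG.ni v
    rw [← heq] at hw
    rw [map_adj] at hw
    obtain ⟨a, b, h1, h2, h3⟩ := hw
    exact ⟨a, h2⟩
  · intro a b hab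
    rw [← heq] at hab
    rw [map_adj] at hab
    obtain ⟨a', b', h1, h2, h3⟩ := hab
    have := hf h2; have := hf h3; subst_vars; exact h1

theorem adj5_path4 : ∀ c d : Fin 5, ∃ x y z, adj5 c x ∧ adj5 x y ∧ adj5 y z ∧ adj5 z d := by
  decide

theorem adj5_path3 : ∀ c d : Fin 5, c ≠ d → ∃ x y, adj5 c x ∧ adj5 x y ∧ adj5 y d := by
  decide

/-- no three consecutive vertices of degree two -/
theorem Crit.no3 (hG : Crit G) {p x y z q : V} (hx : ∀ t, G.Adj x t → t = p ∨ t = y)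
    (hy : ∀ t, G.Adj y t → t = x ∨ t = z) (hz : ∀ t, G.Adj z t → t = y ∨ t = q)
    (hxy : G.Adj x y) (hxz : x ≠ z) (hyz : G.Adj y z) (hp : p ≠ y ∧ p ≠ z) (hq : q ≠ x ∧ q ≠ y)
    (hpx : G.Adj p x) (hqz : G.Adj q z) : False := by
  classical
  obtain ⟨g, hg⟩ := hG.del (fun c _ => c = x ∨ c = y ∨ c = z) hxy (Or.inl rfl)
  obtain ⟨cx, cy, cz, h1, h2, h3, h4⟩ := adj5_path4 (g p) (g q)
  apply hG.no
  have n1 := hxy.ne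
  have n2 := hyz.ne
  have n3 := hpx.ne
  have n4 := hqz.ne
  let g' : V → Fin 5 := fun t => if t = x then cx else if t = y then cy else if t = z then cz else g t
  have e1 : g' x = cx := by simp [g']
  have e2 : g' y = cy := by simp [g', n1.symm]
  have e3 : g' z = cz := by simp [g', n2.symm, hxz.symm]
  have e0 : ∀ t, t ≠ x → t ≠ y → t ≠ z → g' t = g t := fun t a b c => by simp [g', a, b, c]
  have e4 : g' p = g p := e0 p n3 hp.1 hp.2
  have e5 : g' q = g q := e0 q hq.1 hq.2 n4
  have key : ∀ c d, G.Adj c d → (c = x ∨ c = y ∨ c = z) → adj5 (g' c) (g' d) := by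
    rintro c d hcd (rfl | rfl | rfl)
    · rcases hx d hcd with rfl | rfl
      · rw [e1, e4]; exact adj5_symm h1
      · rw [e1, e2]; exact h2
    · rcases hy d hcd with rfl | rfl
      · rw [e1, e2]; exact adj5_symm h2
      · rw [e2, e3]; exact h3
    · rcases hz d hcd with rfl | rfl
      · rw [e2, e3]; exact adj5_symm h3
      · rw [e3, e5]; exact h4
  refine ⟨g', fun c d hcd => ?_⟩
  by_cases hc : c = x ∨ c = y ∨ c = z
  · exact key c d hcd hc
  by_cases hd : d = x ∨ d = y ∨ d = z
  · exact adj5_symm (key d c hcd.symm hd)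
  have := hg c d hcd hc hd
  push Not at hc hd
  rwa [e0 c hc.1 hc.2.1 hc.2.2, e0 d hd.1 hd.2.1 hd.2.2]

end basic

/-! ### Potentials -/
section potential
variable {V : Type} {G : SimpleGraph V}

open Classical in
noncomputable def darts {V : Type} (G : SimpleGraph V) (R : Finset V) : Finset (V × V) :=
  (R ×ˢ R).filter (fun p => G.Adj p.1 p.2)

theorem mem_darts {R : Finset V} {p : V × V} :
    p ∈ darts G R ↔ p.1 ∈ R ∧ p.2 ∈ R ∧ G.Adj p.1 p.2 := by
  simp [darts, and_assoc]

noncomputable def pR {V : Type} (G : SimpleGraph V) (R : Finset V) : ℤ :=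
  5 * (R.card : ℤ) - 2 * ((darts G R).card : ℤ)

theorem pot_eq [Fintype V] (G : SimpleGraph V) : pot G = pR G Finset.univ := by
  classical
  unfold pot pR
  have h1 : (darts G Finset.univ).card = 2 * G.edgeSet.ncard := by
    have h2 := G.dart_card_eq_twice_card_edges
    rw [← Set.ncard_coe_finset G.edgeFinset, coe_edgeFinset] at h2
    rw [← h2, ← Finset.card_univ]
    refine (Finset.card_bij (fun d _ => d.toProd) ?_ ?_ ?_).symm
    · intro d _; rw [mem_darts]; exact ⟨Finset.mem_univ _, Finset.mem_univ _, d.adj⟩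
    · intro d _ d' _ hd; exact Dart.ext _ _ hd
    · intro p hp; exact ⟨⟨p, (mem_darts.1 hp).2.2⟩, Finset.mem_univ _, rfl⟩
  rw [h1, Finset.card_univ]; push_cast; ring

theorem pR_insert [DecidableEq V] {R N : Finset V} {x : V} (hx : x ∉ R) (hN : N ⊆ R)
    (hadj : ∀ n ∈ N, G.Adj x n) : pR G (insert x R) ≤ pR G R + 5 - 4 * (N.card : ℤ) := by
  have h1 : darts G R ∪ (N.image (fun n => (x, n)) ∪ N.image (fun n => (n, x))) ⊆
      darts G (insert x R) := by
    intro p hp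
    rw [mem_darts]
    simp only [Finset.mem_union, Finset.mem_image, mem_darts] at hp
    rcases hp with ⟨h1, h2, h3⟩ | ⟨n, hn, rfl⟩ | ⟨n, hn, rfl⟩
    · exact ⟨Finset.mem_insert_of_mem h1, Finset.mem_insert_of_mem h2, h3⟩
    · exact ⟨by simp, Finset.mem_insert_of_mem (hN hn), hadj n hn⟩
    · exact ⟨Finset.mem_insert_of_mem (hN hn), by simp, (hadj n hn).symm⟩
  have h2 := Finset.card_le_card h1
  rw [Finset.card_union_of_disjoint, Finset.card_union_of_disjoint,
    Finset.card_image_of_injective, Finset.card_image_of_injective] at h2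
  · unfold pR
    rw [Finset.card_insert_of_notMem hx]
    push_cast
    have : ((darts G R).card : ℤ) + (N.card + N.card) ≤ (darts G (insert x R)).card := by
      exact_mod_cast h2
    linarith
  · intro a b h; simpa using h
  · intro a b h; simpa using h
  · rw [Finset.disjoint_left]
    intro p hp hq
    simp only [Finset.mem_image] at hp hq
    obtain ⟨a, ha, rfl⟩ := hp
    obtain ⟨b, hb, he⟩ := hq
    simp only [Prod.mk.injEq] at he
    exact hx (he.1 ▸ hN hb)
  · rw [Finset.disjoint_left]
    intro p hp hq
    simp only [Finset.mem_image, Finset.mem_union] at hq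
    rw [mem_darts] at hp
    rcases hq with ⟨a, ha, rfl⟩ | ⟨a, ha, rfl⟩
    · exact hx hp.1
    · exact hx hp.2.1

theorem pR_add1 [DecidableEq V] {R : Finset V} {x a : V} (hx : x ∉ R) (ha : a ∈ R)
    (h : G.Adj x a) : pR G (insert x R) ≤ pR G R + 1 := by
  have := pR_insert (G := G) (N := {a}) hx (by simpa using ha) (by simpa using h)
  simp at this; linarith

theorem pR_add2 [DecidableEq V] {R : Finset V} {x a b : V} (hx : x ∉ R) (ha : a ∈ R) (hb : b ∈ R)
    (hab : a ≠ b) (h : G.Adj x a) (h' : G.Adj x b) : pR G (insert x R) ≤ pR G R - 3 := by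
  have := pR_insert (G := G) (N := {a, b}) hx (by intro t; simp; rintro (rfl | rfl) <;> assumption)
    (by simp [h, h'])
  rw [Finset.card_pair hab] at this
  push_cast at this; linarith

theorem pR_add2' [DecidableEq V] {R : Finset V} {x a b : V} (ha : a ∈ R) (hb : b ∈ R)
    (hab : a ≠ b) (h : G.Adj x a) (h' : G.Adj x b) : pR G (insert x R) ≤ pR G R := by
  by_cases hx : x ∈ R
  · rw [Finset.insert_eq_of_mem hx]
  · have := pR_add2 hx ha hb hab h h'; linarith

theorem pR_add3 [DecidableEq V] {R : Finset V} {x a b c : V} (hx : x ∉ R) (ha : a ∈ R)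
    (hb : b ∈ R) (hc : c ∈ R) (hab : a ≠ b) (hac : a ≠ c) (hbc : b ≠ c)
    (h : G.Adj x a) (h' : G.Adj x b) (h'' : G.Adj x c) : pR G (insert x R) ≤ pR G R - 7 := by
  have := pR_insert (G := G) (N := {a, b, c}) hx
    (by intro t; simp; rintro (rfl | rfl | rfl) <;> assumption) (by simp [h, h', h''])
  rw [Finset.card_eq_three.2 ⟨a, b, c, hab, hac, hbc, rfl⟩] at this
  push_cast at this; linarith

theorem pR_add0 [DecidableEq V] {R : Finset V} {x : V} (hx : x ∉ R) :
    pR G (insert x R) ≤ pR G R + 5 := by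
  have := pR_insert (G := G) (N := ∅) hx (by simp) (by simp)
  simpa using this

/-- the counting lemma -/
theorem count_lemma [DecidableEq V] {ι W : Type} {R1 S : Finset V} (hd : Disjoint R1 S)
    (T : Finset (V × V)) (hT : ∀ p ∈ T, p ∈ darts G (R1 ∪ S) ∧ p ∉ darts G R1)
    (KD : Finset (ι × ι)) (q : V → W) (f : ι → W) (hf : Function.Injective f)
    (hl : ∀ k k', (k, k') ∈ KD → ∃ a b, (a, b) ∈ darts G (R1 ∪ S) ∧ (a, b) ∉ darts G R1 ∧
      (a, b) ∉ T ∧ q a = f k ∧ q b = f k') :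
    pR G (R1 ∪ S) + 2 * (T.card : ℤ) + 2 * (KD.card : ℤ) ≤ pR G R1 + 5 * (S.card : ℤ) := by
  classical
  have h0 : darts G R1 ⊆ darts G (R1 ∪ S) := by
    intro p hp
    rw [mem_darts] at hp ⊢
    exact ⟨Finset.mem_union_left _ hp.1, Finset.mem_union_left _ hp.2.1, hp.2.2⟩
  have h1 : KD.image (fun p => (f p.1, f p.2)) ⊆
      ((darts G (R1 ∪ S) \ darts G R1) \ T).image (fun p => (q p.1, q p.2)) := by
    intro p hp
    rw [Finset.mem_image] at hp
    obtain ⟨⟨k, k'⟩, hk, rfl⟩ := hp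
    obtain ⟨a, b, h1, h2, h3, h4, h5⟩ := hl k k' hk
    rw [Finset.mem_image]
    exact ⟨(a, b), by simp only [Finset.mem_sdiff]; exact ⟨⟨h1, h2⟩, h3⟩, by simp [h4, h5]⟩
  have h2 := (Finset.card_le_card h1).trans Finset.card_image_le
  rw [Finset.card_image_of_injective] at h2
  · rw [Finset.card_sdiff_of_subset, Finset.card_sdiff_of_subset h0] at h2
    · have h3 := Finset.card_le_card h0
      have h4 : T.card ≤ (darts G (R1 ∪ S)).card - (darts G R1).card := by
        rw [← Finset.card_sdiff_of_subset h0]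
        exact Finset.card_le_card (fun p hp => by
          rw [Finset.mem_sdiff]; exact hT p hp)
      unfold pR
      rw [Finset.card_union_of_disjoint hd]
      push_cast
      have : ((darts G R1).card : ℤ) + T.card + KD.card ≤ (darts G (R1 ∪ S)).card := by
        exact_mod_cast (by omega)
      linarith
    · exact fun p hp => by
          rw [Finset.mem_sdiff]; exact hT p hp
  · rintro ⟨a, b⟩ ⟨c, d⟩ h
    simp only [Prod.mk.injEq] at h
    rw [hf h.1, hf h.2]

end potential

/-! ### Basic facts on smallest counterexamples -/
section cex
variable {V : Type} [Fintype V] {G : SimpleGraph V}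

theorem cycleGraph3_top : (cycleGraph 3 : SimpleGraph (Fin 3)) = ⊤ := by
  ext a b; rw [cycleGraph_adj, top_adj]; revert a b; decide

theorem SmallestCex.crit (h : SmallestCex G) : Crit G := (crit_iff G).1 h.1

theorem SmallestCex.two_le (h : SmallestCex G) : 2 ≤ pR G Finset.univ := by
  rw [← pot_eq]; exact h.2.2.2.2.1

theorem hasCol_top3 : ¬ HasCol (⊤ : SimpleGraph (Fin 3)) := by
  rintro ⟨g, hg⟩
  have h1 := hg 0 1 (by simp)
  have h2 := hg 1 2 (by simp)
  have h3 := hg 2 0 (by simp)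
  generalize g 0 = a at *; generalize g 1 = b at *; generalize g 2 = c at *
  revert a b c; decide

theorem SmallestCex.no_tri (h : SmallestCex G) {a b c : V} (hab : G.Adj a b) (hbc : G.Adj b c)
    (hca : G.Adj c a) : False := by
  let f : Fin 3 → V := ![a, b, c]
  have hf : Function.Injective f := by
    intro i j hij
    fin_cases i <;> fin_cases j <;> simp [f] at hij ⊢ <;>
      first | exact hab.ne hij | exact hab.ne' hij | exact hbc.ne hij | exact hbc.ne' hij | exact hca.ne hij | exact hca.ne' hij
  obtain ⟨hs, hb⟩ := h.crit.surj hasCol_top3 f hf (by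
    intro i j hij
    fin_cases i <;> fin_cases j <;> simp [f] at hij ⊢ <;>
      first | assumption | exact hab.symm | exact hbc.symm | exact hca.symm)
  refine h.2.1.false ?_
  rw [cycleGraph3_top]
  refine (⟨Equiv.ofBijective f ⟨hf, hs⟩, ?_⟩ : (⊤ : SimpleGraph (Fin 3)) ≃g G).symm
  intro i j
  constructor
  · exact hb i j
  · intro hij
    fin_cases i <;> fin_cases j <;> simp [f] at hij ⊢ <;>
      first | assumption | exact hab.symm | exact hbc.symm | exact hca.symm

theorem pot_iso {W W' : Type} [Fintype W] [Fintype W'] {A : SimpleGraph W} {B : SimpleGraph W'}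
    (e : A ≃g B) : pot A = pot B := by
  unfold pot
  rw [Fintype.card_congr e.toEquiv]
  congr 3
  rw [← Nat.card_coe_set_eq, ← Nat.card_coe_set_eq]
  exact Nat.card_congr e.mapEdgeSet

theorem pot_top3 : pot (⊤ : SimpleGraph (Fin 3)) = 3 := by
  rw [pot_eq]; unfold pR
  have : (darts (⊤ : SimpleGraph (Fin 3)) Finset.univ).card = 6 := by
    have : darts (⊤ : SimpleGraph (Fin 3)) Finset.univ =
      (Finset.univ : Finset (Fin 3 × Fin 3)).filter (fun p => p.1 ≠ p.2) := by
      ext p; simp [mem_darts]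
    rw [this]; decide
  rw [this]; decide

/-- classification of a smaller critical graph -/
theorem SmallestCex.cls (h : SmallestCex G) {m : ℕ} {K : SimpleGraph (Fin m)} (hK : Crit K)
    (hm : m < Fintype.card V) :
    pot K ≤ 1 ∨ Nonempty (K ≃g E1) ∨ Nonempty (K ≃g E2) ∨ (m = 3 ∧ K = ⊤ ∧ pot K = 3) := by
  by_cases h1 : Nonempty (K ≃g E1)
  · exact Or.inr (Or.inl h1)
  by_cases h2 : Nonempty (K ≃g E2)
  · exact Or.inr (Or.inr (Or.inl h2))
  by_cases h3 : Nonempty (K ≃g cycleGraph 3)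
  · right; right; right
    obtain ⟨e⟩ := h3
    have hm : m = 3 := by simpa using Fintype.card_congr e.toEquiv
    subst hm
    refine ⟨rfl, ?_, ?_⟩
    · ext a b
      have : (cycleGraph 3).Adj (e a) (e b) ↔ e a ≠ e b := by
        rw [← top_adj]; exact Iff.of_eq (congrFun (congrFun (congrArg SimpleGraph.Adj cycleGraph3_top) _) _)
      rw [← e.map_adj_iff, this]
      simp
    · rw [pot_iso e, cycleGraph3_top, pot_top3]
  · left
    exact h.2.2.2.2.2 m K ((crit_iff K).2 hK) (not_nonempty_iff.1 h3) (not_nonempty_iff.1 h1)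
      (not_nonempty_iff.1 h2) hm

theorem Crit.four {m : ℕ} {K : SimpleGraph (Fin m)} (hK : Crit K) : 3 ≤ m ∧ (m = 3 → K = ⊤) := by
  have hm : 0 < m := by
    by_contra hc
    have : m = 0 := by omega
    subst this
    exact hK.no ⟨fun _ => 0, fun a => a.elim0⟩
  have key : ∀ v : Fin m, ∃ a b : Fin m, a ≠ b ∧ a ≠ v ∧ b ≠ v ∧ K.Adj v a ∧ K.Adj v b := by
    intro v
    obtain ⟨a, b, h1, h2, h3⟩ := hK.two v
    exact ⟨a, b, h1, h2.ne', h3.ne', h2, h3⟩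
  constructor
  · obtain ⟨a, b, h1, h2, h3, -⟩ := key ⟨0, hm⟩
    have := Finset.card_le_univ ({a, b, ⟨0, hm⟩} : Finset (Fin m))
    rw [Finset.card_eq_three.2 ⟨a, b, _, h1, h2, h3, rfl⟩] at this
    simpa using this
  · rintro rfl
    ext x y
    rw [top_adj]
    refine ⟨fun h => h.ne, fun h => ?_⟩
    obtain ⟨a, b, h1, h2, h3, h4, h5⟩ := key x
    have : y = a ∨ y = b := by
      omega
    rcases this with rfl | rfl <;> assumption

end cex

/-! ### The exceptional graphs -/

def L1 : List (Fin 10 × Fin 10) :=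
  [(0,1), (1,2), (2,3), (3,4), (4,5), (5,6), (6,7), (7,8), (8,0), (9,0), (9,3), (9,6)]

def L2 : List (Fin 10 × Fin 10) :=
  [(0,1), (1,2), (2,3), (3,4), (4,0), (1,5), (5,6), (6,7), (7,0), (3,8), (8,9), (9,6)]

def adjL (L : List (Fin 10 × Fin 10)) (a b : Fin 10) : Prop := (a, b) ∈ L ∨ (b, a) ∈ L

instance (L : List (Fin 10 × Fin 10)) : DecidableRel (adjL L) := fun a b => by
  unfold adjL; infer_instance

theorem E1_adj (a b : Fin 10) : E1.Adj a b ↔ adjL L1 a b := by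
  unfold E1
  simp only [fromEdgeSet_adj, Set.mem_insert_iff, Set.mem_singleton_iff]
  revert a b; decide +kernel

theorem E2_adj (a b : Fin 10) : E2.Adj a b ↔ adjL L2 a b := by
  unfold E2
  simp only [fromEdgeSet_adj, Set.mem_insert_iff, Set.mem_singleton_iff]
  revert a b; decide +kernel

theorem pot_of_adjL (L : List (Fin 10 × Fin 10)) (E : SimpleGraph (Fin 10))
    (h : ∀ a b, E.Adj a b ↔ adjL L a b)
    (hc : ((Finset.univ : Finset (Fin 10 × Fin 10)).filter (fun p => adjL L p.1 p.2)).card = 24) :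
    pot E = 2 := by
  rw [pot_eq]; unfold pR
  have : darts E Finset.univ =
      (Finset.univ : Finset (Fin 10 × Fin 10)).filter (fun p => adjL L p.1 p.2) := by
    ext p; simp [mem_darts, h]
  rw [this, hc]; simp

theorem pot_E1 : pot E1 = 2 := pot_of_adjL L1 E1 E1_adj (by decide +kernel)
theorem pot_E2 : pot E2 = 2 := pot_of_adjL L2 E2 E2_adj (by decide +kernel)

/-- `K` is one of the two exceptional graphs on ten vertices, given by its edge list -/
def IsE {m : ℕ} (K : SimpleGraph (Fin m)) : Prop :=
  ∃ (L : List (Fin 10 × Fin 10)) (e : Fin m ≃ Fin 10), (L = L1 ∨ L = L2) ∧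
    ∀ a b, K.Adj a b ↔ adjL L (e a) (e b)

section cex
variable {V : Type} [Fintype V] {G : SimpleGraph V}

theorem SmallestCex.cls3 (h : SmallestCex G) {m : ℕ} {K : SimpleGraph (Fin m)} (hK : Crit K)
    (hm : m < Fintype.card V) :
    (pot K ≤ 1 ∧ 4 ≤ m) ∨ (IsE K ∧ pot K = 2 ∧ m = 10) ∨ (m = 3 ∧ K = ⊤ ∧ pot K = 3) := by
  rcases h.cls hK hm with h1 | ⟨⟨e⟩⟩ | ⟨⟨e⟩⟩ | h3
  · left
    refine ⟨h1, ?_⟩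
    obtain ⟨h2, h3⟩ := hK.four
    by_contra hc
    have : m = 3 := by omega
    subst this
    rw [h3 rfl, pot_top3] at h1
    omega
  · right; left
    exact ⟨⟨L1, e.toEquiv, Or.inl rfl, fun a b => by
      rw [← e.map_adj_iff]; exact E1_adj _ _⟩, by rw [pot_iso e, pot_E1],
      by simpa using Fintype.card_congr e.toEquiv⟩
  · right; left
    exact ⟨⟨L2, e.toEquiv, Or.inr rfl, fun a b => by
      rw [← e.map_adj_iff]; exact E2_adj _ _⟩, by rw [pot_iso e, pot_E2],
      by simpa using Fintype.card_congr e.toEquiv⟩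
  · exact Or.inr (Or.inr h3)

end cex

/-! ### Glueing a coloured subgraph onto the 5-cycle -/

/-- result of glueing `R1`, coloured by `φ`, onto the 5-cycle, using only edges of `G'`,
and extracting a critical graph -/
structure GlueOut {V : Type} (G' : SimpleGraph V) (R1 : Finset V) (φ : V → Fin 5) where
  m : ℕ
  K : SimpleGraph (Fin m)
  f : Fin m → V ⊕ Fin 5
  crit : Crit K
  inj : Function.Injective f
  hL : ∀ k a, f k = Sum.inl a → a ∉ R1
  hLL : ∀ k k' a b, K.Adj k k' → f k = Sum.inl a → f k' = Sum.inl b → G'.Adj a b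
  hLR : ∀ k k' a y, K.Adj k k' → f k = Sum.inl a → f k' = Sum.inr y →
    ∃ r ∈ R1, φ r = y ∧ G'.Adj a r
  hRR : ∀ k k' y y', K.Adj k k' → f k = Sum.inr y → f k' = Sum.inr y' → adj5 y y'

set_option synthInstance.maxSize 100000 in
set_option synthInstance.maxHeartbeats 400000 in
theorem endo5 (c : Fin 5 → Fin 5) (hc : ∀ x y, adj5 x y → adj5 (c x) (c y)) :
    ∃ d : Fin 5 → Fin 5, (∀ x y, adj5 x y → adj5 (d x) (d y)) ∧ ∀ x, d (c x) = x := by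
  have h : ∀ x, adj5 (c x) (c (x+1)) := fun x => hc _ _ (Or.inr rfl)
  have key : ∀ a b : Fin 5, adj5 a b → ∀ c : Fin 5, adj5 b c → ∀ d : Fin 5, adj5 c d →
      ∀ e : Fin 5, adj5 d e → adj5 e a →
      (b = a + 1 ∧ c = a + 2 ∧ d = a + 3 ∧ e = a + 4) ∨
      (b = a - 1 ∧ c = a - 2 ∧ d = a - 3 ∧ e = a - 4) := by decide +kernel
  have := key (c 0) (c 1) (h 0) (c 2) (h 1) (c 3) (h 2) (c 4) (h 3) (h 4)
  rcases this with ⟨h1, h2, h3, h4⟩ | ⟨h1, h2, h3, h4⟩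
  · refine ⟨fun x => x - c 0, ?_, ?_⟩
    · generalize c 0 = z; revert z; decide
    · intro x
      fin_cases x <;> simp [h1, h2, h3, h4]
  · refine ⟨fun x => c 0 - x, ?_, ?_⟩
    · generalize c 0 = z; revert z; decide
    · intro x
      fin_cases x <;> simp [h1, h2, h3, h4]

set_option linter.unusedSectionVars false

section glue
variable {V : Type} [Fintype V] {G : SimpleGraph V}

open Classical in
theorem exists_glue (G' : SimpleGraph V) (R1 : Finset V) (φ : V → Fin 5)
    (hφ : ∀ a b, a ∈ R1 → b ∈ R1 → G'.Adj a b → adj5 (φ a) (φ b))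
    (hno : ∀ g : V → Fin 5, IsCol G' g → (∀ r ∈ R1, g r = φ r) → False) :
    Nonempty (GlueOut G' R1 φ) := by
  let q : V → V ⊕ Fin 5 := fun a => if a ∈ R1 then Sum.inr (φ a) else Sum.inl a
  let rel : V ⊕ Fin 5 → V ⊕ Fin 5 → Prop := fun w w' =>
    (∃ a b, G'.Adj a b ∧ q a = w ∧ q b = w') ∨ (∃ y y', adj5 y y' ∧ w = Sum.inr y ∧ w' = Sum.inr y')
  have rsymm : ∀ w w', rel w w' → rel w' w := by
    rintro w w' (⟨a, b, h1, h2, h3⟩ | ⟨y, y', h1, h2, h3⟩)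
    · exact Or.inl ⟨b, a, h1.symm, h3, h2⟩
    · exact Or.inr ⟨y', y, adj5_symm h1, h3, h2⟩
  have qL : ∀ a b, q a = Sum.inl b → a = b ∧ a ∉ R1 := by
    intro a b h
    by_cases ha : a ∈ R1 <;> simp [q, ha] at h
    exact ⟨h, ha⟩
  have qR : ∀ a y, q a = Sum.inr y → a ∈ R1 ∧ φ a = y := by
    intro a y h
    by_cases ha : a ∈ R1 <;> simp [q, ha] at h
    exact ⟨ha, h⟩
  have nadj : ∀ y : Fin 5, ¬ adj5 y y := by decide
  have rirr : ∀ w, ¬ rel w w := by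
    rintro w (⟨a, b, h1, h2, h3⟩ | ⟨y, y', h1, h2, h3⟩)
    · cases w with
      | inl c =>
        have e1 := (qL _ _ h2).1; have e2 := (qL _ _ h3).1
        subst e1; subst e2; exact G'.irrefl h1
      | inr y =>
        have e1 := (qR _ _ h2); have e2 := (qR _ _ h3)
        have := hφ a b e1.1 e2.1 h1
        rw [e1.2, e2.2] at this
        exact nadj _ this
    · rw [h2] at h3
      cases h3
      exact nadj _ h1
  let Q : SimpleGraph (V ⊕ Fin 5) := ⟨rel, ⟨fun w w' h => rsymm w w' h⟩, ⟨fun w h => rirr w h⟩⟩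
  have hQ : ¬ HasCol Q := by
    rintro ⟨c, hc⟩
    obtain ⟨d, hd1, hd2⟩ := endo5 (fun y => c (Sum.inr y)) (fun x y hxy =>
      hc _ _ (Or.inr ⟨x, y, hxy, rfl, rfl⟩))
    refine hno (fun a => d (c (q a))) ?_ ?_
    · intro a b hab
      exact hd1 _ _ (hc _ _ (Or.inl ⟨a, b, hab, rfl, rfl⟩))
    · intro r hr
      have : q r = Sum.inr (φ r) := by simp [q, hr]
      simp only [this]
      exact hd2 _
  obtain ⟨m, K, f, h1, h2, h3⟩ := exists_crit Q hQ
  refine ⟨⟨m, K, f, h1, h2, ?_, ?_, ?_, ?_⟩⟩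
  · intro k a hk
    obtain ⟨k', hk'⟩ := h1.ni k
    rcases h3 _ _ hk' with ⟨x, b, h4, h5, h6⟩ | ⟨y, y', h4, h5, h6⟩
    · rw [hk] at h5
      have := qL _ _ h5
      exact this.1 ▸ this.2
    · rw [hk] at h5; cases h5
  · intro k k' a b hk ha hb
    rcases h3 _ _ hk with ⟨x, y, h4, h5, h6⟩ | ⟨y, y', h4, h5, h6⟩
    · rw [ha] at h5; rw [hb] at h6
      have e1 := (qL _ _ h5).1; have e2 := (qL _ _ h6).1
      subst e1; subst e2; exact h4
    · rw [ha] at h5; cases h5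
  · intro k k' a y hk ha hb
    rcases h3 _ _ hk with ⟨x, r, h4, h5, h6⟩ | ⟨y, y', h4, h5, h6⟩
    · rw [ha] at h5; rw [hb] at h6
      have e1 := (qL _ _ h5).1; have e2 := (qR _ _ h6)
      subst e1; exact ⟨r, e2.1, e2.2, h4⟩
    · rw [ha] at h5; cases h5
  · intro k k' y y' hk ha hb
    rcases h3 _ _ hk with ⟨x, r, h4, h5, h6⟩ | ⟨z, z', h4, h5, h6⟩
    · rw [ha] at h5; rw [hb] at h6
      have e1 := (qR _ _ h5); have e2 := (qR _ _ h6)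
      have := hφ _ _ e1.1 e2.1 h4
      rwa [e1.2, e2.2] at this
    · rw [ha] at h5; rw [hb] at h6
      cases h5; cases h6; exact h4

namespace GlueOut
variable {G' : SimpleGraph V} {R1 : Finset V} {φ : V → Fin 5}

open Classical in
noncomputable def S (o : GlueOut G' R1 φ) : Finset V :=
  Finset.univ.filter (fun a => ∃ k, o.f k = Sum.inl a)

open Classical in
noncomputable def X (o : GlueOut G' R1 φ) : Finset (Fin o.m) :=
  Finset.univ.filter (fun k => ∃ y, o.f k = Sum.inr y)

theorem mem_S {o : GlueOut G' R1 φ} {a : V} : a ∈ o.S ↔ ∃ k, o.f k = Sum.inl a := by simp [S]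
theorem mem_X {o : GlueOut G' R1 φ} {k} : k ∈ o.X ↔ ∃ y, o.f k = Sum.inr y := by simp [X]

theorem disj (o : GlueOut G' R1 φ) : Disjoint R1 o.S := by
  rw [Finset.disjoint_left]
  intro a ha hs
  obtain ⟨k, hk⟩ := mem_S.1 hs
  exact o.hL k a hk ha

theorem notX {o : GlueOut G' R1 φ} {k} (h : k ∉ o.X) : ∃ a ∈ o.S, o.f k = Sum.inl a := by
  cases hk : o.f k with
  | inl a => exact ⟨a, mem_S.2 ⟨k, hk⟩, rfl⟩
  | inr y => exact absurd (mem_X.2 ⟨y, hk⟩) h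

theorem card_SX (o : GlueOut G' R1 φ) : o.S.card + o.X.card = o.m := by
  classical
  have h1 : o.S.card = (o.Xᶜ).card := by
    symm
    refine Finset.card_bij (fun k hk => (notX (Finset.mem_compl.1 hk)).choose) ?_ ?_ ?_
    · intro k hk; exact (notX (Finset.mem_compl.1 hk)).choose_spec.1
    · intro k hk k' hk' he
      apply o.inj
      rw [(notX (Finset.mem_compl.1 hk)).choose_spec.2, (notX (Finset.mem_compl.1 hk')).choose_spec.2, he]
    · intro a ha
      obtain ⟨k, hk⟩ := mem_S.1 ha
      have hkX : k ∉ o.X := by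
        intro hx; obtain ⟨y, hy⟩ := mem_X.1 hx; rw [hk] at hy; cases hy
      refine ⟨k, Finset.mem_compl.2 hkX, ?_⟩
      have := (notX hkX).choose_spec.2
      exact (Sum.inl.inj (hk.symm.trans this)).symm
  rw [h1, Finset.card_compl, Fintype.card_fin]
  have := Finset.card_le_univ o.X
  rw [Fintype.card_fin] at this
  omega

theorem count [DecidableEq V] (o : GlueOut G' R1 φ) (hle : G' ≤ G) (T : Finset (V × V))
    (hT : ∀ p ∈ T, p ∈ darts G (R1 ∪ o.S) ∧ p ∉ darts G R1 ∧
      (¬ G'.Adj p.1 p.2 ∨ ∀ k k', o.K.Adj k k' →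
        (if p.1 ∈ R1 then Sum.inr (φ p.1) else Sum.inl p.1) = o.f k →
        (if p.2 ∈ R1 then Sum.inr (φ p.2) else Sum.inl p.2) = o.f k' → False)) :
    pR G (R1 ∪ o.S) + 2 * (T.card : ℤ) ≤ pR G R1 + pot o.K - pR o.K o.X := by
  let q : V → V ⊕ Fin 5 := fun a => if a ∈ R1 then Sum.inr (φ a) else Sum.inl a
  let KD := darts o.K Finset.univ \ darts o.K o.X
  have hsub : darts o.K o.X ⊆ darts o.K Finset.univ := by
    intro p hp; rw [mem_darts] at hp ⊢; exact ⟨Finset.mem_univ _, Finset.mem_univ _, hp.2.2⟩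
  have hq1 : ∀ a, a ∈ R1 → q a = Sum.inr (φ a) := fun a ha => by simp [q, ha]
  have hq2 : ∀ a, a ∉ R1 → q a = Sum.inl a := fun a ha => by simp [q, ha]
  have hS : ∀ a ∈ o.S, a ∉ R1 := fun a ha h => Finset.disjoint_left.1 o.disj h ha
  have main : ∀ k k', (k, k') ∈ KD → ∃ a b, (a, b) ∈ darts G (R1 ∪ o.S) ∧ (a, b) ∉ darts G R1 ∧
      G'.Adj a b ∧ q a = o.f k ∧ q b = o.f k' := by
    have half : ∀ k k', o.K.Adj k k' → k ∉ o.X → ∃ a b, (a, b) ∈ darts G (R1 ∪ o.S) ∧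
      (a, b) ∉ darts G R1 ∧ G'.Adj a b ∧ q a = o.f k ∧ q b = o.f k' := by
      intro k k' hk hx
      obtain ⟨a, haS, ha⟩ := notX hx
      cases hb : o.f k' with
      | inl b =>
        have hab := o.hLL k k' a b hk ha hb
        have hbS : b ∈ o.S := mem_S.2 ⟨k', hb⟩
        refine ⟨a, b, ?_, ?_, hab, ?_, ?_⟩
        · rw [mem_darts]; exact ⟨Finset.mem_union_right _ haS, Finset.mem_union_right _ hbS, hle hab⟩
        · rw [mem_darts]; exact fun h => hS a haS h.1
        · rw [hq2 a (hS a haS), ha]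
        · rw [hq2 b (hS b hbS)]
      | inr y =>
        obtain ⟨r, hr, hry, hab⟩ := o.hLR k k' a y hk ha hb
        refine ⟨a, r, ?_, ?_, hab, ?_, ?_⟩
        · rw [mem_darts]; exact ⟨Finset.mem_union_right _ haS, Finset.mem_union_left _ hr, hle hab⟩
        · rw [mem_darts]; exact fun h => hS a haS h.1
        · rw [hq2 a (hS a haS), ha]
        · rw [hq1 r hr, hry]
    intro k k' hk
    simp only [KD, Finset.mem_sdiff, mem_darts, Finset.mem_univ, true_and] at hk
    by_cases hx : k ∈ o.X
    · have hx' : k' ∉ o.X := fun h => hk.2 ⟨hx, h, hk.1⟩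
      obtain ⟨a, b, h1, h2, h3, h4, h5⟩ := half k' k hk.1.symm hx'
      rw [mem_darts] at h1 h2
      refine ⟨b, a, ?_, ?_, h3.symm, h5, h4⟩
      · rw [mem_darts]; exact ⟨h1.2.1, h1.1, h1.2.2.symm⟩
      · rw [mem_darts]; exact fun h => h2 ⟨h.2.1, h.1, h.2.2.symm⟩
    · exact half k k' hk.1 hx
  have := count_lemma (G := G) o.disj T (fun p hp => ⟨(hT p hp).1, (hT p hp).2.1⟩) KD q o.f o.inj (by
    intro k k' hk
    obtain ⟨a, b, h1, h2, h3, h4, h5⟩ := main k k' hk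
    refine ⟨a, b, h1, h2, ?_, h4, h5⟩
    intro hTT
    rcases (hT _ hTT).2.2 with h | h
    · exact h h3
    · refine h k k' ?_ h4 h5
      simp only [KD, Finset.mem_sdiff, mem_darts] at hk
      exact hk.1.2.2)
  have hc : (KD.card : ℤ) = (darts o.K Finset.univ).card - (darts o.K o.X).card := by
    have := Finset.card_sdiff_of_subset hsub
    have h2 := Finset.card_le_card hsub
    simp only [KD]; rw [this]; push_cast [h2]; ring
  have hm := o.card_SX
  rw [pot_eq]
  have hm' : (o.S.card : ℤ) + o.X.card = o.m := by exact_mod_cast hm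
  rw [hc] at this
  have e1 : pR o.K Finset.univ = 5 * (o.m : ℤ) - 2 * (darts o.K Finset.univ).card := by
    simp [pR]
  have e2 : pR o.K o.X = 5 * (o.X.card : ℤ) - 2 * (darts o.K o.X).card := rfl
  linarith

theorem count0 [DecidableEq V] (o : GlueOut G' R1 φ) (hle : G' ≤ G) :
    pR G (R1 ∪ o.S) ≤ pR G R1 + pot o.K - pR o.K o.X := by
  have := o.count hle ∅ (by simp)
  simpa using this

theorem dart5 : ∀ Y : Finset (Fin 5), Y.Nonempty →
    let d := ((Finset.univ : Finset (Fin 5 × Fin 5)).filter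
      (fun p => p.1 ∈ Y ∧ p.2 ∈ Y ∧ adj5 p.1 p.2)).card
    2 * d + 5 ≤ 5 * Y.card ∧ (Y.card ≠ 1 → Y.card ≠ 5 → 2 * d + 6 ≤ 5 * Y.card) ∧ d ≤ 10 := by
  decide +kernel

/-- potential of the part on the 5-cycle -/
theorem pX (o : GlueOut G' R1 φ) (hX : o.X.Nonempty) :
    5 ≤ pR o.K o.X ∧ (pR o.K o.X ≤ 5 → o.X.card = 1 ∨
      (∀ y y', adj5 y y' → ∃ k k', o.f k = Sum.inr y ∧ o.f k' = Sum.inr y' ∧ o.K.Adj k k')) := by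
  classical
  have hy : ∀ k ∈ o.X, ∃ y, o.f k = Sum.inr y := fun k hk => mem_X.1 hk
  let ρ : Fin o.m → Fin 5 := fun k => if h : ∃ y, o.f k = Sum.inr y then h.choose else 0
  have hρ : ∀ k ∈ o.X, o.f k = Sum.inr (ρ k) := by
    intro k hk
    have := hy k hk
    simp only [ρ, this, dif_pos]
    exact this.choose_spec
  have hinj : ∀ k ∈ o.X, ∀ k' ∈ o.X, ρ k = ρ k' → k = k' := by
    intro k hk k' hk' he
    apply o.inj
    rw [hρ k hk, hρ k' hk', he]
  let Y := o.X.image ρ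
  have hYc : Y.card = o.X.card := Finset.card_image_of_injOn (fun k hk k' hk' => hinj k hk k' hk')
  have hYn : Y.Nonempty := hX.image ρ
  obtain ⟨d1, d2, d3⟩ := dart5 Y hYn
  have hsub : (darts o.K o.X).image (fun p => (ρ p.1, ρ p.2)) ⊆
      ((Finset.univ : Finset (Fin 5 × Fin 5)).filter
      (fun p => p.1 ∈ Y ∧ p.2 ∈ Y ∧ adj5 p.1 p.2)) := by
    intro p hp
    obtain ⟨⟨k, k'⟩, hk, rfl⟩ := Finset.mem_image.1 hp
    obtain ⟨a, b, c⟩ := mem_darts.1 hk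
    simp only [Finset.mem_filter, Finset.mem_univ, true_and]
    exact ⟨Finset.mem_image_of_mem _ a, Finset.mem_image_of_mem _ b, o.hRR _ _ _ _ c (hρ _ a) (hρ _ b)⟩
  have hci : ((darts o.K o.X).image (fun p => (ρ p.1, ρ p.2))).card = (darts o.K o.X).card := by
    apply Finset.card_image_of_injOn
    rintro ⟨k, k'⟩ hk ⟨l, l'⟩ hl he
    obtain ⟨a, b, c⟩ := mem_darts.1 hk
    obtain ⟨a', b', c'⟩ := mem_darts.1 hl
    simp only [Prod.mk.injEq] at he
    exact Prod.ext (hinj _ a _ a' he.1) (hinj _ b _ b' he.2)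
  have hcard := Finset.card_le_card hsub
  rw [hci] at hcard
  set d := ((Finset.univ : Finset (Fin 5 × Fin 5)).filter
      (fun p => p.1 ∈ Y ∧ p.2 ∈ Y ∧ adj5 p.1 p.2)).card with hd
  have e2 : pR o.K o.X = 5 * (o.X.card : ℤ) - 2 * (darts o.K o.X).card := rfl
  rw [hYc] at d1 d2
  refine ⟨by rw [e2]; omega, fun h5 => ?_⟩
  by_cases c1 : o.X.card = 1
  · exact Or.inl c1
  right
  have c5 : o.X.card = 5 := by
    by_contra c5
    have := d2 c1 c5
    omega
  have hYu : Y = Finset.univ := by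
    apply Finset.eq_univ_of_card; rw [hYc, c5]; simp
  have heq := Finset.eq_of_subset_of_card_le hsub (by rw [hci]; omega)
  intro y y' hyy
  have : (y, y') ∈ (darts o.K o.X).image (fun p => (ρ p.1, ρ p.2)) := by
    rw [heq]; simp [hYu, hyy]
  obtain ⟨⟨k, k'⟩, hk, he⟩ := Finset.mem_image.1 this
  obtain ⟨a, b, c⟩ := mem_darts.1 hk
  simp only [Prod.mk.injEq] at he
  exact ⟨k, k', by rw [hρ k a, he.1], by rw [hρ k' b, he.2], c⟩

theorem S_nonempty (o : GlueOut G' R1 φ) : o.S.Nonempty := by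
  by_contra hc
  rw [Finset.not_nonempty_iff_eq_empty] at hc
  have hX : ∀ k, ∃ y, o.f k = Sum.inr y := by
    intro k
    by_contra h
    obtain ⟨a, ha, -⟩ := notX (fun hk => h (mem_X.1 hk))
    simp [hc] at ha
  choose y hy using hX
  exact o.crit.no ⟨y, fun a b hab => o.hRR a b _ _ hab (hy a) (hy b)⟩

theorem X_nonempty (o : GlueOut G' R1 φ) (hG : Crit G) (hle : G' ≤ G) (hR : R1.Nonempty) :
    o.X.Nonempty := by
  by_contra hc
  rw [Finset.not_nonempty_iff_eq_empty] at hc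
  have hX : ∀ k, ∃ a, o.f k = Sum.inl a := by
    intro k
    obtain ⟨a, -, ha⟩ := notX (o := o) (k := k) (by simp [hc])
    exact ⟨a, ha⟩
  choose a ha using hX
  obtain ⟨hs, -⟩ := hG.surj o.crit.no a (fun k k' h => o.inj (by rw [ha, ha, h]))
    (fun k k' h => hle (o.hLL k k' _ _ h (ha k) (ha k')))
  obtain ⟨r, hr⟩ := hR
  obtain ⟨k, hk⟩ := hs r
  exact o.hL k r (hk ▸ ha k) hr

/-- every vertex of `S` has a neighbour in `G'` -/
theorem S_adj {o : GlueOut G' R1 φ} {a : V} (ha : a ∈ o.S) : ∃ b c, b ≠ c ∧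
    (b ∈ o.S ∨ b ∈ R1) ∧ (c ∈ o.S ∨ c ∈ R1) ∧ G'.Adj a b ∧ G'.Adj a c := by
  obtain ⟨k, hk⟩ := mem_S.1 ha
  obtain ⟨k1, k2, hne, h1, h2⟩ := o.crit.two k
  have key : ∀ k', o.K.Adj k k' → ∃ b, (o.f k' = Sum.inl b ∨ (b ∈ R1 ∧ o.f k' = Sum.inr (φ b))) ∧
      (b ∈ o.S ∨ b ∈ R1) ∧ G'.Adj a b := by
    intro k' hk'
    cases hf : o.f k' with
    | inl b => exact ⟨b, Or.inl rfl, Or.inl (mem_S.2 ⟨k', hf⟩), o.hLL _ _ _ _ hk' hk hf⟩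
    | inr y =>
      obtain ⟨r, hr, hy, h⟩ := o.hLR _ _ _ _ hk' hk hf
      exact ⟨r, Or.inr ⟨hr, by rw [hy]⟩, Or.inr hr, h⟩
  obtain ⟨b, hb1, hb2, hb3⟩ := key k1 h1
  obtain ⟨c, hc1, hc2, hc3⟩ := key k2 h2
  refine ⟨b, c, ?_, hb2, hc2, hb3, hc3⟩
  rintro rfl
  apply hne
  apply o.inj
  rcases hb1 with hb1 | ⟨hb0, hb1⟩ <;> rcases hc1 with hc1 | ⟨hc0, hc1⟩
  · rw [hb1, hc1]
  · exact absurd hc0 (o.hL _ _ hb1)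
  · exact absurd hb0 (o.hL _ _ hc1)
  · rw [hb1, hc1]

theorem m_lt (o : GlueOut G' R1 φ) (O : Finset V) (hO : 6 ≤ O.card)
    (hOv : ∀ a ∈ O, a ∈ R1 ∨ ∀ b, ¬ G'.Adj a b) : o.m < Fintype.card V := by
  classical
  have hX : o.X.card ≤ 5 := by
    have hy : ∀ k ∈ o.X, ∃ y, o.f k = Sum.inr y := fun k hk => mem_X.1 hk
    have := Finset.card_le_card_of_injOn (s := o.X) (t := (Finset.univ : Finset (Fin 5)))
      (fun k => if h : ∃ y, o.f k = Sum.inr y then h.choose else 0) (fun _ _ => Finset.mem_univ _)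
      (by
        intro k hk k' hk' he
        have h1 := hy k hk
        have h2 := hy k' hk'
        simp only [h1, h2, dif_pos] at he
        apply o.inj
        rw [h1.choose_spec, h2.choose_spec, he])
    simpa using this
  have hd : Disjoint O o.S := by
    rw [Finset.disjoint_left]
    intro a ha hs
    rcases hOv a ha with h | h
    · exact Finset.disjoint_left.1 o.disj h hs
    · obtain ⟨b, c, -, -, -, hb, -⟩ := S_adj hs
      exact h b hb
  have := Finset.card_le_univ (O ∪ o.S)
  rw [Finset.card_union_of_disjoint hd] at this
  have := o.card_SX
  omega

end GlueOut
end glue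

section lemP
variable {V : Type} [Fintype V] [DecidableEq V] {G : SimpleGraph V}

/-- a proper subset has a colouring -/
theorem Crit.col_sub (hG : Crit G) {R : Finset V} (hR : R ≠ Finset.univ) :
    ∃ φ : V → Fin 5, ∀ a b, a ∈ R → b ∈ R → G.Adj a b → adj5 (φ a) (φ b) := by
  obtain ⟨s, hs⟩ : ∃ s, s ∉ R := by
    by_contra hc; push Not at hc; exact hR (Finset.eq_univ_iff_forall.2 hc)
  obtain ⟨t, ht⟩ := hG.ni s
  obtain ⟨g, hg⟩ := hG.del (fun c _ => c ∉ R) ht hs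
  exact ⟨g, fun a b ha hb hab => hg a b hab (by simpa using ha) (by simpa using hb)⟩

/-- in a triangle every two vertices are adjacent -/
theorem GlueOut.tri_card {G' : SimpleGraph V} {R1 : Finset V} {φ : V → Fin 5}
    (o : GlueOut G' R1 φ) (hK : o.m = 3 ∧ o.K = ⊤ ∧ pot o.K = 3) :
    (o.X.card = 2 → pR o.K o.X = 6) ∧ (∀ k k', k ≠ k' → o.K.Adj k k') := by
  have hadj : ∀ k k', k ≠ k' → o.K.Adj k k' := by
    intro k k' hk; rw [hK.2.1]; exact hk
  refine ⟨fun h2 => ?_, hadj⟩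
  obtain ⟨x, y, hxy, hX⟩ := Finset.card_eq_two.1 h2
  have : darts o.K o.X = {(x, y), (y, x)} := by
    ext ⟨a, b⟩
    simp only [mem_darts, hX, Finset.mem_insert, Finset.mem_singleton, Prod.mk.injEq]
    constructor
    · rintro ⟨h1 | h1, h3 | h3, h4⟩
      · exact absurd (h1.trans h3.symm) h4.ne
      · exact Or.inl ⟨h1, h3⟩
      · exact Or.inr ⟨h1, h3⟩
      · exact absurd (h1.trans h3.symm) h4.ne
    · rintro (⟨rfl, rfl⟩ | ⟨rfl, rfl⟩)
      · exact ⟨Or.inl rfl, Or.inr rfl, hadj _ _ hxy⟩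
      · exact ⟨Or.inr rfl, Or.inl rfl, hadj _ _ hxy.symm⟩
  unfold pR
  rw [this, h2, Finset.card_pair (by simp [hxy])]
  norm_num

theorem SmallestCex.lemP (h : SmallestCex G) : ∀ n, ∀ R : Finset V, (Rᶜ).card = n → 6 ≤ R.card →
    R ≠ Finset.univ → pR G R ≤ 4 → 4 ≤ pR G R ∧ ∃ s s', s ∉ R ∧ s' ∉ R ∧
      (∀ t, t ∉ R → t = s ∨ t = s') ∧ G.Adj s s' ∧ (∃ r, ∀ t, G.Adj s t → t = s' ∨ t = r) ∧
      (∃ r, ∀ t, G.Adj s' t → t = s ∨ t = r) := by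
  intro n
  induction n using Nat.strong_induction_on with
  | _ n ih =>
  intro R hn h6 hR hp
  obtain ⟨φ, hφ⟩ := h.crit.col_sub hR
  obtain ⟨o⟩ := exists_glue G R φ hφ (fun g hg _ => h.crit.no ⟨g, hg⟩)
  have hRne : R.Nonempty := Finset.card_pos.1 (by omega)
  have hXn := o.X_nonempty h.crit le_rfl hRne
  have hm := o.m_lt R h6 (fun a ha => Or.inl ha)
  have hc := o.count0 (G := G) le_rfl
  have hS := o.S_nonempty
  obtain ⟨hx5, hx5'⟩ := o.pX hXn
  have hcard : R.card + o.S.card = (R ∪ o.S).card := (Finset.card_union_of_disjoint o.disj).symm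
  have hSp : 0 < o.S.card := Finset.card_pos.2 hS
  have hlow : (R ∪ o.S ≠ Finset.univ → 4 ≤ pR G (R ∪ o.S)) ∧ 2 ≤ pR G (R ∪ o.S) := by
    have a1 : R ∪ o.S ≠ Finset.univ → 4 ≤ pR G (R ∪ o.S) := by
      intro hne
      by_contra hlt
      have := ih ((R ∪ o.S)ᶜ).card (by
        rw [← hn, Finset.card_compl, Finset.card_compl]
        have := Finset.card_le_univ (R ∪ o.S)
        omega) (R ∪ o.S) rfl (by omega) hne (by omega)
      omega
    refine ⟨a1, ?_⟩
    by_cases hu : R ∪ o.S = Finset.univ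
    · rw [hu]; exact h.two_le
    · have := a1 hu; omega
  rcases h.cls3 o.crit hm with ⟨c1, -⟩ | ⟨-, c2, -⟩ | c3
  · omega
  · omega
  · have hu : R ∪ o.S = Finset.univ := by
      by_contra hne
      have := hlow.1 hne
      have := c3.2.2
      omega
    have hp4 : 4 ≤ pR G R := by have := c3.2.2; omega
    refine ⟨hp4, ?_⟩
    have hsx := o.card_SX
    have hm3 := c3.1
    have hXp : 0 < o.X.card := Finset.card_pos.2 hXn
    have hX1 : o.X.card = 1 := by
      by_contra hne
      have : o.X.card = 2 := by omega
      have := (o.tri_card c3).1 this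
      have := c3.2.2
      omega
    obtain ⟨s, s', hss, hSS⟩ := Finset.card_eq_two.1 (show o.S.card = 2 by omega)
    have hsS : s ∈ o.S := by rw [hSS]; simp
    have hsS' : s' ∈ o.S := by rw [hSS]; simp
    have hsR : s ∉ R := fun hh => Finset.disjoint_left.1 o.disj hh hsS
    have hsR' : s' ∉ R := fun hh => Finset.disjoint_left.1 o.disj hh hsS'
    have hcov : ∀ t, t ∉ R → t = s ∨ t = s' := by
      intro t ht
      have : t ∈ R ∪ o.S := by rw [hu]; exact Finset.mem_univ _
      rcases Finset.mem_union.1 this with h1 | h1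
      · exact absurd h1 ht
      · rw [hSS] at h1; simpa using h1
    have hadj : G.Adj s s' := by
      obtain ⟨k, hk⟩ := GlueOut.mem_S.1 hsS
      obtain ⟨k', hk'⟩ := GlueOut.mem_S.1 hsS'
      refine o.hLL k k' s s' ((o.tri_card c3).2 k k' ?_) hk hk'
      rintro rfl
      rw [hk] at hk'
      exact hss (Sum.inl.inj hk')
    -- degrees
    classical
    let N := R.filter (fun t => G.Adj s t)
    let N' := R.filter (fun t => G.Adj s' t)
    have e1 : pR G (insert s' R) ≤ pR G R + 5 - 4 * (N'.card : ℤ) :=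
      pR_insert hsR' (Finset.filter_subset _ _) (fun n hn => (Finset.mem_filter.1 hn).2)
    have e2 : pR G (insert s (insert s' R)) ≤ pR G (insert s' R) + 5 - 4 * ((insert s' N).card : ℤ) :=
      pR_insert (by simp [hss, hsR])
        (Finset.insert_subset_insert _ (Finset.filter_subset _ _))
        (by
          intro t ht
          rcases Finset.mem_insert.1 ht with rfl | ht
          · exact hadj
          · exact (Finset.mem_filter.1 ht).2)
    have e3 : insert s (insert s' R) = Finset.univ := by
      rw [Finset.eq_univ_iff_forall]
      intro t
      by_cases ht : t ∈ R
      · simp [ht]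
      · rcases hcov t ht with rfl | rfl <;> simp
    have e4 : (insert s' N).card = N.card + 1 := Finset.card_insert_of_notMem (by
      simp [N, hsR'])
    rw [e3, e4] at e2
    have e5 := h.two_le
    have hle : N.card + N'.card ≤ 2 := by push_cast at e2; omega
    have hpos : ∀ s s', s ∉ R → (∀ t, t ∉ R → t = s ∨ t = s') →
        0 < (R.filter (fun t => G.Adj s t)).card := by
      intro s s' hsR hcov
      obtain ⟨a, b, hab, ha, hb⟩ := h.crit.two s
      apply Finset.card_pos.2
      by_cases haR : a ∈ R
      · exact ⟨a, by simp [haR, ha]⟩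
      · by_cases hbR : b ∈ R
        · exact ⟨b, by simp [hbR, hb]⟩
        · exfalso
          have ha' := (hcov a haR).resolve_left ha.ne'
          have hb' := (hcov b hbR).resolve_left hb.ne'
          exact hab (ha'.trans hb'.symm)
    have p1 : 0 < N.card := hpos s s' hsR hcov
    have p2 : 0 < N'.card := hpos s' s hsR' (fun t ht => (hcov t ht).symm)
    obtain ⟨r, hr⟩ := Finset.card_eq_one.1 (show N.card = 1 by omega)
    obtain ⟨r', hr'⟩ := Finset.card_eq_one.1 (show N'.card = 1 by omega)
    refine ⟨s, s', hsR, hsR', hcov, hadj, ⟨r, ?_⟩, ⟨r', ?_⟩⟩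
    · intro t ht
      by_cases htR : t ∈ R
      · right
        have : t ∈ N := by simp [N, htR, ht]
        rw [hr] at this; simpa using this
      · exact Or.inl ((hcov t htR).resolve_left ht.ne')
    · intro t ht
      by_cases htR : t ∈ R
      · right
        have : t ∈ N' := by simp [N', htR, ht]
        rw [hr'] at this; simpa using this
      · exact Or.inl ((hcov t htR).resolve_right ht.ne')

theorem SmallestCex.P4 (h : SmallestCex G) {R : Finset V} (h6 : 6 ≤ R.card)
    (hR : R ≠ Finset.univ) : 4 ≤ pR G R := by
  by_contra hc
  have := (h.lemP _ R rfl h6 hR (by omega)).1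
  omega

theorem SmallestCex.P2 (h : SmallestCex G) {R : Finset V} (h6 : 6 ≤ R.card) : 2 ≤ pR G R := by
  by_cases hR : R = Finset.univ
  · rw [hR]; exact h.two_le
  · have := h.P4 h6 hR; omega

theorem SmallestCex.Pstr (h : SmallestCex G) {R : Finset V} (h6 : 6 ≤ R.card)
    {x : V} (hx : x ∉ R) (hp : pR G R ≤ 4) : ∃ s s', s ∉ R ∧ s' ∉ R ∧
      (∀ t, t ∉ R → t = s ∨ t = s') ∧ G.Adj s s' ∧ (∃ r, ∀ t, G.Adj s t → t = s' ∨ t = r) ∧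
      (∃ r, ∀ t, G.Adj s' t → t = s ∨ t = r) :=
  (h.lemP _ R rfl h6 (by rintro rfl; simp at hx) hp).2

/-- three missing vertices force potential at least five -/
theorem SmallestCex.P5 (h : SmallestCex G) {R : Finset V} (h6 : 6 ≤ R.card)
    {x y z : V} (hx : x ∉ R) (hy : y ∉ R) (hz : z ∉ R) (hxy : x ≠ y) (hxz : x ≠ z) (hyz : y ≠ z) :
    5 ≤ pR G R := by
  by_contra hc
  obtain ⟨s, s', -, -, hcov, -⟩ := h.Pstr h6 hx (by omega)
  rcases hcov x hx with rfl | rfl <;> rcases hcov y hy with rfl | rfl <;>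
    rcases hcov z hz with rfl | rfl <;> simp_all

end lemP

section conf
variable {V : Type} {G : SimpleGraph V}

/-- no closed walk of length five through `v` -/
def No5 (G : SimpleGraph V) (v : V) : Prop :=
  ∀ p q r s, G.Adj v p → G.Adj p q → G.Adj q r → G.Adj r s → G.Adj s v → False

theorem no5_of (hT : ∀ a b c, G.Adj a b → G.Adj b c → G.Adj a c → False) {v : V}
    (h : ¬ InFiveCycle G v) : No5 G v := by
  intro p q r s h1 h2 h3 h4 h5
  apply h
  have e1 : v ≠ q := by rintro rfl; exact hT _ _ _ h3 h4 h5.symm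
  have e2 : v ≠ r := by rintro rfl; exact hT _ _ _ h1 h2 h3.symm
  have e3 : p ≠ r := by rintro rfl; exact hT _ _ _ h1 h4 h5.symm
  have e4 : p ≠ s := by rintro rfl; exact hT _ _ _ h2 h3 h4.symm
  have e5 : q ≠ s := by rintro rfl; exact hT _ _ _ h1 h2 h5.symm
  refine ⟨v, .cons h1 (.cons h2 (.cons h3 (.cons h4 (.cons h5 .nil)))), ?_, rfl, by simp⟩
  rw [Walk.isCycle_def]
  refine ⟨?_, by simp, ?_⟩
  · rw [Walk.isTrail_def]
    simp only [Walk.edges_cons, Walk.edges_nil, List.nodup_cons, List.mem_cons, List.not_mem_nil,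
      Sym2.eq_iff, List.nodup_nil]
    have := h1.ne; have := h2.ne; have := h3.ne; have := h4.ne; have := h5.ne
    grind
  · simp only [Walk.support_cons, Walk.support_nil, List.tail_cons, List.nodup_cons, List.mem_cons,
      List.not_mem_nil, List.nodup_nil]
    have := h1.ne; have := h2.ne; have := h3.ne; have := h4.ne; have := h5.ne
    grind

theorem deg2_iff {x a b : V} (hd : deg G x = 2) (ha : G.Adj x a) (hb : G.Adj x b) (hab : a ≠ b) :
    ∀ t, G.Adj x t ↔ t = a ∨ t = b := by
  obtain ⟨c, d, hcd, hs⟩ := Set.ncard_eq_two.1 hd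
  have : ∀ t, G.Adj x t ↔ t = c ∨ t = d := by
    intro t; rw [← mem_neighborSet, hs]; simp
  grind

theorem deg3_ex {x a : V} (hd : deg G x = 3) (ha : G.Adj x a) : ∃ b c, a ≠ b ∧ a ≠ c ∧ b ≠ c ∧
    ∀ t, G.Adj x t ↔ t = a ∨ t = b ∨ t = c := by
  obtain ⟨c, d, e, h1, h2, h3, hs⟩ := Set.ncard_eq_three.1 hd
  have this : ∀ t, G.Adj x t ↔ t = c ∨ t = d ∨ t = e := by
    intro t; rw [← mem_neighborSet, hs]; simp
  rcases (this a).1 ha with rfl | rfl | rfl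
  · exact ⟨d, e, h1, h2, h3, this⟩
  · exact ⟨c, e, h1.symm, h3, h2, by grind⟩
  · exact ⟨c, d, h2.symm, h3.symm, h1, by grind⟩

theorem deg_iff_of_card [Finite V] {x : V} {s : Finset V} (hd : deg G x = s.card)
    (hs : ∀ t ∈ s, G.Adj x t) : ∀ t, G.Adj x t ↔ t ∈ s := by
  have h1 : (↑s : Set V) ⊆ G.neighborSet x := fun t ht => hs t ht
  have h2 : (↑s : Set V) = G.neighborSet x :=
    Set.eq_of_subset_of_ncard_le h1 (by rw [Set.ncard_coe_finset]; exact hd.le) (Set.toFinite _)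
  intro t
  rw [← mem_neighborSet, ← h2]; simp

theorem deg_ge3 {x : V} (hd : 3 ≤ deg G x) : ∀ r r', ∃ t, G.Adj x t ∧ t ≠ r ∧ t ≠ r' := by
  intro r r'
  by_contra hc
  push Not at hc
  have h1 : G.neighborSet x ⊆ {r, r'} := by
    intro t ht
    by_cases h : t = r
    · simp [h]
    · simp [hc t ht h]
  have := Set.ncard_le_ncard h1 (Set.toFinite _)
  have := Set.ncard_insert_le r {r'}
  simp at this
  unfold deg at hd
  omega

theorem str2 {v u : V} (p : G.Walk v u) (hp : IsString G p) (hl : p.length = 2) :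
    G.Adj v (p.getVert 1) ∧ v ≠ u ∧ 3 ≤ deg G u ∧ deg G (p.getVert 1) = 2 ∧
      (∀ t, G.Adj (p.getVert 1) t ↔ t = v ∨ t = u) := by
  obtain ⟨h1, h2, h3, h4, h5⟩ := hp
  match u, p, hl with
  | u, .cons ha (.cons hb .nil), _ =>
    simp only [Walk.cons_isPath_iff, Walk.support_cons, Walk.support_nil] at h1 h5
    have hvu : v ≠ u := by simp at h1; grind
    have hd : deg G _ = 2 := h5 _ (by simp) ha.ne' hb.ne
    refine ⟨by simpa using ha, hvu, h4, by simpa using hd, ?_⟩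
    simpa using deg2_iff hd ha.symm hb hvu

theorem str3 {v u : V} (p : G.Walk v u) (hp : IsString G p) (hl : p.length = 3) :
    ∃ y', G.Adj v (p.getVert 1) ∧ v ≠ u ∧ y' ≠ v ∧ p.getVert 1 ≠ u ∧ 3 ≤ deg G u ∧ 
      deg G (p.getVert 1) = 2 ∧ deg G y' = 2 ∧
      (∀ t, G.Adj (p.getVert 1) t ↔ t = v ∨ t = y') ∧ 
      (∀ t, G.Adj y' t ↔ t = p.getVert 1 ∨ t = u) := by
  obtain ⟨h1, h2, h3, h4, h5⟩ := hp
  match u, p, hl with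
  | u, .cons (v := x) ha (.cons (v := y) hb (.cons hc .nil)), _ =>
    simp only [Walk.cons_isPath_iff, Walk.support_cons, Walk.support_nil] at h1 h5
    simp at h1
    have hvu : v ≠ u := by grind
    have hvy : v ≠ y := by grind
    have hxu : x ≠ u := by grind
    have hd : deg G x = 2 := h5 _ (by simp) ha.ne' hxu
    have hd' : deg G y = 2 := h5 _ (by simp) hvy.symm hc.ne
    refine ⟨y, by simpa using ha, hvu, hvy.symm, by simpa using hxu, h4, by simpa using hd, hd', ?_, ?_⟩
    · simpa using deg2_iff hd ha.symm hb hvy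
    · simpa using deg2_iff hd' hb.symm hc hxu

/-- the rest of a `(1,1,1)`-vertex -/
def Cs3 (G : SimpleGraph V) (v x1 x2 x3 u3 : V) : Prop :=
  x3 ≠ x1 ∧ x3 ≠ x2 ∧ v ≠ u3 ∧ (∀ t, G.Adj v t ↔ t = x1 ∨ t = x2 ∨ t = x3) ∧
  (∀ t, G.Adj x3 t ↔ t = v ∨ t = u3) ∧ (∀ r r', ∃ t, G.Adj u3 t ∧ t ≠ r ∧ t ≠ r')

/-- the rest of a `(2,2,1,1)`-vertex -/
def Cs4 (G : SimpleGraph V) (v x1 x2 y y' e z z' f : V) : Prop :=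
  y ≠ z ∧ y ≠ x1 ∧ y ≠ x2 ∧ z ≠ x1 ∧ z ≠ x2 ∧ v ≠ e ∧ v ≠ f ∧ y' ≠ v ∧ z' ≠ v ∧ y ≠ e ∧ z ≠ f ∧
  (∀ t, G.Adj v t ↔ t = x1 ∨ t = x2 ∨ t = y ∨ t = z) ∧
  (∀ t, G.Adj y t ↔ t = v ∨ t = y') ∧ (∀ t, G.Adj y' t ↔ t = y ∨ t = e) ∧
  (∀ t, G.Adj z t ↔ t = v ∨ t = z') ∧ (∀ t, G.Adj z' t ↔ t = z ∨ t = f) ∧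
  (∀ r r', ∃ t, G.Adj e t ∧ t ≠ r ∧ t ≠ r') ∧ (∀ r r', ∃ t, G.Adj f t ∧ t ≠ r ∧ t ≠ r')

structure Conf (G : SimpleGraph V) (v x1 x2 u1 u2 a1 b1 a2 b2 : V) : Prop where
  hT : ∀ a b c, G.Adj a b → G.Adj b c → G.Adj a c → False
  nx1 : ∀ t, G.Adj x1 t ↔ t = v ∨ t = u1
  nx2 : ∀ t, G.Adj x2 t ↔ t = v ∨ t = u2
  nu1 : ∀ t, G.Adj u1 t ↔ t = x1 ∨ t = a1 ∨ t = b1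
  nu2 : ∀ t, G.Adj u2 t ↔ t = x2 ∨ t = a2 ∨ t = b2
  vu1 : v ≠ u1
  vu2 : v ≠ u2
  xx : x1 ≠ x2
  uu : u1 ≠ u2
  xa1 : x1 ≠ a1
  xb1 : x1 ≠ b1
  ab1 : a1 ≠ b1
  xa2 : x2 ≠ a2
  xb2 : x2 ≠ b2
  ab2 : a2 ≠ b2
  n5v : No5 G v
  n5u1 : No5 G u1
  n5u2 : No5 G u2
  cs : (∃ x3 u3, Cs3 G v x1 x2 x3 u3) ∨ (∃ y y' e z z' f, Cs4 G v x1 x2 y y' e z z' f)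

end conf

theorem exists_conf {V : Type} [Fintype V] {G : SimpleGraph V}
    (h : SmallestCex G) (v : V)
    (hv : IsVertex4 G v 2 2 1 1 ∨ IsVertex3 G v 1 1 1)
    (hnc : ¬ InFiveCycle G v) 
    (hno : ∀ x1 x2 u1 u2 a1 b1 a2 b2, Conf G v x1 x2 u1 u2 a1 b1 a2 b2 → False) :
    {u : V | (∃ p : G.Walk v u, IsString G p ∧ p.length = 2) ∧ deg G u = 3 ∧
      ¬ InFiveCycle G u}.Subsingleton := by
  classical
  rintro u1 ⟨⟨p1, s1, l1⟩, d1, n1⟩ u2 ⟨⟨p2, s2, l2⟩, d2, n2⟩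
  by_contra hu
  have hT : ∀ a b c, G.Adj a b → G.Adj b c → G.Adj a c → False :=
    fun a b c h1 h2 h3 => h.no_tri h1 h2 h3.symm
  obtain ⟨vx1, vu1, -, -, nx1⟩ := str2 p1 s1 l1
  obtain ⟨vx2, vu2, -, -, nx2⟩ := str2 p2 s2 l2
  generalize p1.getVert 1 = x1 at *
  generalize p2.getVert 1 = x2 at *
  have xx : x1 ≠ x2 := by
    rintro rfl
    have := (nx1 u2).1 ((nx2 u2).2 (Or.inr rfl))
    grind
  obtain ⟨a1, b1, xa1, xb1, ab1, nu1⟩ := deg3_ex d1 ((nx1 u1).2 (Or.inr rfl)).symm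
  obtain ⟨a2, b2, xa2, xb2, ab2, nu2⟩ := deg3_ex d2 ((nx2 u2).2 (Or.inr rfl)).symm
  apply hno x1 x2 u1 u2 a1 b1 a2 b2
  refine ⟨fun a b c => ?_, nx1, nx2, nu1, nu2, vu1, vu2, xx, hu, xa1, xb1, ab1, xa2, xb2, ab2,
    no5_of ?_ hnc, no5_of ?_ n1, no5_of ?_ n2, ?_⟩
  · exact fun ha hb hc => hT _ _ _ ha hb hc
  · exact fun a b c ha hb hc => hT _ _ _ ha hb hc
  · exact fun a b c ha hb hc => hT _ _ _ ha hb hc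
  · exact fun a b c ha hb hc => hT _ _ _ ha hb hc
  rcases hv with ⟨dv, e, f, g3, g4, q1, q2, q3, q4, r1, r2, r3, r4, n12, n13, n14, n23, n24, n34,
    m1, m2, m3, m4⟩ | ⟨dv, g1, g2, g3, q1, q2, q3, r1, r2, r3, n12, n13, n23, m1, m2, m3⟩
  · right
    obtain ⟨y', vy, ve, yv, ye, de, dy, dy', ny, ny'⟩ := str3 q1 r1 m1
    obtain ⟨z', vz, vf, zv, zf, df, dz, dz', nz, nz'⟩ := str3 q2 r2 m2
    obtain ⟨v3, -, -, -, -⟩ := str2 q3 r3 m3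
    obtain ⟨v4, -, -, -, -⟩ := str2 q4 r4 m4
    generalize q1.getVert 1 = y at *
    generalize q2.getVert 1 = z at *
    generalize q3.getVert 1 = w3 at *
    generalize q4.getVert 1 = w4 at *
    have nv := deg_iff_of_card (G := G) (x := v) (s := {y, z, w3, w4}) (by
      rw [dv, Finset.card_insert_of_notMem, Finset.card_insert_of_notMem, Finset.card_pair n34] <;>
      simp_all) (by simp_all)
    simp only [Finset.mem_insert, Finset.mem_singleton] at nv
    have k1 : ∀ x u, (∀ t, G.Adj x t ↔ t = v ∨ t = u) → v ≠ u → deg G u = 3 → x ≠ y ∧ x ≠ z := by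
      intro x u hx hvu hd
      constructor
      · rintro rfl
        have := (ny u).1 ((hx u).2 (Or.inr rfl))
        have : u = y' := by grind
        subst this; omega
      · rintro rfl
        have := (nz u).1 ((hx u).2 (Or.inr rfl))
        have : u = z' := by grind
        subst this; omega
    obtain ⟨c1, c2⟩ := k1 x1 u1 nx1 vu1 d1
    obtain ⟨c3, c4⟩ := k1 x2 u2 nx2 vu2 d2
    have hx1 := (nv x1).1 vx1
    have hx2 := (nv x2).1 vx2
    refine ⟨y, y', e, z, z', f, n12, c1.symm, c3.symm, c2.symm, c4.symm, ve, vf, yv, zv, ye, zf,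
      ?_, ny, ny', nz, nz', deg_ge3 de, deg_ge3 df⟩
    intro t
    rw [nv t]
    grind
  · left
    obtain ⟨v1, b1, c1, -, d1⟩ := str2 q1 r1 m1
    obtain ⟨v2, b2, c2, -, d2⟩ := str2 q2 r2 m2
    obtain ⟨v3, b3, c3, -, d3⟩ := str2 q3 r3 m3
    generalize q1.getVert 1 = w1 at *
    generalize q2.getVert 1 = w2 at *
    generalize q3.getVert 1 = w3 at *
    have nv := deg_iff_of_card (G := G) (x := v) (s := {w1, w2, w3}) (by
      rw [dv, Finset.card_insert_of_notMem, Finset.card_pair n23]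
      simp_all) (by simp_all)
    simp only [Finset.mem_insert, Finset.mem_singleton] at nv
    have hx1 := (nv x1).1 vx1
    have hx2 := (nv x2).1 vx2
    have key : ∀ w g, w ≠ x1 → w ≠ x2 → G.Adj v w → 3 ≤ deg G g → v ≠ g →
        (∀ t, G.Adj w t ↔ t = v ∨ t = g) → ∃ x3 u3, Cs3 G v x1 x2 x3 u3 := by
      intro w g h1 h2 h3 h4 h5 h6
      refine ⟨w, g, h1, h2, h5, ?_, h6, deg_ge3 h4⟩
      have := (nv w).1 h3
      intro t; rw [nv t]; grind
    by_cases e1 : w1 = x1 ∨ w1 = x2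
    · by_cases e2 : w2 = x1 ∨ w2 = x2
      · exact key w3 g3 (by grind) (by grind) v3 c3 b3 d3
      · exact key w2 g2 (by grind) (by grind) v2 c2 b2 d2
    · exact key w1 g1 (by grind) (by grind) v1 c1 b1 d1

section pcol
variable {V : Type} {G : SimpleGraph V}

/-- colouring respecting all edges that avoid the list `W` -/
def PCol (G : SimpleGraph V) (W : List V) (g : V → Fin 5) : Prop :=
  ∀ c d, G.Adj c d → c ∉ W → d ∉ W → adj5 (g c) (g d)

theorem PCol.mono {W W' : List V} {g : V → Fin 5} (h : PCol G W g) (hW : ∀ t ∈ W, t ∈ W') :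
    PCol G W' g :=
  fun c d hcd hc hd => h c d hcd (fun h1 => hc (hW _ h1)) (fun h1 => hd (hW _ h1))

theorem PCol.ext [DecidableEq V] {W : List V} {s : V} {g : V → Fin 5} (h : PCol G (s :: W) g)
    (k : Fin 5) (hk : ∀ t, G.Adj s t → t ∉ W → adj5 k (g t)) :
    PCol G W (Function.update g s k) := by
  intro c d hcd hc hd
  by_cases h1 : c = s
  · subst h1
    rw [Function.update_self, Function.update_of_ne hcd.ne']
    exact hk d hcd hd
  · by_cases h2 : d = s
    · subst h2
      rw [Function.update_self, Function.update_of_ne hcd.ne]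
      exact adj5_symm (hk c hcd.symm hc)
    · rw [Function.update_of_ne h1, Function.update_of_ne h2]
      exact h c d hcd (by simp [h1, hc]) (by simp [h2, hd])

theorem PCol.done {g : V → Fin 5} (hG : ¬ HasCol G) (h : PCol G [] g) : False :=
  hG ⟨g, fun a b hab => h a b hab (by simp) (by simp)⟩

theorem mid5 : ∀ c d : Fin 5, ¬ adj5 c d → ∃ x, adj5 x c ∧ adj5 x d := by decide

/-- no twins of degree two -/
theorem Crit.no_twin (hG : Crit G) {x x' v u : V} (hxx : x ≠ x')
    (h1 : ∀ t, G.Adj x t ↔ t = v ∨ t = u) (h2 : ∀ t, G.Adj x' t ↔ t = v ∨ t = u) : False := by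
  classical
  obtain ⟨g, hg⟩ := hG.del (fun c _ => c = x') ((h2 v).2 (Or.inl rfl)) rfl
  have hp : PCol G [x'] g := by
    intro c d hcd hc hd
    exact hg c d hcd (by simpa using hc) (by simpa using hd)
  refine PCol.done hG.no (hp.ext (g x) ?_)
  intro t ht _
  have h3 : G.Adj x t := (h1 t).2 ((h2 t).1 ht)
  have : ¬ G.Adj x x' := by
    intro h4
    rcases (h1 x').1 h4 with rfl | rfl
    · exact G.irrefl ((h2 x').2 (Or.inl rfl))
    · exact G.irrefl ((h2 x').2 (Or.inr rfl))
  exact hg x t h3 hxx (by rintro rfl; exact this h3)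

end pcol

section conf2
variable {V : Type} {G : SimpleGraph V} {v x1 x2 u1 u2 a1 b1 a2 b2 : V}

namespace Conf

theorem swap (C : Conf G v x1 x2 u1 u2 a1 b1 a2 b2) : Conf G v x2 x1 u2 u1 a2 b2 a1 b1 := by
  refine ⟨C.hT, C.nx2, C.nx1, C.nu2, C.nu1, C.vu2, C.vu1, C.xx.symm, C.uu.symm, C.xa2, C.xb2,
    C.ab2, C.xa1, C.xb1, C.ab1, C.n5v, C.n5u2, C.n5u1, ?_⟩
  rcases C.cs with ⟨x3, u3, h1, h2, h3, h4, h5⟩ | ⟨y, y', e, z, z', f, h⟩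
  · exact Or.inl ⟨x3, u3, h2, h1, h3, fun t => by rw [h4 t]; tauto, h5⟩
  · obtain ⟨e1, e2, e3, e4, e5, e6, e7, e8, e9, e10, e11, e12, e13⟩ := h
    exact Or.inr ⟨y, y', e, z, z', f, e1, e3, e2, e5, e4, e6, e7, e8, e9, e10, e11,
      fun t => by rw [e12 t]; tauto, e13⟩

theorem sw1 (C : Conf G v x1 x2 u1 u2 a1 b1 a2 b2) : Conf G v x1 x2 u1 u2 b1 a1 a2 b2 :=
  ⟨C.hT, C.nx1, C.nx2, fun t => by rw [C.nu1 t]; tauto, C.nu2, C.vu1, C.vu2, C.xx, C.uu, C.xb1, C.xa1,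
    C.ab1.symm, C.xa2, C.xb2, C.ab2, C.n5v, C.n5u1, C.n5u2, C.cs⟩

theorem sw2 (C : Conf G v x1 x2 u1 u2 a1 b1 a2 b2) : Conf G v x1 x2 u1 u2 a1 b1 b2 a2 :=
  C.swap.sw1.swap


theorem vx1 (C : Conf G v x1 x2 u1 u2 a1 b1 a2 b2) : G.Adj v x1 := ((C.nx1 v).2 (Or.inl rfl)).symm
theorem vx2 (C : Conf G v x1 x2 u1 u2 a1 b1 a2 b2) : G.Adj v x2 := ((C.nx2 v).2 (Or.inl rfl)).symm
theorem xu1 (C : Conf G v x1 x2 u1 u2 a1 b1 a2 b2) : G.Adj x1 u1 := (C.nx1 u1).2 (Or.inr rfl)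
theorem xu2 (C : Conf G v x1 x2 u1 u2 a1 b1 a2 b2) : G.Adj x2 u2 := (C.nx2 u2).2 (Or.inr rfl)
theorem ua1 (C : Conf G v x1 x2 u1 u2 a1 b1 a2 b2) : G.Adj u1 a1 := (C.nu1 a1).2 (by simp)
theorem ub1 (C : Conf G v x1 x2 u1 u2 a1 b1 a2 b2) : G.Adj u1 b1 := (C.nu1 b1).2 (by simp)
theorem ua2 (C : Conf G v x1 x2 u1 u2 a1 b1 a2 b2) : G.Adj u2 a2 := (C.nu2 a2).2 (by simp)
theorem ub2 (C : Conf G v x1 x2 u1 u2 a1 b1 a2 b2) : G.Adj u2 b2 := (C.nu2 b2).2 (by simp)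
theorem nvu1 (C : Conf G v x1 x2 u1 u2 a1 b1 a2 b2) : ¬ G.Adj v u1 := fun h => C.hT _ _ _ C.vx1 C.xu1 h
theorem nvu2 (C : Conf G v x1 x2 u1 u2 a1 b1 a2 b2) : ¬ G.Adj v u2 := fun h => C.hT _ _ _ C.vx2 C.xu2 h
theorem nuu (C : Conf G v x1 x2 u1 u2 a1 b1 a2 b2) : ¬ G.Adj u1 u2 := fun h => C.n5v _ _ _ _ C.vx1 C.xu1 h C.xu2.symm C.vx2.symm
theorem nxx (C : Conf G v x1 x2 u1 u2 a1 b1 a2 b2) : ¬ G.Adj x1 x2 := fun h => C.hT _ _ _ C.vx1 h C.vx2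
theorem nxu12 (C : Conf G v x1 x2 u1 u2 a1 b1 a2 b2) : ¬ G.Adj x1 u2 := fun h => by
  rcases (C.nx1 _).1 h with h | h
  · exact C.vu2 h.symm
  · exact C.uu h.symm
theorem nxu21 (C : Conf G v x1 x2 u1 u2 a1 b1 a2 b2) : ¬ G.Adj x2 u1 := C.swap.nxu12
theorem nab1 (C : Conf G v x1 x2 u1 u2 a1 b1 a2 b2) : ¬ G.Adj a1 b1 := fun h => C.hT _ _ _ C.ua1 h C.ub1
theorem nab2 (C : Conf G v x1 x2 u1 u2 a1 b1 a2 b2) : ¬ G.Adj a2 b2 := fun h => C.hT _ _ _ C.ua2 h C.ub2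

/-- five basic vertices are distinct -/
theorem dist5 (C : Conf G v x1 x2 u1 u2 a1 b1 a2 b2) : v ≠ x1 ∧ v ≠ x2 ∧ v ≠ u1 ∧ v ≠ u2 ∧ x1 ≠ x2 ∧ x1 ≠ u1 ∧ x1 ≠ u2 ∧ x2 ≠ u1 ∧
    x2 ≠ u2 ∧ u1 ≠ u2 := by
  refine ⟨C.vx1.ne, C.vx2.ne, C.vu1, C.vu2, C.xx, C.xu1.ne, ?_, ?_, C.xu2.ne, C.uu⟩
  · rintro rfl; exact C.nvu2 C.vx1
  · rintro rfl; exact C.nvu1 C.vx2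

theorem a1n (C : Conf G v x1 x2 u1 u2 a1 b1 a2 b2) : a1 ≠ v ∧ a1 ≠ x1 ∧ a1 ≠ x2 ∧ a1 ≠ u1 ∧ a1 ≠ u2 := by
  refine ⟨?_, C.xa1.symm, ?_, C.ua1.ne', ?_⟩
  · rintro rfl; exact C.nvu1 C.ua1.symm
  · rintro rfl; exact C.nxu21 C.ua1.symm
  · rintro rfl; exact C.nuu C.ua1
theorem b1n (C : Conf G v x1 x2 u1 u2 a1 b1 a2 b2) : b1 ≠ v ∧ b1 ≠ x1 ∧ b1 ≠ x2 ∧ b1 ≠ u1 ∧ b1 ≠ u2 := C.sw1.a1n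
theorem a2n (C : Conf G v x1 x2 u1 u2 a1 b1 a2 b2) : a2 ≠ v ∧ a2 ≠ x1 ∧ a2 ≠ x2 ∧ a2 ≠ u1 ∧ a2 ≠ u2 := by
  have := C.swap.a1n; tauto
theorem b2n (C : Conf G v x1 x2 u1 u2 a1 b1 a2 b2) : b2 ≠ v ∧ b2 ≠ x1 ∧ b2 ≠ x2 ∧ b2 ≠ u1 ∧ b2 ≠ u2 := C.sw2.a2n

theorem three1 (C : Conf G v x1 x2 u1 u2 a1 b1 a2 b2) : ∀ r r', ∃ t, G.Adj u1 t ∧ t ≠ r ∧ t ≠ r' := by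
  intro r r'
  by_contra hc
  push Not at hc
  have h1 := hc _ C.ua1
  have h2 := hc _ C.ub1
  have h3 := hc _ C.xu1.symm
  have := C.xa1; have := C.xb1; have := C.ab1
  by_cases k1 : a1 = r <;> by_cases k2 : b1 = r <;> by_cases k3 : x1 = r <;> grind

/-- other neighbours of `v` are not adjacent to `u1` -/
theorem nQ1 (C : Conf G v x1 x2 u1 u2 a1 b1 a2 b2) (hG : Crit G) {q : V} (hq : G.Adj v q) (hqu : G.Adj q u1) : q = x1 := by
  by_contra hne
  have hq2 : q ≠ x2 := by rintro rfl; exact C.nxu21 hqu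
  rcases C.cs with ⟨x3, u3, h1, h2, h3, h4, h5, h6⟩ | ⟨y, y', e, z, z', f, e1, e2, e3, e4, e5, e6, 
    e7, e8, e9, e10, e11, e12, e13, e14, e15, e16, e17, e18⟩
  · have : q = x3 := by have := (h4 q).1 hq; tauto
    subst this
    have : u1 = u3 := ((h5 u1).1 hqu).resolve_left C.vu1.symm
    subst this
    exact hG.no_twin h1 h5 C.nx1
  · rcases (e12 q).1 hq with rfl | rfl | rfl | rfl
    · exact hne rfl
    · exact hq2 rfl
    · have h1 := ((e13 u1).1 hqu).resolve_left C.vu1.symm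
      subst h1
      obtain ⟨t, ht, h2, h3⟩ := C.three1 q e
      have := (e14 t).1 ht
      tauto
    · have h1 := ((e15 u1).1 hqu).resolve_left C.vu1.symm
      subst h1
      obtain ⟨t, ht, h2, h3⟩ := C.three1 q f
      have := (e16 t).1 ht
      tauto

theorem nva1 (C : Conf G v x1 x2 u1 u2 a1 b1 a2 b2) (hG : Crit G) : ¬ G.Adj v a1 := fun h => C.xa1 (C.nQ1 hG h C.ua1.symm).symm
theorem nvb1 (C : Conf G v x1 x2 u1 u2 a1 b1 a2 b2) (hG : Crit G) : ¬ G.Adj v b1 := C.sw1.nva1 hG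
theorem nva2 (C : Conf G v x1 x2 u1 u2 a1 b1 a2 b2) (hG : Crit G) : ¬ G.Adj v a2 := C.swap.nva1 hG
theorem nvb2 (C : Conf G v x1 x2 u1 u2 a1 b1 a2 b2) (hG : Crit G) : ¬ G.Adj v b2 := C.sw2.nva2 hG

/-- neighbours of `v` have degree two -/
theorem Qdeg (C : Conf G v x1 x2 u1 u2 a1 b1 a2 b2) {q : V} (hq : G.Adj v q) : ∃ r, ∀ t, G.Adj q t → t = v ∨ t = r := by
  rcases C.cs with ⟨x3, u3, h1, h2, h3, h4, h5, h6⟩ | ⟨y, y', e, z, z', f, e1, e2, e3, e4, e5, e6, 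
    e7, e8, e9, e10, e11, e12, e13, e14, e15, e16, e17, e18⟩
  · rcases (h4 q).1 hq with rfl | rfl | rfl
    · exact ⟨u1, fun t ht => (C.nx1 t).1 ht⟩
    · exact ⟨u2, fun t ht => (C.nx2 t).1 ht⟩
    · exact ⟨u3, fun t ht => (h5 t).1 ht⟩
  · rcases (e12 q).1 hq with rfl | rfl | rfl | rfl
    · exact ⟨u1, fun t ht => (C.nx1 t).1 ht⟩
    · exact ⟨u2, fun t ht => (C.nx2 t).1 ht⟩
    · exact ⟨y', fun t ht => (e13 t).1 ht⟩
    · exact ⟨z', fun t ht => (e15 t).1 ht⟩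

theorem forb3 (C : Conf G v x1 x2 u1 u2 a1 b1 a2 b2) (hG : Crit G) {x3 u3 : V} (h3 : Cs3 G v x1 x2 x3 u3) {g : V → Fin 5}
    (hg : PCol G [v, x1, x2, u1, u2, x3] g) {c1 c2 y : Fin 5} (h1a : adj5 c1 (g a1))
    (h1b : adj5 c1 (g b1)) (h2a : adj5 c2 (g a2)) (h2b : adj5 c2 (g b2)) (hy1 : ¬ adj5 y c1)
    (hy2 : ¬ adj5 y c2) (hy3 : ¬ adj5 y (g u3)) : False := by
  classical
  obtain ⟨k1, k2, k3, k4, k5, k6⟩ := h3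
  have hv3 : G.Adj v x3 := (k4 x3).2 (by simp)
  have h3u : G.Adj x3 u3 := (k5 u3).2 (by simp)
  have n31 : u3 ≠ u1 := by rintro rfl; exact hG.no_twin k1 k5 C.nx1
  have n32 : u3 ≠ u2 := by rintro rfl; exact hG.no_twin k2 k5 C.nx2
  have nvu3 : ¬ G.Adj v u3 := fun h => C.hT _ _ _ hv3 h3u h
  have m1 : u3 ≠ x1 := by rintro rfl; exact nvu3 C.vx1
  have m2 : u3 ≠ x2 := by rintro rfl; exact nvu3 C.vx2
  obtain ⟨d1, d2, d3, d4, d5, d6, d7, d8, d9, d10⟩ := C.dist5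
  have p1 : x3 ≠ u1 := by rintro rfl; exact C.nvu1 hv3
  have p2 : x3 ≠ u2 := by rintro rfl; exact C.nvu2 hv3
  obtain ⟨z1, hz1, hz1'⟩ := mid5 _ _ hy1
  obtain ⟨z2, hz2, hz2'⟩ := mid5 _ _ hy2
  obtain ⟨z3, hz3, hz3'⟩ := mid5 _ _ hy3
  obtain ⟨qa, qb, qc, qd, qe⟩ := C.a2n
  obtain ⟨ra, rb, rc, rd, re⟩ := C.b2n
  have H1 : PCol G [u2, v, x1, x2, x3] (Function.update g u1 c1) := by
    refine (hg.mono (W' := [u1, u2, v, x1, x2, x3]) (by grind)).ext c1 ?_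
    intro t ht htW
    rcases (C.nu1 t).1 ht with rfl | rfl | rfl
    · simp at htW
    · exact h1a
    · exact h1b
  have H2 := H1.ext c2 (by
    intro t ht htW
    rcases (C.nu2 t).1 ht with rfl | rfl | rfl
    · simp at htW
    · rw [Function.update_of_ne (by grind)]; exact h2a
    · rw [Function.update_of_ne (by grind)]; exact h2b)
  have H3 := H2.ext y (by
    intro t ht htW
    rcases (k4 t).1 ht with rfl | rfl | rfl <;> simp at htW)
  have H4 := H3.ext z1 (by
    intro t ht htW
    rcases (C.nx1 t).1 ht with rfl | rfl
    · rw [Function.update_self]; exact hz1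
    · rw [Function.update_of_ne d3.symm, Function.update_of_ne d10, Function.update_self]
      exact hz1')
  have H5 := H4.ext z2 (by
    intro t ht htW
    rcases (C.nx2 t).1 ht with rfl | rfl
    · rw [Function.update_of_ne d1, Function.update_self]; exact hz2
    · rw [Function.update_of_ne d7.symm, Function.update_of_ne d4.symm, Function.update_self]
      exact hz2')
  have H6 := H5.ext z3 (by
    intro t ht htW
    rcases (k5 t).1 ht with rfl | rfl
    · rw [Function.update_of_ne d2, Function.update_of_ne d1, Function.update_self]; exact hz3
    · rw [Function.update_of_ne m2, Function.update_of_ne m1, Function.update_of_ne k3.symm,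
        Function.update_of_ne n32, Function.update_of_ne n31]
      exact hz3')
  exact H6.done hG.no

theorem forb4 (C : Conf G v x1 x2 u1 u2 a1 b1 a2 b2) (hG : Crit G) {q q' e z z' f : V} (h4 : Cs4 G v x1 x2 q q' e z z' f) {g : V → Fin 5}
    (hg : PCol G [v, x1, x2, u1, u2, q, q', z, z'] g) {c1 c2 y : Fin 5} (h1a : adj5 c1 (g a1))
    (h1b : adj5 c1 (g b1)) (h2a : adj5 c2 (g a2)) (h2b : adj5 c2 (g b2)) (hy1 : ¬ adj5 y c1)
    (hy2 : ¬ adj5 y c2) (hye : y ≠ g e) (hyf : y ≠ g f) : False := by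
  classical
  obtain ⟨e1, e2, e3, e4, e5, e6, e7, e8, e9, e10, e11, e12, e13, e14, e15, e16, e17, e18⟩ := h4
  have vq : G.Adj v q := (e12 q).2 (by simp)
  have vz : G.Adj v z := (e12 z).2 (by simp)
  have qq : G.Adj q q' := (e13 q').2 (by simp)
  have zz : G.Adj z z' := (e15 z').2 (by simp)
  have qe : G.Adj q' e := (e14 e).2 (by simp)
  have zf : G.Adj z' f := (e16 f).2 (by simp)
  have d2 : ∀ {s p r}, (∀ r r', ∃ t, G.Adj s t ∧ t ≠ r ∧ t ≠ r') →
    ¬ (∀ t, G.Adj s t ↔ t = p ∨ t = r) := by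
    intro s p r h1 h2
    obtain ⟨t, ht, k1, k2⟩ := h1 p r
    have := (h2 t).1 ht
    tauto
  have eu1 : e ≠ u1 := by
    rintro rfl; exact C.n5v _ _ _ _ C.vx1 C.xu1 qe.symm qq.symm vq.symm
  have eu2 : e ≠ u2 := by
    rintro rfl; exact C.n5v _ _ _ _ C.vx2 C.xu2 qe.symm qq.symm vq.symm
  have fu1 : f ≠ u1 := by
    rintro rfl; exact C.n5v _ _ _ _ C.vx1 C.xu1 zf.symm zz.symm vz.symm
  have fu2 : f ≠ u2 := by
    rintro rfl; exact C.n5v _ _ _ _ C.vx2 C.xu2 zf.symm zz.symm vz.symm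
  have ex1 : e ≠ x1 := by rintro rfl; exact d2 e17 C.nx1
  have ex2 : e ≠ x2 := by rintro rfl; exact d2 e17 C.nx2
  have fx1 : f ≠ x1 := by rintro rfl; exact d2 e18 C.nx1
  have fx2 : f ≠ x2 := by rintro rfl; exact d2 e18 C.nx2
  have eq' : e ≠ q' := qe.ne'
  have ez : e ≠ z := by rintro rfl; exact d2 e17 e15
  have ez' : e ≠ z' := by rintro rfl; exact d2 e17 e16
  have fz' : f ≠ z' := zf.ne'
  have fq : f ≠ q := by rintro rfl; exact d2 e18 e13
  have fq' : f ≠ q' := by rintro rfl; exact d2 e18 e14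
  have nq'z' : q' ≠ z' := by
    rintro rfl
    rcases (e14 z).1 zz.symm with h | h
    · exact e1 h.symm
    · exact ez h.symm
  have q'z : q' ≠ z := by
    rintro rfl
    exact C.hT _ _ _ vq qq vz
  have z'q : z' ≠ q := by
    rintro rfl
    exact C.hT _ _ _ vz zz vq
  have q'x1 : q' ≠ x1 := by rintro rfl; exact C.hT _ _ _ vq qq C.vx1
  have q'x2 : q' ≠ x2 := by rintro rfl; exact C.hT _ _ _ vq qq C.vx2
  have z'x1 : z' ≠ x1 := by rintro rfl; exact C.hT _ _ _ vz zz C.vx1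
  have z'x2 : z' ≠ x2 := by rintro rfl; exact C.hT _ _ _ vz zz C.vx2
  obtain ⟨d1, d2, d3, d4, d5, d6, d7, d8, d9, d10⟩ := C.dist5
  obtain ⟨w1, hw1, hw1'⟩ := mid5 _ _ hy1
  obtain ⟨w2, hw2, hw2'⟩ := mid5 _ _ hy2
  obtain ⟨w3, w3', hw3, hw3', hw3''⟩ := adj5_path3 _ _ hye
  obtain ⟨w4, w4', hw4, hw4', hw4''⟩ := adj5_path3 _ _ hyf
  obtain ⟨qa, qb, qc, qd, qe'⟩ := C.a2n
  obtain ⟨ra, rb, rc, rd, re⟩ := C.b2n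
  have H1 : PCol G [u2, v, x1, x2, q, q', z, z'] (Function.update g u1 c1) := by
    refine (hg.mono (W' := [u1, u2, v, x1, x2, q, q', z, z']) (by grind)).ext c1 ?_
    intro t ht htW
    rcases (C.nu1 t).1 ht with rfl | rfl | rfl
    · simp at htW
    · exact h1a
    · exact h1b
  have H2 := H1.ext c2 (by
    intro t ht htW
    rcases (C.nu2 t).1 ht with rfl | rfl | rfl
    · simp at htW
    · rw [Function.update_of_ne (by grind)]; exact h2a
    · rw [Function.update_of_ne (by grind)]; exact h2b)
  have H3 := H2.ext y (by
    intro t ht htW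
    rcases (e12 t).1 ht with rfl | rfl | rfl | rfl <;> simp at htW)
  have H4 := H3.ext w1 (by
    intro t ht htW
    rcases (C.nx1 t).1 ht with rfl | rfl
    · rw [Function.update_self]; exact hw1
    · rw [Function.update_of_ne d3.symm, Function.update_of_ne d10, Function.update_self]
      exact hw1')
  have H5 := H4.ext w2 (by
    intro t ht htW
    rcases (C.nx2 t).1 ht with rfl | rfl
    · rw [Function.update_of_ne d1, Function.update_self]; exact hw2
    · rw [Function.update_of_ne d7.symm, Function.update_of_ne d4.symm, Function.update_self]
      exact hw2')
  have H6 := H5.ext w3 (by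
    intro t ht htW
    rcases (e13 t).1 ht with rfl | rfl
    · rw [Function.update_of_ne d2, Function.update_of_ne d1, Function.update_self]
      exact adj5_symm hw3
    · simp at htW)
  have H7 := H6.ext w3' (by
    intro t ht htW
    rcases (e14 t).1 ht with rfl | rfl
    · rw [Function.update_self]
      exact adj5_symm hw3'
    · rw [Function.update_of_ne e10.symm, Function.update_of_ne ex2, Function.update_of_ne ex1,
        Function.update_of_ne e6.symm, Function.update_of_ne eu2, Function.update_of_ne eu1]
      exact hw3'')
  have H8 := H7.ext w4 (by
    intro t ht htW
    rcases (e15 t).1 ht with rfl | rfl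
    · rw [Function.update_of_ne e8.symm, Function.update_of_ne vq.ne, Function.update_of_ne d2,
        Function.update_of_ne d1, Function.update_self]
      exact adj5_symm hw4
    · simp at htW)
  have H9 := H8.ext w4' (by
    intro t ht htW
    rcases (e16 t).1 ht with rfl | rfl
    · rw [Function.update_self]
      exact adj5_symm hw4'
    · rw [Function.update_of_ne e11.symm, Function.update_of_ne fq', Function.update_of_ne fq,
        Function.update_of_ne fx2, Function.update_of_ne fx1,
        Function.update_of_ne e7.symm, Function.update_of_ne fu2, Function.update_of_ne fu1]
      exact hw4'')
  exact H9.done hG.no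

theorem forb (C : Conf G v x1 x2 u1 u2 a1 b1 a2 b2) (hG : Crit G) {g : V → Fin 5} (hg : PCol G [v, x1, x2, u1, u2] g) :
    ∃ F1 F2 : Fin 5, ∀ c1 c2 y : Fin 5, adj5 c1 (g a1) → adj5 c1 (g b1) → adj5 c2 (g a2) →
      adj5 c2 (g b2) → ¬ adj5 y c1 → ¬ adj5 y c2 → y ≠ F1 → y ≠ F2 → False := by
  rcases C.cs with ⟨x3, u3, h⟩ | ⟨y, y', e, z, z', f, h⟩
  · refine ⟨g u3 + 1, g u3 - 1, ?_⟩
    intro c1 c2 y h1 h2 h3 h4 h5 h6 h7 h8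
    refine C.forb3 hG h (hg.mono (by intro t ht; simp only [List.mem_cons] at ht ⊢; tauto)) h1 h2 h3 h4 h5 h6 ?_
    have : ∀ y k : Fin 5, y ≠ k + 1 → y ≠ k - 1 → ¬ adj5 y k := by decide
    exact this _ _ h7 h8
  · exact ⟨g e, g f, fun c1 c2 y h1 h2 h3 h4 h5 h6 h7 h8 =>
      C.forb4 hG h (hg.mono (by intro t ht; simp only [List.mem_cons] at ht ⊢; tauto)) h1 h2 h3 h4 h5 h6 h7 h8⟩

set_option synthInstance.maxSize 100000 in
set_option synthInstance.maxHeartbeats 400000 in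
theorem nocol (C : Conf G v x1 x2 u1 u2 a1 b1 a2 b2) (hG : Crit G) {g : V → Fin 5} (hg : PCol G [v, x1, x2, u1, u2] g)
    (h1 : g a1 = g b1) (h2 : g a2 = g b2) : False := by
  obtain ⟨F1, F2, hF⟩ := C.forb hG hg
  have key : ∀ p q F1 F2 : Fin 5, ∃ c1 c2 y, adj5 c1 p ∧ adj5 c2 q ∧ ¬ adj5 y c1 ∧ ¬ adj5 y c2 ∧
      y ≠ F1 ∧ y ≠ F2 := by decide +kernel
  obtain ⟨c1, c2, y, k1, k2, k3, k4, k5, k6⟩ := key (g a1) (g a2) F1 F2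
  exact hF c1 c2 y k1 (h1 ▸ k1) k2 (h2 ▸ k2) k3 k4 k5 k6

theorem Pkill (C : Conf G v x1 x2 u1 u2 a1 b1 a2 b2) [Fintype V] [DecidableEq V] (h : SmallestCex G) {R : Finset V} (h6 : 6 ≤ R.card)
    (hv : v ∈ R) (hQ : ∀ q, G.Adj v q → q ≠ x1 → q ≠ x2 → q ∉ R) (hp : pR G R ≤ 4) : False := by
  rcases C.cs with ⟨x3, u3, k1, k2, k3, k4, k5, k6⟩ | ⟨y, y', e, z, z', f, e1, e2, e3, e4, e5, e6, 
    e7, e8, e9, e10, e11, e12, e13, e14, e15, e16, e17, e18⟩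
  · have hx3 := hQ x3 ((k4 x3).2 (by simp)) k1 k2
    have key : ∀ s s', s ∉ R → s' ∉ R → x3 = s → G.Adj s s' →
        (∃ r, ∀ t, G.Adj s' t → t = s ∨ t = r) → False := by
      rintro s s' hs hs' rfl ha ⟨r, hr⟩
      have : s' = u3 := ((k5 s').1 ha).resolve_left (by rintro rfl; exact hs' hv)
      subst this
      obtain ⟨t, ht, t1, t2⟩ := k6 x3 r
      have := hr t ht
      tauto
    obtain ⟨s, s', hs, hs', hcov, hadj, r1, r2⟩ := h.Pstr h6 hx3 hp
    rcases hcov x3 hx3 with h1 | h1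
    · exact key s s' hs hs' h1 hadj r2
    · exact key s' s hs' hs h1 hadj.symm r1
  · have vy : G.Adj v y := (e12 y).2 (by simp)
    have vz : G.Adj v z := (e12 z).2 (by simp)
    have hy := hQ y vy e2 e3
    have hz := hQ z vz e4 e5
    obtain ⟨s, s', hs, hs', hcov, hadj, r1, r2⟩ := h.Pstr h6 hy hp
    have : G.Adj y z := by
      rcases hcov y hy with h1 | h1 <;> rcases hcov z hz with h2 | h2
      · exact absurd (h1.trans h2.symm) e1
      · rw [h1, h2]; exact hadj
      · rw [h1, h2]; exact hadj.symm
      · exact absurd (h1.trans h2.symm) e1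
    exact C.hT _ _ _ vy this vz

end Conf
end conf2

section star
variable {V : Type} {G : SimpleGraph V} {v x1 x2 u1 u2 a1 b1 a2 b2 : V}

/-- delete the edges described by `P` -/
def cut (G : SimpleGraph V) (P : V → V → Prop) : SimpleGraph V :=
  ⟨fun c d => G.Adj c d ∧ ¬ P c d ∧ ¬ P d c,
    ⟨fun _ _ h => ⟨h.1.symm, h.2.2, h.2.1⟩⟩, ⟨fun _ h => G.irrefl h.1⟩⟩

theorem cut_le {P : V → V → Prop} : cut G P ≤ G := fun _ _ h => h.1

theorem GlueOut.not_S {G' : SimpleGraph V} [Fintype V] {R1 : Finset V} {φ : V → Fin 5}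
    {o : GlueOut G' R1 φ} {a p r : V} (h : ∀ t, G'.Adj a t → t = p ∨ t = r) (hp : p ∉ R1)
    (hpS : p ∉ o.S) : a ∉ o.S := by
  intro ha
  obtain ⟨b, c, hbc, hb, hc, h1, h2⟩ := o.S_adj ha
  have e1 := h b h1
  have e2 := h c h2
  have f1 : b ≠ p := by rintro rfl; tauto
  have f2 : c ≠ p := by rintro rfl; tauto
  exact hbc ((e1.resolve_left f1).trans (e2.resolve_left f2).symm)

theorem GlueOut.not_S' {G' : SimpleGraph V} [Fintype V] {R1 : Finset V} {φ : V → Fin 5}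
    {o : GlueOut G' R1 φ} {a : V} (h : ∀ t, ¬ G'.Adj a t) : a ∉ o.S := by
  intro ha
  obtain ⟨b, c, hbc, hb, hc, h1, h2⟩ := o.S_adj ha
  exact h b h1

namespace Conf
variable [Fintype V] [DecidableEq V]

theorem star (C : Conf G v x1 x2 u1 u2 a1 b1 a2 b2) (h : SmallestCex G) {R0 : Finset V} (h6 : 6 ≤ R0.card) (hu1 : u1 ∈ R0) (hu2 : u2 ∈ R0)
    (hv : v ∉ R0) (hQ : ∀ q, G.Adj v q → q ∉ R0) (hp : pR G R0 ≤ 7) {φ : V → Fin 5}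
    (hφ : ∀ a b, a ∈ R0 → b ∈ R0 → G.Adj a b → adj5 (φ a) (φ b)) (hc : φ u1 = φ u2) : False := by
  obtain ⟨d1, d2, d3, d4, d5, d6, d7, d8, d9, d10⟩ := C.dist5
  have hx1 := hQ _ C.vx1
  have hx2 := hQ _ C.vx2
  let G' := cut G (fun c _ => c = x2)
  have hle : G' ≤ G := cut_le
  obtain ⟨o⟩ := exists_glue G' R0 φ (fun a b ha hb hab => hφ a b ha hb hab.1) (by
    intro g hg hgφ
    have hpc : PCol G [x2] g := fun c d hcd h1 h2 =>
      hg c d ⟨hcd, by simpa using h1, by simpa using h2⟩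
    refine (hpc.ext (g x1) ?_).done h.crit.no
    intro t ht _
    rcases (C.nx2 t).1 ht with rfl | rfl
    · exact hg x1 t ⟨C.vx1.symm, d5, d2⟩
    · rw [hgφ t hu2, ← hc, ← hgφ u1 hu1]
      exact hg x1 u1 ⟨C.xu1, d5, d8.symm⟩)
  have hRne : R0.Nonempty := ⟨u1, hu1⟩
  have hXn := o.X_nonempty h.crit hle hRne
  have hm := o.m_lt R0 h6 (fun a ha => Or.inl ha)
  have hc := o.count0 hle
  obtain ⟨hx5, -⟩ := o.pX hXn
  have hx2S : x2 ∉ o.S := GlueOut.not_S' (fun t ht => ht.2.1 rfl)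
  have hcard : R0.card ≤ (R0 ∪ o.S).card := Finset.card_le_card Finset.subset_union_left
  by_cases hvS : v ∈ o.S
  · have hK : pot o.K ≤ 2 := by
      rcases h.cls3 o.crit hm with ⟨c1, -⟩ | ⟨-, c2, -⟩ | c3
      · omega
      · omega
      · exfalso
        obtain ⟨k, hk⟩ := GlueOut.mem_S.1 hvS
        obtain ⟨k0, hk0⟩ := hXn
        obtain ⟨y, hy⟩ := GlueOut.mem_X.1 hk0
        obtain ⟨r, hr, -, hvr⟩ := o.hLR k k0 v y ((o.tri_card c3).2 k k0 (by
          rintro rfl; rw [hk] at hy; cases hy)) hk hy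
        exact hQ r hvr.1 hr
    have s1 : pR G (insert x1 (R0 ∪ o.S)) ≤ pR G (R0 ∪ o.S) :=
      pR_add2' (a := v) (b := u1) (by simp [hvS]) (by simp [hu1]) d3 C.vx1.symm C.xu1
    have s2 : pR G (insert x2 (insert x1 (R0 ∪ o.S))) ≤ pR G (insert x1 (R0 ∪ o.S)) - 3 :=
      pR_add2 (a := v) (b := u2) (by simp [hx2, hx2S, d5.symm]) (by simp [hvS]) (by simp [hu2])
        d4 C.vx2.symm C.xu2
    have := h.P2 (R := insert x2 (insert x1 (R0 ∪ o.S))) (by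
      refine le_trans h6 (le_trans hcard (Finset.card_le_card ?_))
      intro t ht; simp only [Finset.mem_insert]; tauto)
    omega
  · have hQS : ∀ q, G.Adj v q → q ∉ o.S := by
      intro q hq
      obtain ⟨r, hr⟩ := C.Qdeg hq
      exact GlueOut.not_S (fun t ht => hr t ht.1) hv hvS
    have hx1S := hQS _ C.vx1
    have hK : pot o.K ≤ 3 := by
      rcases h.cls3 o.crit hm with ⟨c1, -⟩ | ⟨-, c2, -⟩ | c3
      · omega
      · omega
      · exact c3.2.2.le
    have s1 : pR G (insert x1 (R0 ∪ o.S)) ≤ pR G (R0 ∪ o.S) + 1 :=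
      pR_add1 (a := u1) (by simp [hx1, hx1S]) (by simp [hu1]) C.xu1
    have s2 : pR G (insert v (insert x1 (R0 ∪ o.S))) ≤ pR G (insert x1 (R0 ∪ o.S)) + 1 :=
      pR_add1 (a := x1) (by simp [hv, hvS, d1]) (by simp) C.vx1
    have s3 : pR G (insert x2 (insert v (insert x1 (R0 ∪ o.S)))) ≤
        pR G (insert v (insert x1 (R0 ∪ o.S))) - 3 :=
      pR_add2 (a := v) (b := u2) (by simp [hx2, hx2S, d5.symm, d2.symm]) (by simp) (by simp [hu2])
        d4 C.vx2.symm C.xu2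
    refine C.Pkill h (R := insert x2 (insert v (insert x1 (R0 ∪ o.S)))) ?_ (by simp) ?_ (by omega)
    · refine le_trans h6 (le_trans hcard (Finset.card_le_card ?_))
      intro t ht; simp only [Finset.mem_insert]; tauto
    · intro q hq h1 h2
      simp [hQ q hq, hQS q hq, h1, h2, hq.ne']

theorem star2 (C : Conf G v x1 x2 u1 u2 a1 b1 a2 b2) (h : SmallestCex G) {R0 : Finset V} (h6 : 6 ≤ R0.card) (hu1 : u1 ∈ R0) (hu2 : u2 ∈ R0)
    (hv : v ∉ R0) (hQ : ∀ q, G.Adj v q → q ∉ R0) (hp : pR G R0 ≤ 6) {φ : V → Fin 5}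
    (hφ : ∀ a b, a ∈ R0 → b ∈ R0 → G.Adj a b → adj5 (φ a) (φ b)) {μ : Fin 5}
    (hc1 : adj5 μ (φ u1)) (hc2 : adj5 μ (φ u2)) :
    ∃ x3 u3, Cs3 G v x1 x2 x3 u3 ∧ ∀ t, t ∈ R0 ∨ t = x1 ∨ t = x2 ∨ t = v ∨ t = x3 := by
  by_contra hcon
  obtain ⟨d1, d2, d3, d4, d5, d6, d7, d8, d9, d10⟩ := C.dist5
  have hx1 := hQ _ C.vx1
  have hx2 := hQ _ C.vx2
  let G' := cut G (fun c _ => c = x2)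
  have hle : G' ≤ G := cut_le
  let R1 := insert x1 R0
  have hpR1 : pR G R1 ≤ pR G R0 + 1 := pR_add1 (a := u1) hx1 hu1 C.xu1
  let ψ := Function.update φ x1 μ
  have hψx : ψ x1 = μ := Function.update_self _ _ _
  have hψ : ∀ t ∈ R0, ψ t = φ t := fun t ht =>
    Function.update_of_ne (by rintro rfl; exact hx1 ht) _ _
  have hx1R : ∀ b ∈ R0, G.Adj x1 b → adj5 μ (φ b) := by
    intro b hb hab
    rcases (C.nx1 b).1 hab with rfl | rfl
    · exact absurd hb hv
    · exact hc1
  obtain ⟨o⟩ := exists_glue G' R1 ψ (by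
    intro a b ha hb hab
    have hab := hab.1
    rcases Finset.mem_insert.1 ha with rfl | ha' <;> rcases Finset.mem_insert.1 hb with rfl | hb'
    · exact absurd hab (G.irrefl)
    · rw [hψx, hψ b hb']; exact hx1R b hb' hab
    · rw [hψx, hψ a ha']; exact adj5_symm (hx1R a ha' hab.symm)
    · rw [hψ a ha', hψ b hb']; exact hφ a b ha' hb' hab) (by
    intro g hg hgφ
    have hpc : PCol G [x2] g := fun c d hcd h1 h2 =>
      hg c d ⟨hcd, by simpa using h1, by simpa using h2⟩
    refine (hpc.ext μ ?_).done h.crit.no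
    intro t ht _
    rcases (C.nx2 t).1 ht with rfl | rfl
    · rw [← hψx, ← hgφ x1 (by simp [R1])]
      exact hg x1 t ⟨C.vx1.symm, d5, d2⟩
    · rw [hgφ t (by simp [R1, hu2]), hψ t hu2]; exact hc2)
  have hRne : R1.Nonempty := ⟨x1, by simp [R1]⟩
  have hXn := o.X_nonempty h.crit hle hRne
  have h6' : 6 ≤ R1.card := le_trans h6 (Finset.card_le_card (Finset.subset_insert _ _))
  have hm := o.m_lt R1 h6' (fun a ha => Or.inl ha)
  have hc := o.count0 hle
  obtain ⟨hx5, -⟩ := o.pX hXn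
  have hx2S : x2 ∉ o.S := GlueOut.not_S' (fun t ht => ht.2.1 rfl)
  have hx2R1 : x2 ∉ R1 := by simp [R1, hx2, d5.symm]
  have hvR1 : v ∉ R1 := by simp [R1, hv, d1]
  have hcard : R1.card ≤ (R1 ∪ o.S).card := Finset.card_le_card Finset.subset_union_left
  have hu2R1 : u2 ∈ R1 := by simp [R1, hu2]
  by_cases hvS : v ∈ o.S
  · have s2 : pR G (insert x2 (R1 ∪ o.S)) ≤ pR G (R1 ∪ o.S) - 3 :=
      pR_add2 (a := v) (b := u2) (by simp [hx2R1, hx2S]) (by simp [hvS]) (by simp [hu2R1])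
        d4 C.vx2.symm C.xu2
    have h6'' : 6 ≤ (insert x2 (R1 ∪ o.S)).card := by
      refine le_trans h6' (le_trans hcard (Finset.card_le_card (Finset.subset_insert _ _)))
    have l2 := h.P2 h6''
    rcases h.cls3 o.crit hm with ⟨c1, -⟩ | ⟨-, c2, -⟩ | c3
    · omega
    · omega
    · have hsx := o.card_SX
      have hm3 := c3.1
      have hpot := c3.2.2
      have hXp : 0 < o.X.card := Finset.card_pos.2 hXn
      have hSp : 0 < o.S.card := Finset.card_pos.2 ⟨v, hvS⟩
      have hX1 : o.X.card = 1 := by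
        by_contra hne
        have := (o.tri_card c3).1 (by omega)
        omega
      have huniv : insert x2 (R1 ∪ o.S) = Finset.univ := by
        by_contra hne
        have := h.P4 h6'' hne
        omega
      obtain ⟨s, hsS, hsv⟩ : ∃ s ∈ o.S, s ≠ v :=
        Finset.exists_mem_ne (by omega : 1 < o.S.card) v
      have hS : ∀ t ∈ o.S, t = v ∨ t = s := by
        have : o.S = {v, s} := by
          symm
          apply Finset.eq_of_subset_of_card_le
          · intro t; simp; rintro (rfl | rfl) <;> assumption
          · rw [Finset.card_pair hsv.symm]; omega
        intro t ht; rw [this] at ht; simpa using ht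
      have hcov : ∀ t, t ∈ R0 ∨ t = x1 ∨ t = x2 ∨ t = v ∨ t = s := by
        intro t
        have : t ∈ insert x2 (R1 ∪ o.S) := by rw [huniv]; exact Finset.mem_univ _
        simp only [Finset.mem_insert, Finset.mem_union, R1] at this
        have := hS t
        tauto
      have key : ∀ q, G.Adj v q → q ≠ x1 → q ≠ x2 → q = s := by
        intro q hq h1 h2
        have := hcov q
        have := hQ q hq
        have := hq.ne'
        tauto
      rcases C.cs with ⟨x3, u3, h3⟩ | ⟨y, y', e, z, z', f, e1, e2, e3, e4, e5, e6, 
        e7, e8, e9, e10, e11, e12, -⟩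
      · have := key x3 ((h3.2.2.2.1 x3).2 (by simp)) h3.1 h3.2.1
        subst this
        exact hcon ⟨x3, u3, h3, hcov⟩
      · have k1 := key y ((e12 y).2 (by simp)) e2 e3
        have k2 := key z ((e12 z).2 (by simp)) e4 e5
        exact e1 (k1.trans k2.symm)
  · have hQS : ∀ q, G.Adj v q → q ∉ o.S := by
      intro q hq
      obtain ⟨r, hr⟩ := C.Qdeg hq
      exact GlueOut.not_S (fun t ht => hr t ht.1) hvR1 hvS
    have hK : pot o.K ≤ 3 := by
      rcases h.cls3 o.crit hm with ⟨c1, -⟩ | ⟨-, c2, -⟩ | c3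
      · omega
      · omega
      · exact c3.2.2.le
    have s2 : pR G (insert v (R1 ∪ o.S)) ≤ pR G (R1 ∪ o.S) + 1 :=
      pR_add1 (a := x1) (by simp [hvR1, hvS]) (by simp [R1]) C.vx1
    have s3 : pR G (insert x2 (insert v (R1 ∪ o.S))) ≤
        pR G (insert v (R1 ∪ o.S)) - 3 :=
      pR_add2 (a := v) (b := u2) (by simp [hx2R1, hx2S, d2.symm]) (by simp) (by simp [hu2R1])
        d4 C.vx2.symm C.xu2
    refine C.Pkill h (R := insert x2 (insert v (R1 ∪ o.S))) ?_ (by simp) ?_ (by omega)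
    · refine le_trans h6' (le_trans hcard (Finset.card_le_card ?_))
      intro t ht; simp only [Finset.mem_insert]; tauto
    · intro q hq h1 h2
      simp [R1, hQ q hq, hQS q hq, h1, h2, hq.ne']

end Conf
end star

section cover
variable {V : Type} {G : SimpleGraph V} [DecidableEq V] {m : ℕ} {K : SimpleGraph (Fin m)}
  {π : V → Fin m} {P : Finset V}

/-- every edge of `K` lifts to an edge of `G` inside `P` -/
def Lifts (G : SimpleGraph V) (K : SimpleGraph (Fin m)) (π : V → Fin m) (P : Finset V) : Prop :=
  ∀ k k', K.Adj k k' → ∃ c ∈ P, ∃ d ∈ P, G.Adj c d ∧ π c = k ∧ π d = k'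

theorem cover_count (T : Finset (V × V)) (hT : T ⊆ darts G P)
    (hl : ∀ k k', K.Adj k k' → ∃ c ∈ P, ∃ d ∈ P, G.Adj c d ∧ π c = k ∧ π d = k' ∧ (c, d) ∉ T) :
    pR G P + 2 * (T.card : ℤ) ≤ pot K + 5 * ((P.card : ℤ) - m) := by
  have h1 : (darts K Finset.univ).card ≤ (darts G P \ T).card := by
    have : darts K Finset.univ ⊆ (darts G P \ T).image (fun p => (π p.1, π p.2)) := by
      rintro ⟨k, k'⟩ hk
      obtain ⟨c, hc, d, hd, hcd, rfl, rfl, hnT⟩ := hl k k' (mem_darts.1 hk).2.2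
      refine Finset.mem_image.2 ⟨(c, d), ?_, rfl⟩
      simp only [Finset.mem_sdiff, mem_darts]
      exact ⟨⟨hc, hd, hcd⟩, hnT⟩
    exact (Finset.card_le_card this).trans Finset.card_image_le
  have h2 := Finset.card_sdiff_add_card_eq_card hT
  rw [pot_eq]
  unfold pR
  simp only [Finset.card_univ, Fintype.card_fin]
  omega

theorem cover_exact (hl : Lifts G K π P) (hp : pot K + 5 * ((P.card : ℤ) - m) - 4 < pR G P) :
    ∀ c ∈ P, ∀ d ∈ P, G.Adj c d → K.Adj (π c) (π d) ∧ ∀ c' ∈ P, ∀ d' ∈ P, G.Adj c' d' → 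
      π c' = π c → π d' = π d → c' = c ∧ d' = d := by
  intro c hc d hd hcd
  have hne := hcd.ne
  by_contra hcon
  have := cover_count (G := G) (K := K) (π := π) (P := P) {(c, d), (d, c)} (by
      intro p hp
      simp only [Finset.mem_insert, Finset.mem_singleton] at hp
      rcases hp with rfl | rfl
      · exact mem_darts.2 ⟨hc, hd, hcd⟩
      · exact mem_darts.2 ⟨hd, hc, hcd.symm⟩) (by
      intro k k' hk
      by_contra hno
      push Not at hno
      simp only [Finset.mem_insert, Finset.mem_singleton, Prod.mk.injEq] at hno
      obtain ⟨c1, hc1, d1, hd1, hcd1, rfl, rfl⟩ := hl k k' hk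
      apply hcon
      rcases hno c1 hc1 d1 hd1 hcd1 rfl rfl with ⟨rfl, rfl⟩ | ⟨rfl, rfl⟩
      · refine ⟨hk, fun c' hc' d' hd' h1 h2 h3 => ?_⟩
        rcases hno c' hc' d' hd' h1 h2 h3 with h4 | ⟨rfl, rfl⟩
        · exact h4
        · exact absurd h2.symm hk.ne
      · refine ⟨hk.symm, fun c' hc' d' hd' h1 h2 h3 => ?_⟩
        rcases hno d' hd' c' hc' h1.symm h3 h2 with ⟨rfl, rfl⟩ | ⟨rfl, rfl⟩
        · exact absurd h2 hk.ne
        · exact ⟨rfl, rfl⟩)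
  rw [Finset.card_pair (by simp [hne])] at this
  push_cast at this
  omega

/-- only one identified pair -/
theorem lemA [Fintype V] (h : SmallestCex G) (hK : Crit K) (hm : m < Fintype.card V)
    (hl : Lifts G K π P) {u a b v x1 x2 : V} (hua : G.Adj u a) (hub : G.Adj u b)
    (hab : a ≠ b) (hu : u ∉ P) (h5 : No5 G u)
    (hinj : ∀ c ∈ P, ∀ d ∈ P, π c = π d → c = d ∨ (c = a ∧ d = b) ∨ (c = b ∧ d = a))
    (hv : v ∉ insert u P) (hx1 : x1 ∉ insert u P) (hx2 : x2 ∉ insert u P)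
    (d1 : v ≠ x1) (d2 : v ≠ x2) (d3 : x1 ≠ x2) : False := by
  have hsurj : ∀ k, ∃ c ∈ P, π c = k := by
    intro k
    obtain ⟨k', hk'⟩ := hK.ni k
    obtain ⟨c, hc, d, hd, hcd, h1, h2⟩ := hl k k' hk'
    exact ⟨c, hc, h1⟩
  by_cases hin : ∀ c ∈ P, ∀ d ∈ P, π c = π d → c = d
  · choose f hfP hf using hsurj
    have hfi : Function.Injective f := fun k k' hk => by rw [← hf k, hk, hf k']
    have hom : ∀ k k', K.Adj k k' → G.Adj (f k) (f k') := by
      intro k k' hk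
      obtain ⟨c, hc, d, hd, hcd, h1, h2⟩ := hl k k' hk
      rw [hin (f k) (hfP k) c hc (by rw [hf, h1]), hin (f k') (hfP k') d hd (by rw [hf, h2])]
      exact hcd
    obtain ⟨k, hk⟩ := (h.crit.surj hK.no f hfi hom).1 u
    exact hu (hk ▸ hfP k)
  · push Not at hin
    obtain ⟨c, hc, d, hd, hcd, hne⟩ := hin
    have haP : a ∈ P ∧ b ∈ P ∧ π a = π b := by
      rcases hinj c hc d hd hcd with h1 | ⟨rfl, rfl⟩ | ⟨rfl, rfl⟩
      · exact absurd h1 hne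
      · exact ⟨hc, hd, hcd⟩
      · exact ⟨hd, hc, hcd.symm⟩
    obtain ⟨ha, hb, hπ⟩ := haP
    have hcard : P.card = m + 1 := by
      have : (P.erase b).card = (Finset.univ : Finset (Fin m)).card := by
        refine Finset.card_bij (fun t _ => π t) (fun _ _ => Finset.mem_univ _) ?_ ?_
        · intro s hs t ht hst
          have := hinj s (Finset.mem_of_mem_erase hs) t (Finset.mem_of_mem_erase ht) hst
          have := Finset.ne_of_mem_erase hs
          have := Finset.ne_of_mem_erase ht
          tauto
        · intro k _
          obtain ⟨t, ht, htk⟩ := hsurj k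
          by_cases htb : t = b
          · exact ⟨a, Finset.mem_erase.2 ⟨hab, ha⟩, by rw [hπ, ← htb, htk]⟩
          · exact ⟨t, Finset.mem_erase.2 ⟨htb, ht⟩, htk⟩
      rw [Finset.card_erase_of_mem hb] at this
      simp at this
      have := Finset.card_pos.2 ⟨b, hb⟩
      omega
    have hcnt := cover_count (G := G) (K := K) (π := π) (P := P) ∅ (by simp) (by simpa [Lifts] using hl)
    have hR : pR G (insert u P) ≤ pR G P - 3 := pR_add2 hu ha hb hab hua hub
    have hcu : (insert u P).card = m + 2 := by rw [Finset.card_insert_of_notMem hu, hcard]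
    have hK2 : pot K ≤ 2 → 4 ≤ m → False := by
      intro h1 h2
      have := h.P5 (by omega) hv hx1 hx2 d1 d2 d3
      rw [hcard] at hcnt
      push_cast at hcnt
      simp at hcnt
      omega
    rcases h.cls3 hK hm with ⟨c1, c2⟩ | ⟨-, c2, c3⟩ | ⟨rfl, rfl, -⟩
    · exact hK2 (by omega) c2
    · exact hK2 (by omega) (by omega)
    · obtain ⟨k1, k2, h01, h02, h12⟩ : ∃ k1 k2 : Fin 3, π a ≠ k1 ∧ π a ≠ k2 ∧ k1 ≠ k2 := by
        generalize π a = z; revert z; decide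
      obtain ⟨p, hp, c, hc, hpc, hp1, hc1⟩ := hl (π a) k1 h01
      obtain ⟨q, hq, d, hd, hqd, hq1, hd1⟩ := hl (π a) k2 h02
      obtain ⟨c', hc', d', hd', hcd, hc2, hd2⟩ := hl k1 k2 h12
      have e0 : ∀ s ∈ P, π s = π a → s = a ∨ s = b := by
        intro s hs hsa
        have := hinj s hs a ha hsa
        tauto
      have e1 : c' = c := by
        have := hinj c' hc' c hc (by rw [hc1, hc2])
        rcases this with h1 | ⟨rfl, rfl⟩ | ⟨rfl, rfl⟩
        · exact h1
        · exact absurd hc2 h01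
        · rw [hπ] at h01; exact absurd hc2 h01
      have e2 : d' = d := by
        have := hinj d' hd' d hd (by rw [hd1, hd2])
        rcases this with h1 | ⟨rfl, rfl⟩ | ⟨rfl, rfl⟩
        · exact h1
        · exact absurd hd2 h02
        · rw [hπ] at h02; exact absurd hd2 h02
      subst e1 e2
      rcases e0 p hp hp1 with rfl | rfl <;> rcases e0 q hq hq1 with rfl | rfl
      · exact h.no_tri hpc hcd hqd.symm
      · exact h5 _ _ _ _ hua hpc hcd hqd.symm hub.symm
      · exact h5 _ _ _ _ hub hpc hcd hqd.symm hua.symm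
      · exact h.no_tri hpc hcd hqd.symm

end cover

section pre
variable {V : Type} {G : SimpleGraph V} {v x1 x2 u1 u2 a1 b1 a2 b2 : V}

/-- result of identifying `a1,b1` and `a2,b2` -/
structure Pre (G : SimpleGraph V) (v x1 x2 u1 u2 a1 b1 a2 b2 : V) {m : ℕ}
    (K : SimpleGraph (Fin m)) (π : V → Fin m) (P : Finset V) : Prop where
  crit : Crit K
  lift : Lifts G K π P
  out : ∀ t ∈ P, t ≠ v ∧ t ≠ x1 ∧ t ≠ x2 ∧ t ≠ u1 ∧ t ≠ u2
  fib : ∀ c ∈ P, ∀ d ∈ P, π c = π d → c = d ∨ (c = a1 ∧ d = b1) ∨ (c = b1 ∧ d = a1) ∨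
    (c = a2 ∧ d = b2) ∨ (c = b2 ∧ d = a2) ∨
    (a1 = a2 ∧ ((c = b1 ∧ d = b2) ∨ (c = b2 ∧ d = b1)))
  e1 : π a1 = π b1
  e2 : π a2 = π b2
  use : ∀ t ∈ P, ∃ d ∈ P, G.Adj t d
  hQ : ∀ q, G.Adj v q → q ∉ P

theorem exists_pre [Fintype V] (C : Conf G v x1 x2 u1 u2 a1 b1 a2 b2)
    (hG : Crit G) (H : (a1 ≠ a2 ∧ a1 ≠ b2 ∧ b1 ≠ a2 ∧ b1 ≠ b2) ∨ a1 = a2) :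
    ∃ (m : ℕ) (K : SimpleGraph (Fin m)) (π : V → Fin m) (P : Finset V),
      m < Fintype.card V ∧ Pre G v x1 x2 u1 u2 a1 b1 a2 b2 K π P := by
  classical
  have ab1 := C.ab1
  have ab2 := C.ab2
  let q : V → V := fun t => if t = b1 then a1 else if t = b2 then a2 else t
  have q1 : q a1 = a1 := by simp only [q]; grind
  have q2 : q a2 = a2 := by simp only [q]; grind
  have q3 : q b1 = a1 := by simp only [q]; grind
  have q4 : q b2 = a2 := by simp only [q]; grind
  have q5 : ∀ t, t ≠ b1 → t ≠ b2 → q t = t := by intro t; simp only [q]; grind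
  have qf : ∀ c d, q c = q d → c = d ∨ (c = a1 ∧ d = b1) ∨ (c = b1 ∧ d = a1) ∨
    (c = a2 ∧ d = b2) ∨ (c = b2 ∧ d = a2) ∨
    (a1 = a2 ∧ ((c = b1 ∧ d = b2) ∨ (c = b2 ∧ d = b1))) := by
    intro c d hcd
    by_cases c1 : c = b1 <;> by_cases c2 : c = b2 <;> by_cases c3 : d = b1 <;>
      by_cases c4 : d = b2 <;> grind
  let G' := cut G (fun c _ => c = v ∨ c = x1 ∨ c = x2 ∨ c = u1 ∨ c = u2)
  have hloop : ∀ c d, G.Adj c d → q c ≠ q d := by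
    intro c d hcd he
    have nab1 := C.nab1
    have nab2 := C.nab2
    rcases qf c d he with rfl | ⟨rfl, rfl⟩ | ⟨rfl, rfl⟩ | ⟨rfl, rfl⟩ | ⟨rfl, rfl⟩ |
      ⟨rfl, ⟨rfl, rfl⟩ | ⟨rfl, rfl⟩⟩
    · exact G.irrefl hcd
    · exact nab1 hcd
    · exact nab1 hcd.symm
    · exact nab2 hcd
    · exact nab2 hcd.symm
    · exact C.n5u1 _ _ _ _ C.ub1 hcd C.ub2.symm C.ua2 C.ua1.symm
    · exact C.n5u1 _ _ _ _ C.ub1 hcd.symm C.ub2.symm C.ua2 C.ua1.symm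
  have hno : ¬ HasCol (G'.map q) := by
    rintro ⟨g, hg⟩
    refine C.nocol hG (g := g ∘ q) ?_ (by simp [q1, q3]) (by simp [q2, q4])
    intro c d hcd h1 h2
    apply hg
    rw [map_adj']
    refine ⟨hloop c d hcd, c, d, ⟨hcd, ?_, ?_⟩, rfl, rfl⟩
    · simpa using h1
    · simpa using h2
  obtain ⟨m, K, f, hK, hf, hom⟩ := exists_crit _ hno
  have hm0 : 3 ≤ m := hK.four.1
  let π : V → Fin m := fun t => if h : ∃ k, f k = q t then h.choose else ⟨0, by omega⟩
  have hπ : ∀ t k, f k = q t → π t = k := by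
    intro t k hk
    have h : ∃ k, f k = q t := ⟨k, hk⟩
    simp only [π, dif_pos h]
    exact hf (h.choose_spec.trans hk.symm)
  have hπq : ∀ s t, q s = q t → π s = π t := by
    intro s t hst; simp only [π, hst]
  let P : Finset V := Finset.univ.filter
    (fun t => ∃ k k' d, K.Adj k k' ∧ G'.Adj t d ∧ q t = f k ∧ q d = f k')
  have memP : ∀ t, t ∈ P ↔ ∃ k k' d, K.Adj k k' ∧ G'.Adj t d ∧ q t = f k ∧ q d = f k' := by
    intro t; simp [P]
  have hl : ∀ k k', K.Adj k k' → ∃ c ∈ P, ∃ d ∈ P, G'.Adj c d ∧ π c = k ∧ π d = k' ∧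
      q c = f k ∧ q d = f k' := by
    intro k k' hk
    obtain ⟨-, c, d, hcd, h1, h2⟩ := (map_adj' _ _ _ _).1 (hom k k' hk)
    exact ⟨c, (memP c).2 ⟨k, k', d, hk, hcd, h1, h2⟩, d,
      (memP d).2 ⟨k', k, c, hk.symm, hcd.symm, h2, h1⟩, hcd, hπ _ _ h1.symm, hπ _ _ h2.symm, h1, h2⟩
  have out : ∀ t ∈ P, t ≠ v ∧ t ≠ x1 ∧ t ≠ x2 ∧ t ≠ u1 ∧ t ≠ u2 := by
    intro t ht
    obtain ⟨k, k', d, -, h1, -⟩ := (memP t).1 ht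
    have := h1.2.1
    tauto
  have hfP : ∀ t ∈ P, f (π t) = q t := by
    intro t ht
    obtain ⟨k, k', d, -, h1, h2, -⟩ := (memP t).1 ht
    rw [hπ t k h2.symm, h2]
  refine ⟨m, K, π, P, ?_, hK, ?_, out, ?_, hπq _ _ (q1.trans q3.symm), hπq _ _ (q2.trans q4.symm),
    ?_, ?_⟩
  · have : ¬ Function.Surjective f := by
      intro hs
      obtain ⟨k, hk⟩ := hs v
      obtain ⟨k', hk'⟩ := hK.ni k
      obtain ⟨c, hc, d, hd, hcd, -, -, h1, h2⟩ := hl k k' hk'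
      rw [hk] at h1
      have n1 := C.a1n.1
      have n2 := C.a2n.1
      have := (out c hc).1
      by_cases c1 : c = b1
      · subst c1; exact n1 (q3.symm.trans h1)
      · by_cases c2 : c = b2
        · subst c2; exact n2 (q4.symm.trans h1)
        · exact this ((q5 c c1 c2).symm.trans h1)
    have := Fintype.card_lt_of_injective_not_surjective f hf this
    simpa using this
  · intro k k' hk
    obtain ⟨c, hc, d, hd, hcd, h1, h2, -⟩ := hl k k' hk
    exact ⟨c, hc, d, hd, hcd.1, h1, h2⟩
  · intro c hc d hd hcd
    apply qf
    rw [← hfP c hc, ← hfP d hd, hcd]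
  · intro t ht
    obtain ⟨k, k', d, h0, h1, h2, h3⟩ := (memP t).1 ht
    exact ⟨d, (memP d).2 ⟨k', k, t, h0.symm, h1.symm, h3, h2⟩, h1.1⟩
  · intro t hvt ht
    have s1 : t ≠ a1 := by rintro rfl; exact C.nva1 hG hvt
    have s2 : t ≠ b1 := by rintro rfl; exact C.nvb1 hG hvt
    have s3 : t ≠ a2 := by rintro rfl; exact C.nva2 hG hvt
    have s4 : t ≠ b2 := by rintro rfl; exact C.nvb2 hG hvt
    obtain ⟨r, hr⟩ := C.Qdeg hvt
    obtain ⟨k1, k2, hne, hk1, hk2⟩ := hK.two (π t)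
    obtain ⟨c, hc, d, hd, hcd, -, h2, h3, -⟩ := hl _ _ hk1
    obtain ⟨c', hc', d', hd', hcd', -, h2', h3', -⟩ := hl _ _ hk2
    rw [hfP t ht] at h3 h3'
    have e : c = t := by
      have := qf _ _ h3; tauto
    have e' : c' = t := by
      have := qf _ _ h3'; tauto
    subst e e'
    have f1 := (hr d hcd.1).resolve_left (out d hd).1
    have f2 := (hr d' hcd'.1).resolve_left (out d' hd').1
    exact hne (by rw [← h2, ← h2', f1, f2])

/-- both pairs are really needed -/
structure Red (G : SimpleGraph V) (v x1 x2 u1 u2 a1 b1 a2 b2 : V) {m : ℕ}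
    (K : SimpleGraph (Fin m)) (π : V → Fin m) (P : Finset V) : Prop where
  crit : Crit K
  lift : Lifts G K π P
  out : ∀ t ∈ P, t ≠ v ∧ t ≠ x1 ∧ t ≠ x2 ∧ t ≠ u1 ∧ t ≠ u2
  fib : ∀ c ∈ P, ∀ d ∈ P, π c = π d → c = d ∨ (c = a1 ∧ d = b1) ∨ (c = b1 ∧ d = a1) ∨
    (c = a2 ∧ d = b2) ∨ (c = b2 ∧ d = a2) ∨
    (a1 = a2 ∧ ((c = b1 ∧ d = b2) ∨ (c = b2 ∧ d = b1)))
  e1 : π a1 = π b1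
  e2 : π a2 = π b2
  hQ : ∀ q, G.Adj v q → q ∉ P
  ma1 : a1 ∈ P
  mb1 : b1 ∈ P
  ma2 : a2 ∈ P
  mb2 : b2 ∈ P
  card : P.card = m + 2
  ub1 : ∃ d ∈ P, G.Adj b1 d
  ub2 : ∃ d ∈ P, G.Adj b2 d
  kind : ((a1 ≠ a2 ∧ a1 ≠ b2 ∧ b1 ≠ a2 ∧ b1 ≠ b2) ∧ (∃ d ∈ P, G.Adj a1 d) ∧ (∃ d ∈ P, G.Adj a2 d)) ∨
    (a1 = a2 ∧ b1 ≠ b2)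

theorem exists_red [Fintype V] (C : Conf G v x1 x2 u1 u2 a1 b1 a2 b2)
    (h : SmallestCex G) (H : (a1 ≠ a2 ∧ a1 ≠ b2 ∧ b1 ≠ a2 ∧ b1 ≠ b2) ∨ a1 = a2) :
    ∃ (m : ℕ) (K : SimpleGraph (Fin m)) (π : V → Fin m) (P : Finset V),
      m < Fintype.card V ∧ Red G v x1 x2 u1 u2 a1 b1 a2 b2 K π P := by
  classical
  obtain ⟨m, K, π, P, hm, p⟩ := exists_pre C h.crit H
  obtain ⟨d1, d2, d3, d4, d5, d6, d7, d8, d9, d10⟩ := C.dist5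
  have out := p.out
  have A2 : (∀ c ∈ P, ∀ d ∈ P, π c = π d → c = d ∨ (c = a2 ∧ d = b2) ∨ (c = b2 ∧ d = a2)) → False := by
    intro hin
    refine lemA h p.crit hm p.lift C.ua2 C.ub2 C.ab2 (fun hu => (out _ hu).2.2.2.2 rfl) C.n5u2 hin
      (v := v) (x1 := x1) (x2 := x2) ?_ ?_ ?_ d1 d2 d5 <;>
    simp only [Finset.mem_insert] <;> grind
  have A1 : (∀ c ∈ P, ∀ d ∈ P, π c = π d → c = d ∨ (c = a1 ∧ d = b1) ∨ (c = b1 ∧ d = a1)) → False := by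
    intro hin
    refine lemA h p.crit hm p.lift C.ua1 C.ub1 C.ab1 (fun hu => (out _ hu).2.2.2.1 rfl) C.n5u1 hin
      (v := v) (x1 := x1) (x2 := x2) ?_ ?_ ?_ d1 d2 d5 <;>
    simp only [Finset.mem_insert] <;> grind
  have hb1 : b1 ∈ P := by
    by_contra hb
    refine A2 (fun c hc d hd hcd => ?_)
    have := p.fib c hc d hd hcd
    grind
  have hb2 : b2 ∈ P := by
    by_contra hb
    refine A1 (fun c hc d hd hcd => ?_)
    have := p.fib c hc d hd hcd
    grind
  have hbb : b1 ≠ b2 := by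
    intro hb
    refine A1 (fun c hc d hd hcd => ?_)
    have := p.fib c hc d hd hcd
    grind
  have hU : a1 ≠ a2 → a1 ∈ P ∧ a2 ∈ P := by
    intro haa
    constructor
    · by_contra hb
      refine A2 (fun c hc d hd hcd => ?_)
      have := p.fib c hc d hd hcd
      grind
    · by_contra hb
      refine A1 (fun c hc d hd hcd => ?_)
      have := p.fib c hc d hd hcd
      grind
  let P' := insert a1 (insert a2 P)
  have hsub : ∀ t ∈ P, t ∈ P' := fun t ht => by simp [P', ht]
  have hP' : ∀ t ∈ P', t = a1 ∨ t = a2 ∨ t ∈ P := fun t ht => by simpa [P'] using ht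
  have fib' : ∀ c ∈ P', ∀ d ∈ P', π c = π d → c = d ∨ (c = a1 ∧ d = b1) ∨ (c = b1 ∧ d = a1) ∨
    (c = a2 ∧ d = b2) ∨ (c = b2 ∧ d = a2) ∨
    (a1 = a2 ∧ ((c = b1 ∧ d = b2) ∨ (c = b2 ∧ d = b1))) := by
    intro c hc d hd hcd
    by_cases haa : a1 = a2
    · have k1 : ∀ s ∈ P, π s = π a1 → s = a1 ∨ s = b1 ∨ s = b2 := by
        intro s hs hsa
        have := p.fib s hs b1 hb1 (hsa.trans p.e1)
        grind
      rcases hP' c hc with e | e | hcP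
      · rcases hP' d hd with e' | e' | hdP
        · grind
        · grind
        · have := k1 d hdP (by rw [← hcd, e]); grind
      · rcases hP' d hd with e' | e' | hdP
        · grind
        · grind
        · have := k1 d hdP (by rw [← hcd, e, haa]); grind
      · rcases hP' d hd with e' | e' | hdP
        · have := k1 c hcP (by rw [hcd, e']); grind
        · have := k1 c hcP (by rw [hcd, e', haa]); grind
        · exact p.fib c hcP d hdP hcd
    · obtain ⟨m1, m2⟩ := hU haa
      have : ∀ t ∈ P', t ∈ P := by
        intro t ht; rcases hP' t ht with rfl | rfl | ht' <;> assumption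
      exact p.fib c (this c hc) d (this d hd) hcd
  refine ⟨m, K, π, P', hm, p.crit, ?_, ?_, fib', p.e1, p.e2, ?_, by simp [P'], hsub _ hb1, by simp [P'],
    hsub _ hb2, ?_, ?_, ?_, ?_⟩
  · intro k k' hk
    obtain ⟨c, hc, d, hd, h1⟩ := p.lift k k' hk
    exact ⟨c, hsub c hc, d, hsub d hd, h1⟩
  · intro t ht
    rcases hP' t ht with rfl | rfl | ht'
    · exact C.a1n
    · exact C.a2n
    · exact out t ht'
  · intro q hq hqP
    rcases hP' q hqP with rfl | rfl | ht'
    · exact C.nva1 h.crit hq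
    · exact C.nva2 h.crit hq
    · exact p.hQ q hq ht'
  · have : ((P'.erase b1).erase b2).card = (Finset.univ : Finset (Fin m)).card := by
      refine Finset.card_bij (fun t _ => π t) (fun _ _ => Finset.mem_univ _) ?_ ?_
      · intro s hs t ht hst
        simp only [Finset.mem_erase] at hs ht
        have := fib' s hs.2.2 t ht.2.2 hst
        tauto
      · intro k _
        obtain ⟨k', hk'⟩ := p.crit.ni k
        obtain ⟨c, hc, d, hd, hcd, h1, h2⟩ := p.lift k k' hk'
        have ab1 := C.ab1
        have ab2 := C.ab2
        by_cases c1 : c = b1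
        · refine ⟨a1, ?_, by rw [p.e1, ← c1, h1]⟩
          simp only [Finset.mem_erase, P']
          refine ⟨by grind, ab1, by simp⟩
        · by_cases c2 : c = b2
          · refine ⟨a2, ?_, by rw [p.e2, ← c2, h1]⟩
            simp only [Finset.mem_erase, P']
            refine ⟨ab2, by grind, by simp⟩
          · refine ⟨c, ?_, h1⟩
            simp only [Finset.mem_erase]
            exact ⟨c2, c1, hsub c hc⟩
    rw [Finset.card_erase_of_mem (Finset.mem_erase.2 ⟨hbb.symm, hsub _ hb2⟩),
      Finset.card_erase_of_mem (hsub _ hb1)] at this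
    simp at this
    have := Finset.card_le_card (s := {b1, b2}) (t := P') (by
      intro t; simp only [Finset.mem_insert, Finset.mem_singleton]
      rintro (rfl | rfl)
      · exact hsub _ hb1
      · exact hsub _ hb2)
    rw [Finset.card_pair hbb] at this
    omega
  · obtain ⟨d, hd, h1⟩ := p.use b1 hb1
    exact ⟨d, hsub d hd, h1⟩
  · obtain ⟨d, hd, h1⟩ := p.use b2 hb2
    exact ⟨d, hsub d hd, h1⟩
  · by_cases haa : a1 = a2
    · exact Or.inr ⟨haa, hbb⟩
    · obtain ⟨m1, m2⟩ := hU haa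
      obtain ⟨d, hd, h1⟩ := p.use a1 m1
      obtain ⟨d', hd', h1'⟩ := p.use a2 m2
      exact Or.inl ⟨H.resolve_right haa, ⟨d, hsub d hd, h1⟩, ⟨d', hsub d' hd', h1'⟩⟩

end pre

/-- colourings of the exceptional graph `E1` minus one edge -/
def tab1 : List (Fin 10 × Fin 10 × List (Fin 5)) := [
  (0, 1, [0, 2, 1, 0, 1, 2, 3, 2, 1, 4]),
  (0, 1, [0, 2, 1, 0, 4, 3, 2, 3, 4, 1]),
  (0, 8, [0, 1, 2, 3, 2, 1, 0, 1, 2, 4]),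
  (0, 8, [0, 4, 3, 2, 3, 4, 0, 1, 2, 1]),
  (0, 9, [0, 1, 2, 1, 0, 4, 3, 2, 1, 2]),
  (0, 9, [0, 1, 2, 3, 4, 0, 1, 0, 1, 2]),
  (1, 0, [2, 0, 1, 2, 3, 4, 0, 4, 3, 1]),
  (1, 0, [2, 0, 1, 2, 1, 0, 4, 0, 1, 3]),
  (1, 2, [1, 0, 2, 1, 0, 4, 3, 4, 0, 2]),
  (1, 2, [1, 0, 2, 1, 2, 3, 4, 3, 2, 0]),
  (2, 1, [1, 2, 0, 1, 0, 4, 3, 4, 0, 2]),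
  (2, 1, [1, 2, 0, 1, 2, 3, 4, 3, 2, 0]),
  (2, 3, [2, 1, 0, 2, 3, 4, 0, 4, 3, 1]),
  (2, 3, [2, 1, 0, 2, 1, 0, 4, 0, 1, 3]),
  (3, 2, [0, 1, 2, 0, 1, 2, 3, 2, 1, 4]),
  (3, 2, [0, 1, 2, 0, 4, 3, 2, 3, 4, 1]),
  (3, 4, [2, 3, 4, 0, 2, 1, 0, 4, 3, 1]),
  (3, 4, [3, 2, 1, 0, 2, 1, 0, 1, 2, 4]),
  (3, 9, [1, 0, 4, 0, 1, 2, 3, 4, 0, 2]),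
  (3, 9, [3, 2, 1, 0, 1, 0, 1, 0, 4, 2]),
  (4, 3, [0, 4, 3, 2, 0, 1, 2, 3, 4, 1]),
  (4, 3, [4, 0, 1, 2, 0, 1, 2, 1, 0, 3]),
  (4, 5, [3, 4, 0, 1, 0, 2, 1, 0, 4, 2]),
  (4, 5, [4, 3, 2, 1, 0, 2, 1, 2, 3, 0]),
  (5, 4, [3, 4, 0, 1, 2, 0, 1, 0, 4, 2]),
  (5, 4, [4, 3, 2, 1, 2, 0, 1, 2, 3, 0]),
  (5, 6, [0, 4, 3, 2, 1, 0, 2, 3, 4, 1]),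
  (5, 6, [4, 0, 1, 2, 1, 0, 2, 1, 0, 3]),
  (6, 5, [2, 3, 4, 0, 1, 2, 0, 4, 3, 1]),
  (6, 5, [3, 2, 1, 0, 1, 2, 0, 1, 2, 4]),
  (6, 7, [0, 1, 2, 3, 2, 1, 0, 2, 1, 4]),
  (6, 7, [0, 4, 3, 2, 3, 4, 0, 2, 1, 1]),
  (6, 9, [1, 0, 4, 3, 2, 1, 0, 1, 2, 2]),
  (6, 9, [3, 4, 0, 1, 0, 1, 0, 1, 2, 2]),
  (7, 6, [2, 3, 4, 0, 4, 3, 2, 0, 1, 1]),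
  (7, 6, [2, 1, 0, 4, 0, 1, 2, 0, 1, 3]),
  (7, 8, [1, 0, 4, 3, 4, 0, 1, 0, 2, 2]),
  (7, 8, [1, 2, 3, 4, 3, 2, 1, 0, 2, 0]),
  (8, 0, [2, 3, 4, 0, 4, 3, 2, 1, 0, 1]),
  (8, 0, [2, 1, 0, 4, 0, 1, 2, 1, 0, 3]),
  (8, 7, [1, 0, 4, 3, 4, 0, 1, 2, 0, 2]),
  (8, 7, [1, 2, 3, 4, 3, 2, 1, 2, 0, 0]),
  (9, 0, [2, 1, 0, 4, 3, 2, 1, 2, 1, 0]),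
  (9, 0, [2, 1, 2, 1, 2, 3, 4, 0, 1, 0]),
  (9, 3, [1, 2, 1, 2, 1, 0, 4, 3, 2, 0]),
  (9, 3, [4, 0, 1, 2, 1, 2, 1, 2, 3, 0]),
  (9, 6, [1, 2, 3, 4, 0, 1, 2, 1, 2, 0]),
  (9, 6, [4, 3, 2, 1, 2, 1, 2, 1, 0, 0])]

/-- colourings of the exceptional graph `E2` minus one edge -/
def tab2 : List (Fin 10 × Fin 10 × List (Fin 5)) := [
  (0, 1, [0, 2, 1, 0, 4, 1, 2, 1, 4, 3]),
  (0, 1, [0, 2, 1, 2, 1, 1, 0, 1, 3, 4]),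
  (0, 4, [0, 1, 2, 1, 2, 2, 3, 4, 0, 4]),
  (0, 4, [0, 4, 0, 1, 2, 3, 2, 1, 2, 1]),
  (0, 7, [0, 1, 2, 3, 4, 2, 1, 2, 4, 0]),
  (0, 7, [0, 4, 3, 2, 1, 0, 1, 2, 1, 2]),
  (1, 0, [2, 0, 1, 2, 1, 4, 0, 1, 3, 4]),
  (1, 0, [2, 0, 1, 0, 1, 1, 2, 1, 4, 3]),
  (1, 2, [1, 0, 2, 1, 2, 4, 3, 2, 0, 4]),
  (1, 2, [4, 0, 2, 1, 0, 1, 2, 3, 2, 1]),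
  (1, 5, [1, 0, 4, 3, 2, 2, 1, 2, 4, 0]),
  (1, 5, [4, 0, 1, 2, 3, 2, 1, 0, 1, 2]),
  (2, 1, [3, 2, 0, 1, 2, 1, 0, 4, 0, 4]),
  (2, 1, [1, 2, 0, 1, 0, 3, 4, 0, 2, 3]),
  (2, 3, [0, 1, 0, 2, 1, 2, 3, 4, 1, 2]),
  (2, 3, [2, 1, 0, 2, 1, 0, 4, 3, 1, 0]),
  (3, 2, [0, 1, 2, 0, 4, 2, 3, 4, 1, 2]),
  (3, 2, [2, 1, 2, 0, 1, 0, 4, 3, 1, 0]),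
  (3, 4, [1, 0, 4, 0, 2, 4, 3, 2, 1, 2]),
  (3, 4, [1, 2, 1, 0, 2, 3, 4, 0, 1, 0]),
  (3, 8, [2, 3, 4, 0, 1, 4, 0, 1, 2, 1]),
  (3, 8, [3, 2, 1, 0, 4, 1, 0, 4, 2, 1]),
  (4, 0, [2, 3, 2, 1, 0, 4, 0, 1, 0, 4]),
  (4, 0, [2, 1, 0, 1, 0, 0, 4, 3, 2, 3]),
  (4, 3, [1, 0, 1, 2, 0, 4, 3, 2, 1, 2]),
  (4, 3, [1, 2, 1, 2, 0, 3, 4, 0, 1, 0]),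
  (5, 1, [3, 2, 1, 0, 4, 0, 1, 2, 1, 2]),
  (5, 1, [1, 2, 3, 4, 0, 0, 1, 0, 3, 2]),
  (5, 6, [0, 1, 2, 3, 4, 0, 2, 1, 2, 1]),
  (5, 6, [2, 1, 0, 4, 3, 0, 2, 1, 0, 1]),
  (6, 5, [0, 1, 2, 3, 4, 2, 0, 4, 2, 1]),
  (6, 5, [2, 1, 0, 4, 3, 2, 0, 1, 0, 1]),
  (6, 7, [1, 0, 4, 3, 2, 4, 0, 2, 2, 1]),
  (6, 7, [1, 2, 3, 4, 0, 1, 0, 2, 0, 1]),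
  (6, 9, [2, 3, 4, 0, 1, 4, 0, 1, 1, 2]),
  (6, 9, [3, 2, 1, 0, 4, 1, 0, 4, 1, 2]),
  (7, 0, [2, 3, 4, 0, 1, 2, 1, 0, 1, 2]),
  (7, 0, [2, 1, 0, 4, 3, 0, 1, 0, 3, 2]),
  (7, 6, [1, 0, 4, 3, 2, 1, 2, 0, 2, 1]),
  (7, 6, [1, 2, 3, 4, 0, 1, 2, 0, 0, 1]),
  (8, 3, [0, 4, 3, 2, 1, 3, 2, 1, 0, 1]),
  (8, 3, [4, 0, 1, 2, 3, 1, 2, 3, 0, 1]),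
  (8, 9, [3, 4, 0, 1, 2, 0, 1, 2, 0, 2]),
  (8, 9, [4, 3, 2, 1, 0, 2, 1, 0, 0, 2]),
  (9, 6, [0, 4, 3, 2, 1, 3, 2, 1, 1, 0]),
  (9, 6, [4, 0, 1, 2, 3, 1, 2, 3, 1, 0]),
  (9, 8, [3, 4, 0, 1, 2, 0, 1, 2, 2, 0]),
  (9, 8, [4, 3, 2, 1, 0, 2, 1, 0, 2, 0])]

/-- a colouring of the exceptional graph minus the edge `z t` -/
def OkCol (L : List (Fin 10 × Fin 10)) (z t : Fin 10) (ψ : Fin 10 → Fin 5) : Prop :=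
  ψ z = 0 ∧ ψ t = 2 ∧
    ∀ e ∈ L, (e.1 = z ∧ e.2 = t) ∨ (e.1 = t ∧ e.2 = z) ∨ adj5 (ψ e.1) (ψ e.2)

instance (L z t ψ) : Decidable (OkCol L z t ψ) := by unfold OkCol; infer_instance

/-- read a row of the table -/
def colAt (l : List (Fin 5)) (i : Fin 10) : Fin 5 := l.getD i.1 0

/-- room for the third string -/
def Room (d e : Fin 5) : Prop :=
  ∃ c y : Fin 5, adj5 c d ∧ ¬ adj5 y 4 ∧ ¬ adj5 y c ∧ ¬ adj5 y e

instance (d e) : Decidable (Room d e) := by unfold Room; infer_instance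

/-- `Room` as a bit table -/
def roomB (d e : Fin 5) : Bool := Nat.testBit 33553151 (5 * d.1 + e.1)

theorem roomB_spec : ∀ d e : Fin 5, roomB d e = true → Room d e := by decide +kernel

def tabA (tab : List (Fin 10 × Fin 10 × List (Fin 5))) (z1 t1 z2 : Fin 10) : Bool :=
  tab.any fun r => decide (r.1 = z1) && (decide (r.2.1 = t1) && decide (colAt r.2.2 z2 ≠ 4))

def tabB (tab : List (Fin 10 × Fin 10 × List (Fin 5))) (z1 t1 z2 i : Fin 10) : Bool :=
  tab.any fun r => Nat.beq r.1.1 z1.1 && (Nat.beq r.2.1.1 t1.1 &&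
    roomB (colAt r.2.2 z2) (colAt r.2.2 i))

def tabC (tab : List (Fin 10 × Fin 10 × List (Fin 5))) (L : List (Fin 10 × Fin 10))
    (z1 t1 z2 i : Fin 10) : Prop :=
  tabB tab z1 t1 z2 i = true ∨ ∀ t2, adjL L z2 t2 → tabB tab z2 t2 z1 i = true

instance (tab L z1 t1 z2 i) : Decidable (tabC tab L z1 t1 z2 i) := by unfold tabC; infer_instance

theorem tab1_ok : (tab1.all fun r => decide (OkCol L1 r.1 r.2.1 (colAt r.2.2))) = true := by
  decide +kernel
theorem tab2_ok : (tab2.all fun r => decide (OkCol L2 r.1 r.2.1 (colAt r.2.2))) = true := by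
  decide +kernel

theorem tab1_A : ∀ z1 t1 : Fin 10, adjL L1 z1 t1 → ∀ z2, z2 ≠ z1 → tabA tab1 z1 t1 z2 = true := by
  decide +kernel
theorem tab2_A : ∀ z1 t1 : Fin 10, adjL L2 z1 t1 → ∀ z2, z2 ≠ z1 → tabA tab2 z1 t1 z2 = true := by
  decide +kernel

theorem tab1_B : ∀ z1 t1 : Fin 10, adjL L1 z1 t1 → ∀ z2, z2 ≠ z1 → ∀ i, i ≠ z1 → i ≠ z2 →
    tabC tab1 L1 z1 t1 z2 i := by decide +kernel
theorem tab2_B : ∀ z1 t1 : Fin 10, adjL L2 z1 t1 → ∀ z2, z2 ≠ z1 → ∀ i, i ≠ z1 → i ≠ z2 →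
    tabC tab2 L2 z1 t1 z2 i := by decide +kernel

theorem tab_spec {L : List (Fin 10 × Fin 10)} (hL : L = L1 ∨ L = L2) :
    ∃ tab : List (Fin 10 × Fin 10 × List (Fin 5)),
      (∀ r ∈ tab, OkCol L r.1 r.2.1 (colAt r.2.2)) ∧
      (∀ z1 t1 : Fin 10, adjL L z1 t1 → ∀ z2, z2 ≠ z1 → tabA tab z1 t1 z2 = true) ∧
      (∀ z1 t1 : Fin 10, adjL L z1 t1 → ∀ z2, z2 ≠ z1 → ∀ i, i ≠ z1 → i ≠ z2 →
        tabC tab L z1 t1 z2 i) := by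
  rcases hL with rfl | rfl
  · refine ⟨tab1, ?_, tab1_A, tab1_B⟩
    have := tab1_ok
    rw [List.all_eq_true] at this
    exact fun r hr => of_decide_eq_true (this r hr)
  · refine ⟨tab2, ?_, tab2_A, tab2_B⟩
    have := tab2_ok
    rw [List.all_eq_true] at this
    exact fun r hr => of_decide_eq_true (this r hr)

theorem E_A {L : List (Fin 10 × Fin 10)} (hL : L = L1 ∨ L = L2) {z1 t1 z2 : Fin 10}
    (h1 : adjL L z1 t1) (h2 : z2 ≠ z1) : ∃ ψ, OkCol L z1 t1 ψ ∧ ψ z2 ≠ 4 := by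
  obtain ⟨tab, o, A, -⟩ := tab_spec hL
  obtain ⟨r, hr, h3⟩ := List.any_eq_true.1 (A _ _ h1 _ h2)
  simp only [Bool.and_eq_true, decide_eq_true_eq] at h3
  obtain ⟨rfl, rfl, h4⟩ := h3
  exact ⟨_, o r hr, h4⟩

theorem tabB_spec {L : List (Fin 10 × Fin 10)} {tab : List (Fin 10 × Fin 10 × List (Fin 5))}
    (o : ∀ r ∈ tab, OkCol L r.1 r.2.1 (colAt r.2.2)) {z1 t1 z2 i : Fin 10}
    (h : tabB tab z1 t1 z2 i = true) : ∃ ψ, OkCol L z1 t1 ψ ∧ Room (ψ z2) (ψ i) := by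
  obtain ⟨r, hr, h3⟩ := List.any_eq_true.1 h
  simp only [Bool.and_eq_true, Nat.beq_eq, Fin.val_inj] at h3
  obtain ⟨rfl, rfl, h4⟩ := h3
  exact ⟨_, o r hr, roomB_spec _ _ h4⟩

theorem E_B {L : List (Fin 10 × Fin 10)} (hL : L = L1 ∨ L = L2) {z1 t1 z2 t2 i : Fin 10}
    (h1 : adjL L z1 t1) (h2 : z2 ≠ z1) (h3 : i ≠ z1) (h4 : i ≠ z2) (h5 : adjL L z2 t2) :
    (∃ ψ, OkCol L z1 t1 ψ ∧ Room (ψ z2) (ψ i)) ∨ ∃ ψ, OkCol L z2 t2 ψ ∧ Room (ψ z1) (ψ i) := by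
  obtain ⟨tab, o, -, B⟩ := tab_spec hL
  rcases B _ _ h1 _ h2 i h3 h4 with h6 | h6
  · exact Or.inl (tabB_spec o h6)
  · exact Or.inr (tabB_spec o (h6 _ h5))

theorem E_deg1 : ∀ z i, adjL L1 z i → ∀ j, adjL L1 z j → i ≠ j → ∀ k, adjL L1 z k → k ≠ i → k ≠ j →
    ∀ l, adjL L1 z l → l = i ∨ l = j ∨ l = k := by decide +kernel
theorem E_deg2 : ∀ z i, adjL L2 z i → ∀ j, adjL L2 z j → i ≠ j → ∀ k, adjL L2 z k → k ≠ i → k ≠ j →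
    ∀ l, adjL L2 z l → l = i ∨ l = j ∨ l = k := by decide +kernel

theorem E_deg {L : List (Fin 10 × Fin 10)} (hL : L = L1 ∨ L = L2) {z i j k l : Fin 10}
    (h1 : adjL L z i) (h2 : adjL L z j) (h3 : adjL L z k) (h4 : adjL L z l)
    (hij : i ≠ j) (hik : i ≠ k) (hil : i ≠ l) (hjk : j ≠ k) (hjl : j ≠ l) (hkl : k ≠ l) : False := by
  rcases hL with rfl | rfl
  · have := E_deg1 z i h1 j h2 hij k h3 hik.symm hjk.symm l h4
    grind
  · have := E_deg2 z i h1 j h2 hij k h3 hik.symm hjk.symm l h4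
    grind

section exc
variable {V : Type} {G : SimpleGraph V} {v x1 x2 u1 u2 a1 b1 a2 b2 : V}

/-- the critical graph is one of the two exceptional ones -/
structure ES (G : SimpleGraph V) (v x1 x2 u1 u2 a1 b1 a2 b2 : V) (L : List (Fin 10 × Fin 10))
    (π : V → Fin 10) (P : Finset V) : Prop where
  hL : L = L1 ∨ L = L2
  lift : ∀ i j, adjL L i j → ∃ c ∈ P, ∃ d ∈ P, G.Adj c d ∧ π c = i ∧ π d = j
  ex1 : ∀ c ∈ P, ∀ d ∈ P, G.Adj c d → adjL L (π c) (π d)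
  ex2 : ∀ c ∈ P, ∀ d ∈ P, G.Adj c d → ∀ c' ∈ P, ∀ d' ∈ P, G.Adj c' d' → π c' = π c → π d' = π d →
    c' = c ∧ d' = d
  out : ∀ t ∈ P, t ≠ v ∧ t ≠ x1 ∧ t ≠ x2 ∧ t ≠ u1 ∧ t ≠ u2
  hQ : ∀ q, G.Adj v q → q ∉ P
  e1 : π a1 = π b1
  e2 : π a2 = π b2
  ma1 : a1 ∈ P
  mb1 : b1 ∈ P
  ma2 : a2 ∈ P
  mb2 : b2 ∈ P
  pP : pR G P ≤ 12
  card : P.card = 12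

/-- the unmerged case -/
structure EU (G : SimpleGraph V) (v x1 x2 u1 u2 a1 b1 a2 b2 : V) (L : List (Fin 10 × Fin 10))
    (π : V → Fin 10) (P : Finset V) : Prop extends ES G v x1 x2 u1 u2 a1 b1 a2 b2 L π P where
  ne : a1 ≠ a2 ∧ a1 ≠ b2 ∧ b1 ≠ a2 ∧ b1 ≠ b2
  fib : ∀ c ∈ P, ∀ d ∈ P, π c = π d → c = d ∨ (c = a1 ∧ d = b1) ∨ (c = b1 ∧ d = a1) ∨
    (c = a2 ∧ d = b2) ∨ (c = b2 ∧ d = a2)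
  ua1 : ∃ d ∈ P, G.Adj a1 d
  ub1 : ∃ d ∈ P, G.Adj b1 d
  ua2 : ∃ d ∈ P, G.Adj a2 d
  ub2 : ∃ d ∈ P, G.Adj b2 d

variable {L : List (Fin 10 × Fin 10)} {π : V → Fin 10} {P : Finset V}

theorem ES.swap (E : ES G v x1 x2 u1 u2 a1 b1 a2 b2 L π P) : ES G v x2 x1 u2 u1 a2 b2 a1 b1 L π P :=
  ⟨E.hL, E.lift, E.ex1, E.ex2, fun t ht => by have := E.out t ht; tauto, E.hQ, E.e2, E.e1, E.ma2, E.mb2,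
    E.ma1, E.mb1, E.pP, E.card⟩

theorem EU.swap (E : EU G v x1 x2 u1 u2 a1 b1 a2 b2 L π P) : EU G v x2 x1 u2 u1 a2 b2 a1 b1 L π P :=
  ⟨E.toES.swap, by have := E.ne; tauto, fun c hc d hd h => by have := E.fib c hc d hd h; tauto,
    E.ua2, E.ub2, E.ua1, E.ub1⟩

theorem EU.sw1 (E : EU G v x1 x2 u1 u2 a1 b1 a2 b2 L π P) : EU G v x1 x2 u1 u2 b1 a1 a2 b2 L π P :=
  ⟨⟨E.hL, E.lift, E.ex1, E.ex2, E.out, E.hQ, E.e1.symm, E.e2, E.mb1, E.ma1, E.ma2, E.mb2, E.pP, E.card⟩,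
    by have := E.ne; tauto, fun c hc d hd h => by have := E.fib c hc d hd h; tauto,
    E.ub1, E.ua1, E.ua2, E.ub2⟩

theorem EU.sw2 (E : EU G v x1 x2 u1 u2 a1 b1 a2 b2 L π P) : EU G v x1 x2 u1 u2 a1 b1 b2 a2 L π P :=
  E.swap.sw1.swap

/-- `b` has a unique edge, which goes to `t` -/
def OneE (G : SimpleGraph V) (π : V → Fin 10) (P : Finset V) (b : V) (t : Fin 10) : Prop :=
  (∃ d ∈ P, G.Adj b d ∧ π d = t) ∧ ∀ d ∈ P, G.Adj b d → π d = t

theorem ES.one (E : ES G v x1 x2 u1 u2 a1 b1 a2 b2 L π P) {a b : V} (ha : a ∈ P) (hb : b ∈ P)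
    (hab : a ≠ b) (hπ : π a = π b) (ua : ∃ d ∈ P, G.Adj a d) (ub : ∃ d ∈ P, G.Adj b d) :
    (∃ t, OneE G π P b t) ∨ ∃ t, OneE G π P a t := by
  obtain ⟨d, hd, had⟩ := ua
  obtain ⟨e, he, hbe⟩ := ub
  by_contra hcon
  push Not at hcon
  have h1 := hcon.1 (π e)
  have h2 := hcon.2 (π d)
  simp only [OneE, not_and, not_forall] at h1 h2
  obtain ⟨e', he', hbe', hne⟩ := h1 ⟨e, he, hbe, rfl⟩
  obtain ⟨d', hd', had', hnd⟩ := h2 ⟨d, hd, had, rfl⟩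
  have key : ∀ s ∈ P, ∀ t ∈ P, G.Adj a s → G.Adj b t → π s ≠ π t := by
    intro s hs t ht h1 h2 h3
    exact hab (E.ex2 b hb t ht h2 a ha s hs h1 hπ h3).1
  have z1 := E.ex1 b hb e he hbe
  have z2 := E.ex1 b hb e' he' hbe'
  have z3 := E.ex1 a ha d hd had
  have z4 := E.ex1 a ha d' hd' had'
  rw [hπ] at z3 z4
  exact E_deg E.hL z1 z2 z3 z4 (fun h => hne h.symm) (key d hd e he had hbe).symm
    (key d' hd' e he had' hbe).symm (key d hd e' he' had hbe').symm (key d' hd' e' he' had' hbe').symm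
    (fun h => hnd h.symm)

variable [DecidableEq V]

/-- the colouring -/
def phi (u1 u2 b1 : V) (c2 : Fin 5) (π : V → Fin 10) (ψ : Fin 10 → Fin 5) (t : V) : Fin 5 :=
  if t = u1 then 4 else if t = u2 then c2 else if t = b1 then 3 else ψ (π t)

theorem ES.col (E : ES G v x1 x2 u1 u2 a1 b1 a2 b2 L π P) (C : Conf G v x1 x2 u1 u2 a1 b1 a2 b2)
    (n1 : b1 ≠ a2) (n2 : b1 ≠ b2) {t : Fin 10} (ht : OneE G π P b1 t) {ψ : Fin 10 → Fin 5}
    (hψ : OkCol L (π a1) t ψ) {c2 : Fin 5} (hc : adj5 c2 (ψ (π a2))) :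
    (∀ c d, c ∈ insert u1 (insert u2 P) → d ∈ insert u1 (insert u2 P) → G.Adj c d →
      adj5 (phi u1 u2 b1 c2 π ψ c) (phi u1 u2 b1 c2 π ψ d)) ∧
    phi u1 u2 b1 c2 π ψ u1 = 4 ∧ phi u1 u2 b1 c2 π ψ u2 = c2 ∧ phi u1 u2 b1 c2 π ψ b1 = 3 ∧
    phi u1 u2 b1 c2 π ψ a1 = 0 ∧ ∀ d ∈ P, d ≠ b1 → phi u1 u2 b1 c2 π ψ d = ψ (π d) := by
  obtain ⟨hz, ht2, hok⟩ := hψ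
  obtain ⟨⟨w, hw, hbw, hwt⟩, hone⟩ := ht
  obtain ⟨d1, d2, d3, d4, d5, d6, d7, d8, d9, d10⟩ := C.dist5
  obtain ⟨-, -, -, f4, f5⟩ := C.b1n
  have v1 : phi u1 u2 b1 c2 π ψ u1 = 4 := by simp [phi]
  have v2 : phi u1 u2 b1 c2 π ψ u2 = c2 := by simp [phi, d10.symm]
  have v3 : phi u1 u2 b1 c2 π ψ b1 = 3 := by simp [phi, f4, f5]
  have v5 : ∀ d ∈ P, d ≠ b1 → phi u1 u2 b1 c2 π ψ d = ψ (π d) := by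
    intro d hd hdb
    obtain ⟨-, -, -, g4, g5⟩ := E.out d hd
    simp [phi, g4, g5, hdb]
  have v4 : phi u1 u2 b1 c2 π ψ a1 = 0 := by rw [v5 a1 E.ma1 C.ab1, hz]
  refine ⟨?_, v1, v2, v3, v4, v5⟩
  set φ := phi u1 u2 b1 c2 π ψ
  set R := insert u1 (insert u2 P) with hR
  have outR : ∀ t ∈ R, t ≠ x1 ∧ t ≠ x2 := by
    intro t ht
    rcases Finset.mem_insert.1 ht with rfl | ht'
    · exact ⟨d6.symm, d8.symm⟩
    · rcases Finset.mem_insert.1 ht' with rfl | ht''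
      · exact ⟨d7.symm, d9.symm⟩
      · exact ⟨(E.out t ht'').2.1, (E.out t ht'').2.2.1⟩
  have k1 : ∀ d ∈ R, G.Adj u1 d → adj5 (φ u1) (φ d) := by
    intro d hd h1
    rcases (C.nu1 d).1 h1 with rfl | rfl | rfl
    · exact absurd rfl (outR _ hd).1
    · rw [v1, v4]; decide
    · rw [v1, v3]; decide
  have k2 : ∀ d ∈ R, G.Adj u2 d → adj5 (φ u2) (φ d) := by
    intro d hd h1
    rcases (C.nu2 d).1 h1 with rfl | rfl | rfl
    · exact absurd rfl (outR _ hd).2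
    · rw [v2, v5 _ E.ma2 n1.symm]; exact hc
    · rw [v2, v5 _ E.mb2 n2.symm, ← E.e2]; exact hc
  have k3 : ∀ d ∈ P, G.Adj b1 d → adj5 (φ b1) (φ d) := by
    intro d hd h1
    rw [v3, v5 d hd h1.ne', hone d hd h1, ht2]; decide
  have k4 : ∀ c ∈ P, ∀ d ∈ P, c ≠ b1 → d ≠ b1 → G.Adj c d → adj5 (φ c) (φ d) := by
    intro c hc d hd hcb hdb hcd
    rw [v5 c hc hcb, v5 d hd hdb]
    have q1 : ¬ (π c = π a1 ∧ π d = t) := by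
      rintro ⟨h1, h2⟩
      exact hcb (E.ex2 b1 E.mb1 w hw hbw c hc d hd hcd (h1.trans E.e1) (h2.trans hwt.symm)).1
    have q2 : ¬ (π d = π a1 ∧ π c = t) := by
      rintro ⟨h1, h2⟩
      exact hdb (E.ex2 b1 E.mb1 w hw hbw d hd c hc hcd.symm (h1.trans E.e1) (h2.trans hwt.symm)).1
    rcases E.ex1 c hc d hd hcd with h1 | h1
    · rcases hok _ h1 with r | r | r
      · exact absurd r q1
      · exact absurd r.symm q2
      · exact r
    · rcases hok _ h1 with r | r | r
      · exact absurd r q2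
      · exact absurd r.symm q1
      · exact adj5_symm r
  intro c d hc hd hcd
  rcases Finset.mem_insert.1 hc with rfl | hc'
  · exact k1 d hd hcd
  rcases Finset.mem_insert.1 hd with rfl | hd'
  · exact adj5_symm (k1 c hc hcd.symm)
  rcases Finset.mem_insert.1 hc' with rfl | hc''
  · exact k2 d hd hcd
  rcases Finset.mem_insert.1 hd' with rfl | hd''
  · exact adj5_symm (k2 c hc hcd.symm)
  by_cases hcb : c = b1
  · subst hcb; exact k3 d hd'' hcd
  by_cases hdb : d = b1
  · subst hdb; exact adj5_symm (k3 c hc'' hcd.symm)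
  exact k4 c hc'' d hd'' hcb hdb hcd

variable [Fintype V]

theorem ES.R0 (E : ES G v x1 x2 u1 u2 a1 b1 a2 b2 L π P) (C : Conf G v x1 x2 u1 u2 a1 b1 a2 b2) :
    v ∉ insert u1 (insert u2 P) ∧ (∀ q, G.Adj v q → q ∉ insert u1 (insert u2 P)) ∧
    pR G (insert u1 (insert u2 P)) ≤ 6 ∧ 6 ≤ (insert u1 (insert u2 P)).card := by
  have o := E.out
  refine ⟨?_, ?_, ?_, ?_⟩
  · simp only [Finset.mem_insert]
    have := C.vu1
    have := C.vu2
    have := o v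
    tauto
  · intro q hq
    simp only [Finset.mem_insert]
    rintro (rfl | rfl | h)
    · exact C.nvu1 hq
    · exact C.nvu2 hq
    · exact E.hQ q hq h
  · have s1 : pR G (insert u2 P) ≤ pR G P - 3 :=
      pR_add2 (fun h => (o _ h).2.2.2.2 rfl) E.ma2 E.mb2 C.ab2 C.ua2 C.ub2
    have s2 : pR G (insert u1 (insert u2 P)) ≤ pR G (insert u2 P) - 3 :=
      pR_add2 (a := a1) (b := b1) (by
        simp only [Finset.mem_insert, not_or]
        exact ⟨C.uu, fun h => (o _ h).2.2.2.1 rfl⟩) (by simp [E.ma1]) (by simp [E.mb1]) C.ab1 C.ua1 C.ub1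
    have := E.pP
    omega
  · have := Finset.card_le_card (s := P) (t := insert u1 (insert u2 P)) (by
      intro t ht; simp [ht])
    have := E.card
    omega

/-- merged case -/
theorem ES.merged (E : ES G v x1 x2 u1 u2 a1 b1 a2 b2 L π P) (C : Conf G v x1 x2 u1 u2 a1 b1 a2 b2)
    (h : SmallestCex G) (haa : a1 = a2) (hbb : b1 ≠ b2) (ub1 : ∃ d ∈ P, G.Adj b1 d)
    (ub2 : ∃ d ∈ P, G.Adj b2 d) : False := by
  have main : ∀ {x1 x2 u1 u2 a1 b1 a2 b2 : V}, ES G v x1 x2 u1 u2 a1 b1 a2 b2 L π P →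
      Conf G v x1 x2 u1 u2 a1 b1 a2 b2 → a1 = a2 → b1 ≠ b2 → ∀ t, ¬ OneE G π P b1 t := by
    intro x1 x2 u1 u2 a1 b1 a2 b2 E C haa hbb t ht
    obtain ⟨⟨w, hw, hbw, hwt⟩, -⟩ := id ht
    have hadj : adjL L (π a1) t := by rw [E.e1, ← hwt]; exact E.ex1 _ E.mb1 _ hw hbw
    obtain ⟨z2, hz2⟩ : ∃ z2 : Fin 10, z2 ≠ π a1 := exists_ne _
    obtain ⟨ψ, hψ, -⟩ := E_A E.hL hadj hz2
    have hn : b1 ≠ a2 := by rw [← haa]; exact C.ab1.symm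
    obtain ⟨hφ, v1, v2, -⟩ := E.col C hn hbb ht hψ (c2 := 4) (by
      rw [← haa, hψ.1]; decide)
    obtain ⟨r1, r2, r3, r4⟩ := E.R0 C
    exact C.star h r4 (by simp) (by simp) r1 r2 (by omega) hφ (v1.trans v2.symm)
  rcases E.one E.mb1 E.mb2 hbb (E.e1.symm.trans ((congrArg π haa).trans E.e2)) ub1 ub2 with
    ⟨t, ht⟩ | ⟨t, ht⟩
  · exact main E.swap C.swap haa.symm hbb.symm t ht
  · exact main E C haa hbb t ht

theorem EU.z_ne (E : EU G v x1 x2 u1 u2 a1 b1 a2 b2 L π P) (hab : a1 ≠ b1) : π a2 ≠ π a1 := by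
  intro hz
  have := E.fib _ E.ma2 _ E.ma1 hz
  have := E.ne
  grind

theorem EU.exc (E : EU G v x1 x2 u1 u2 a1 b1 a2 b2 L π P) (C : Conf G v x1 x2 u1 u2 a1 b1 a2 b2)
    (h : SmallestCex G) {t : Fin 10} (ht : OneE G π P b1 t) :
    ∃ x3 u3, Cs3 G v x1 x2 x3 u3 ∧ ∀ t, t ∈ insert u1 (insert u2 P) ∨ t = x1 ∨ t = x2 ∨ t = v ∨ t = x3 := by
  obtain ⟨⟨w, hw, hbw, hwt⟩, -⟩ := id ht
  have hadj : adjL L (π a1) t := by rw [E.e1, ← hwt]; exact E.ex1 _ E.mb1 _ hw hbw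
  obtain ⟨ψ, hψ, h4⟩ := E_A E.hL hadj (E.z_ne C.ab1)
  obtain ⟨r1, r2, r3, r4⟩ := E.R0 C
  obtain ⟨c2, hc2, μ, hc3, hc4⟩ : ∃ c2, adj5 c2 (ψ (π a2)) ∧ ∃ μ, adj5 μ 4 ∧ adj5 μ c2 := by
    generalize ψ (π a2) = d at h4; revert d; decide
  obtain ⟨hφ, v1, v2, -⟩ := E.col C E.ne.2.2.1 E.ne.2.2.2 ht hψ hc2
  exact C.star2 h r4 (by simp) (by simp) r1 r2 r3 hφ (μ := μ) (by rw [v1]; exact hc3) (by rw [v2]; exact hc4)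

theorem EU.room (E : EU G v x1 x2 u1 u2 a1 b1 a2 b2 L π P) (C : Conf G v x1 x2 u1 u2 a1 b1 a2 b2)
    (h : SmallestCex G) {t : Fin 10} (ht : OneE G π P b1 t) {x3 u3 : V} (h3 : Cs3 G v x1 x2 x3 u3)
    (hcov : ∀ t, t ∈ insert u1 (insert u2 P) ∨ t = x1 ∨ t = x2 ∨ t = v ∨ t = x3)
    (hu3 : u3 ∈ P) (hub : u3 ≠ b1) {ψ : Fin 10 → Fin 5}
    (hψ : OkCol L (π a1) t ψ) (hr : Room (ψ (π a2)) (ψ (π u3))) : False := by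
  obtain ⟨c2, y, g1, g2, g3, g4⟩ := hr
  obtain ⟨hφ, v1, v2, v3, v4, v5⟩ := E.col C E.ne.2.2.1 E.ne.2.2.2 ht hψ g1
  have memP : ∀ t, t ∉ [v, x1, x2, u1, u2, x3] → t ∈ insert u1 (insert u2 P) := by
    intro t ht
    have := hcov t
    simp only [List.mem_cons, List.not_mem_nil] at ht
    tauto
  refine C.forb3 h.crit h3 (g := phi u1 u2 b1 c2 π ψ) (c1 := 4) (c2 := c2) (y := y) ?_ ?_ ?_ ?_ ?_ g2 g3 ?_
  · intro c d hcd hc hd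
    exact hφ c d (memP c hc) (memP d hd) hcd
  · rw [v4]; decide
  · rw [v3]; decide
  · rw [v5 _ E.ma2 E.ne.2.2.1.symm]; exact g1
  · rw [v5 _ E.mb2 E.ne.2.2.2.symm, ← E.e2]; exact g1
  · rw [v5 _ hu3 hub]; exact g4

theorem EU.done (E : EU G v x1 x2 u1 u2 a1 b1 a2 b2 L π P) (C : Conf G v x1 x2 u1 u2 a1 b1 a2 b2)
    (h : SmallestCex G) : False := by
  have main : ∀ {a1 b1 a2 b2 : V}, EU G v x1 x2 u1 u2 a1 b1 a2 b2 L π P →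
      Conf G v x1 x2 u1 u2 a1 b1 a2 b2 → ∀ t1 t2, OneE G π P b1 t1 → OneE G π P b2 t2 → False := by
    intro a1 b1 a2 b2 E C t1 t2 ht1 ht2
    obtain ⟨x3, u3, h3, hcov⟩ := E.exc C h ht1
    obtain ⟨⟨w, hw, hbw, hwt⟩, -⟩ := id ht1
    have hadj : adjL L (π a1) t1 := by rw [E.e1, ← hwt]; exact E.ex1 _ E.mb1 _ hw hbw
    obtain ⟨⟨w', hw', hbw', hwt'⟩, -⟩ := id ht2
    have hadj' : adjL L (π a2) t2 := by rw [E.e2, ← hwt']; exact E.ex1 _ E.mb2 _ hw' hbw'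
    obtain ⟨k1, k2, k3, k4, k5, k6⟩ := id h3
    have vx3 : G.Adj v x3 := (k4 x3).2 (by simp)
    have xu3 : G.Adj x3 u3 := (k5 u3).2 (by simp)
    have f1 : ∀ s, G.Adj u1 s → s ≠ u3 := by
      rintro s hs rfl
      exact C.n5v _ _ _ _ vx3 xu3 hs.symm C.xu1.symm C.vx1.symm
    have f2 : ∀ s, G.Adj u2 s → s ≠ u3 := by
      rintro s hs rfl
      exact C.n5v _ _ _ _ vx3 xu3 hs.symm C.xu2.symm C.vx2.symm
    have nv3 : ¬ G.Adj v u3 := fun hh => C.hT _ _ _ vx3 xu3 hh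
    have n31 : u3 ≠ u1 := by rintro rfl; exact h.crit.no_twin k1 k5 C.nx1
    have n32 : u3 ≠ u2 := by rintro rfl; exact h.crit.no_twin k2 k5 C.nx2
    have n33 : u3 ≠ x1 := by rintro rfl; exact nv3 C.vx1
    have n34 : u3 ≠ x2 := by rintro rfl; exact nv3 C.vx2
    have hu3 : u3 ∈ P := by
      have := hcov u3
      simp only [Finset.mem_insert] at this
      have := xu3.ne'
      have := k3.symm
      tauto
    have i1 : π u3 ≠ π a1 := by
      intro hz
      have := E.fib _ hu3 _ E.ma1 hz
      have := f1 _ C.ua1; have := f1 _ C.ub1; have := f2 _ C.ua2; have := f2 _ C.ub2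
      grind
    have i2 : π u3 ≠ π a2 := by
      intro hz
      have := E.fib _ hu3 _ E.ma2 hz
      have := f1 _ C.ua1; have := f1 _ C.ub1; have := f2 _ C.ua2; have := f2 _ C.ub2
      grind
    rcases E_B E.hL hadj (E.z_ne C.ab1) i1 i2 hadj' with ⟨ψ, hψ, hr⟩ | ⟨ψ, hψ, hr⟩
    · exact E.room C h ht1 h3 hcov hu3 (f1 _ C.ub1).symm hψ hr
    · refine E.swap.room C.swap h ht2 (x3 := x3) (u3 := u3)
        ⟨k2, k1, k3, fun t => (k4 t).trans (by tauto), k5, k6⟩ ?_ hu3 (f2 _ C.ub2).symm hψ hr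
      intro t
      have := hcov t
      simp only [Finset.mem_insert] at this ⊢
      tauto
  rcases E.one E.ma1 E.mb1 C.ab1 E.e1 E.ua1 E.ub1 with ⟨t, ht⟩ | ⟨t, ht⟩ <;>
  rcases E.one E.ma2 E.mb2 C.ab2 E.e2 E.ua2 E.ub2 with ⟨s, hs⟩ | ⟨s, hs⟩
  · exact main E C t s ht hs
  · exact main E.sw2 C.sw2 t s ht hs
  · exact main E.sw1 C.sw1 t s ht hs
  · exact main E.sw1.sw2 C.sw1.sw2 t s ht hs

end exc

section finish
variable {V : Type} {G : SimpleGraph V} {v x1 x2 u1 u2 a1 b1 a2 b2 : V}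

/-- the seven-cycle `u1 a1 a2 u2 b2 w b1` -/
structure T7 (G : SimpleGraph V) (v x1 x2 u1 u2 a1 b1 a2 b2 w : V) : Prop where
  aa : G.Adj a1 a2
  bw1 : G.Adj b1 w
  bw2 : G.Adj b2 w
  ne : a1 ≠ a2 ∧ a1 ≠ b2 ∧ b1 ≠ a2 ∧ b1 ≠ b2
  wn : w ≠ v ∧ w ≠ x1 ∧ w ≠ x2 ∧ w ≠ u1 ∧ w ≠ u2
  wne : w ≠ a1 ∧ w ≠ b1 ∧ w ≠ a2 ∧ w ≠ b2
  nvw : ¬ G.Adj v w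
  n1 : ¬ G.Adj a1 b2
  n2 : ¬ G.Adj b1 a2
  n3 : ¬ G.Adj b1 b2
  n4 : ¬ G.Adj a1 w
  n5 : ¬ G.Adj a2 w

variable [DecidableEq V] [Fintype V]

set_option maxHeartbeats 4000000 in
theorem Red.done {m : ℕ} {K : SimpleGraph (Fin m)} {π : V → Fin m} {P : Finset V}
    (hm : m < Fintype.card V) (r : Red G v x1 x2 u1 u2 a1 b1 a2 b2 K π P)
    (C : Conf G v x1 x2 u1 u2 a1 b1 a2 b2) (h : SmallestCex G)
    (H : ∀ a1 b1 a2 b2 w, Conf G v x1 x2 u1 u2 a1 b1 a2 b2 → T7 G v x1 x2 u1 u2 a1 b1 a2 b2 w → False) :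
    False := by
  obtain ⟨d1, d2, d3, d4, d5, d6, d7, d8, d9, d10⟩ := C.dist5
  have out := r.out
  have hcnt := cover_count (G := G) (K := K) (π := π) (P := P) ∅ (by simp) (by simpa [Lifts] using r.lift)
  rw [r.card] at hcnt
  simp only [Finset.card_empty] at hcnt
  push_cast at hcnt
  have s1 : pR G (insert u2 P) ≤ pR G P - 3 :=
    pR_add2 (fun h => (out _ h).2.2.2.2 rfl) r.ma2 r.mb2 C.ab2 C.ua2 C.ub2
  have s2 : pR G (insert u1 (insert u2 P)) ≤ pR G (insert u2 P) - 3 :=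
    pR_add2 (a := a1) (b := b1) (by
      simp only [Finset.mem_insert, not_or]
      exact ⟨C.uu, fun h => (out _ h).2.2.2.1 rfl⟩) (by simp [r.ma1]) (by simp [r.mb1]) C.ab1 C.ua1 C.ub1
  set R0 := insert u1 (insert u2 P) with hR0
  have hcard : R0.card = m + 4 := by
    rw [hR0, Finset.card_insert_of_notMem, Finset.card_insert_of_notMem, r.card]
    · exact fun h => (out _ h).2.2.2.2 rfl
    · simp only [Finset.mem_insert, not_or]
      exact ⟨C.uu, fun h => (out _ h).2.2.2.1 rfl⟩
  have h3 := r.crit.four.1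
  have h6 : 6 ≤ R0.card := by omega
  have hv : v ∉ R0 := by
    simp only [hR0, Finset.mem_insert]
    have := out v
    have := C.dist5
    clear * - this d1 d2 d3 d4 out
    rintro (h | h | h)
    · exact d3 h
    · exact d4 h
    · exact (out v h).1 rfl
  have hQ : ∀ q, G.Adj v q → q ∉ R0 := by
    intro q hq
    simp only [hR0, Finset.mem_insert]
    rintro (rfl | rfl | h)
    · exact C.nvu1 hq
    · exact C.nvu2 hq
    · exact r.hQ q hq h
  have hx1 := hQ _ C.vx1
  have hx2 := hQ _ C.vx2
  have hu1 : u1 ∈ R0 := by simp [hR0]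
  have hu2 : u2 ∈ R0 := by simp [hR0]
  have low := h.P4 h6 (fun hh => hv (hh ▸ Finset.mem_univ v))
  have exact1 : 2 ≤ pot K → pot K ≤ 3 → ∀ c ∈ P, ∀ d ∈ P, G.Adj c d → K.Adj (π c) (π d) ∧
      ∀ c' ∈ P, ∀ d' ∈ P, G.Adj c' d' → π c' = π c → π d' = π d → c' = c ∧ d' = d := by
    intro k1 k2
    apply cover_exact r.lift
    rw [r.card]; push_cast; omega
  rcases h.cls3 r.crit hm with ⟨c1, -⟩ | ⟨⟨L, e, hL, hadj⟩, c2, c3⟩ | ⟨rfl, rfl, c3⟩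
  · have t1 : pR G (insert x1 R0) ≤ pR G R0 + 1 := pR_add1 (a := u1) hx1 hu1 C.xu1
    have t2 : pR G (insert v (insert x1 R0)) ≤ pR G (insert x1 R0) + 1 :=
      pR_add1 (a := x1) (by simp [hv, d1]) (by simp) C.vx1
    have t3 : pR G (insert x2 (insert v (insert x1 R0))) ≤ pR G (insert v (insert x1 R0)) - 3 :=
      pR_add2 (a := v) (b := u2) (by simp [hx2, d5.symm, d2.symm]) (by simp) (by simp [hu2])
        d4 C.vx2.symm C.xu2
    refine C.Pkill h (R := insert x2 (insert v (insert x1 R0))) ?_ (by simp) ?_ (by omega)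
    · refine le_trans h6 (Finset.card_le_card ?_)
      intro t ht; simp [ht]
    · intro q hq h1 h2
      simp [hQ q hq, h1, h2, hq.ne']
  · have ex := exact1 (by omega) (by omega)
    have E : ES G v x1 x2 u1 u2 a1 b1 a2 b2 L (fun t => e (π t)) P :=
      { hL := hL
        lift := by
          intro i j hij
          obtain ⟨c, hc, d, hd, hcd, h1, h2⟩ := r.lift (e.symm i) (e.symm j) (by
            rw [hadj]; simpa using hij)
          exact ⟨c, hc, d, hd, hcd, by simp [h1], by simp [h2]⟩
        ex1 := fun c hc d hd hcd => (hadj _ _).1 (ex c hc d hd hcd).1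
        ex2 := fun c hc d hd hcd c' hc' d' hd' hcd' h1 h2 =>
          (ex c hc d hd hcd).2 c' hc' d' hd' hcd' (e.injective h1) (e.injective h2)
        out := out
        hQ := r.hQ
        e1 := congrArg e r.e1
        e2 := congrArg e r.e2
        ma1 := r.ma1
        mb1 := r.mb1
        ma2 := r.ma2
        mb2 := r.mb2
        pP := by omega
        card := by have := r.card; omega }
    rcases r.kind with ⟨k1, k2, k3⟩ | ⟨k1, k2⟩
    · have EE : EU G v x1 x2 u1 u2 a1 b1 a2 b2 L (fun t => e (π t)) P :=
        { toES := E
          ne := k1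
          fib := by
            intro c hc d hd hcd
            have := r.fib c hc d hd (e.injective hcd)
            have k := k1
            clear * - this k
            grind
          ua1 := k2
          ub1 := r.ub1
          ua2 := k3
          ub2 := r.ub2 }
      exact EE.done C h
    · exact E.merged C h k1 k2 r.ub1 r.ub2
  · have ex := exact1 (by omega) (by omega)
    have exn : ∀ c ∈ P, ∀ d ∈ P, G.Adj c d → π c ≠ π d := fun c hc d hd hcd => (ex c hc d hd hcd).1.ne
    have exu : ∀ c ∈ P, ∀ d ∈ P, G.Adj c d → ∀ c' ∈ P, ∀ d' ∈ P, G.Adj c' d' → π c' = π c →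
      π d' = π d → c' = c ∧ d' = d := fun c hc d hd hcd => (ex c hc d hd hcd).2
    have fib := r.fib
    have ma1 := r.ma1
    have mb1 := r.mb1
    have ma2 := r.ma2
    have mb2 := r.mb2
    have e1 := r.e1
    have e2 := r.e2
    have ab1 := C.ab1
    have ab2 := C.ab2
    rcases r.kind with ⟨⟨k1, k2, k3, k4⟩, ua1, ua2⟩ | ⟨k1, k2⟩
    · have hz : π a1 ≠ π a2 := by
        intro hz; have := fib a1 ma1 a2 ma2 hz; clear r ex exn exu fib; grind
      obtain ⟨k, hk1, hk2, hk3⟩ : ∃ k : Fin 3, k ≠ π a1 ∧ k ≠ π a2 ∧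
          ∀ j, j = π a1 ∨ j = π a2 ∨ j = k := by
        generalize π a1 = z1 at *; generalize π a2 = z2 at *
        clear * - hz
        revert z1 z2; decide
      have fz1 : ∀ s ∈ P, π s = π a1 → s = a1 ∨ s = b1 := by
        intro s hs h1; have := fib s hs a1 ma1 h1; clear r ex exn exu fib; grind
      have fz2 : ∀ s ∈ P, π s = π a2 → s = a2 ∨ s = b2 := by
        intro s hs h1; have := fib s hs a2 ma2 h1; clear r ex exn exu fib; grind
      obtain ⟨p, hp, w, hw, hpw, hp1, hw1⟩ := r.lift (π a1) k hk1.symm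
      obtain ⟨q, hq, w', hw', hqw, hq1, hw2⟩ := r.lift (π a2) k hk2.symm
      obtain ⟨s, hs, t, ht, hst, hs1, ht1⟩ := r.lift (π a1) (π a2) hz
      have wne : w ≠ a1 ∧ w ≠ b1 ∧ w ≠ a2 ∧ w ≠ b2 := by
        refine ⟨?_, ?_, ?_, ?_⟩ <;> rintro rfl
        · exact hk1 hw1.symm
        · exact hk1 (hw1.symm.trans e1.symm)
        · exact hk2 hw1.symm
        · exact hk2 (hw1.symm.trans e2.symm)
      have hww : w' = w := by
        have := fib w hw w' hw' (hw1.trans hw2.symm); clear r ex exn exu fib; grind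
      subst hww
      have wn := out w' hw
      have nvw : ¬ G.Adj v w' := fun hh => r.hQ _ hh hw
      -- all edges inside `P`
      have edges : ∀ c ∈ P, ∀ d ∈ P, G.Adj c d → (c = p ∧ d = w') ∨ (c = w' ∧ d = p) ∨
          (c = q ∧ d = w') ∨ (c = w' ∧ d = q) ∨ (c = s ∧ d = t) ∨ (c = t ∧ d = s) := by
        intro c hc d hd hcd
        have hne := exn c hc d hd hcd
        rcases hk3 (π c) with i1 | i1 | i1 <;> rcases hk3 (π d) with i2 | i2 | i2
        · exact absurd (i1.trans i2.symm) hne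
        · have := exu s hs t ht hst c hc d hd hcd (i1.trans hs1.symm) (i2.trans ht1.symm); clear * - this; tauto
        · have := exu p hp w' hw hpw c hc d hd hcd (i1.trans hp1.symm) (i2.trans hw1.symm); clear * - this; tauto
        · have := exu s hs t ht hst d hd c hc hcd.symm (i2.trans hs1.symm) (i1.trans ht1.symm); clear * - this; tauto
        · exact absurd (i1.trans i2.symm) hne
        · have := exu q hq w' hw hqw c hc d hd hcd (i1.trans hq1.symm) (i2.trans hw1.symm); clear * - this; tauto
        · have := exu p hp w' hw hpw d hd c hc hcd.symm (i2.trans hp1.symm) (i1.trans hw1.symm); clear * - this; tauto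
        · have := exu q hq w' hw hqw d hd c hc hcd.symm (i2.trans hq1.symm) (i1.trans hw1.symm); clear * - this; tauto
        · exact absurd (i1.trans i2.symm) hne
      have cp := fz1 p hp hp1
      have cs := fz1 s hs hs1
      have cq := fz2 q hq hq1
      have ct := fz2 t ht ht1
      have wne0 := wne
      obtain ⟨w1, w2, w3, w4⟩ := wne0
      have j1 : ∀ c ∈ P, (c = a1 ∨ c = b1) → (∃ d ∈ P, G.Adj c d) → c = p ∨ c = s := by
        rintro c hc h1 ⟨d, hd, hcd⟩
        rcases edges c hc d hd hcd with ⟨h2, -⟩ | ⟨h2, -⟩ | ⟨h2, -⟩ | ⟨h2, -⟩ | ⟨h2, -⟩ | ⟨h2, -⟩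
        · exact Or.inl h2
        · clear * - h1 h2 w1 w2; grind
        · clear * - h1 h2 cq k1 k2 k3 k4; grind
        · clear * - h1 h2 w1 w2; grind
        · exact Or.inr h2
        · clear * - h1 h2 ct k1 k2 k3 k4; grind
      have j2 : ∀ c ∈ P, (c = a2 ∨ c = b2) → (∃ d ∈ P, G.Adj c d) → c = q ∨ c = t := by
        rintro c hc h1 ⟨d, hd, hcd⟩
        rcases edges c hc d hd hcd with ⟨h2, -⟩ | ⟨h2, -⟩ | ⟨h2, -⟩ | ⟨h2, -⟩ | ⟨h2, -⟩ | ⟨h2, -⟩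
        · clear * - h1 h2 cp k1 k2 k3 k4; grind
        · clear * - h1 h2 w3 w4; grind
        · exact Or.inl h2
        · clear * - h1 h2 w3 w4; grind
        · clear * - h1 h2 cs k1 k2 k3 k4; grind
        · exact Or.inr h2
      have ps : p ≠ s := by
        intro hh
        have i1 := j1 a1 ma1 (Or.inl rfl) ua1
        have i2 := j1 b1 mb1 (Or.inr rfl) r.ub1
        clear * - hh i1 i2 ab1
        grind
      have qt : q ≠ t := by
        intro hh
        have i1 := j2 a2 ma2 (Or.inl rfl) ua2
        have i2 := j2 b2 mb2 (Or.inr rfl) r.ub2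
        clear * - hh i1 i2 ab2
        grind
      have fin : ∀ a1 b1 a2 b2, Conf G v x1 x2 u1 u2 a1 b1 a2 b2 → s = a1 → p = b1 → t = a2 → q = b2 →
          a1 ∈ P → b1 ∈ P → a2 ∈ P → b2 ∈ P →
          (a1 ≠ a2 ∧ a1 ≠ b2 ∧ b1 ≠ a2 ∧ b1 ≠ b2) →
          (w' ≠ a1 ∧ w' ≠ b1 ∧ w' ≠ a2 ∧ w' ≠ b2) → False := by
        rintro _ _ _ _ C rfl rfl rfl rfl g1 g2 g3 g4 ⟨f1, f2, f3, f4⟩ ⟨f5, f6, f7, f8⟩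
        refine H s p t q w' C ⟨hst, hpw, hqw, ⟨f1, f2, f3, f4⟩, wn, ⟨f5, f6, f7, f8⟩, nvw, ?_, ?_, ?_, ?_, ?_⟩
        · intro hh; have := edges _ g1 _ g4 hh; clear * - this f1 f2 f3 f4 f5 f6 f7 f8 ps qt; grind
        · intro hh; have := edges _ g2 _ g3 hh; clear * - this f1 f2 f3 f4 f5 f6 f7 f8 ps qt; grind
        · intro hh; have := edges _ g2 _ g4 hh; clear * - this f1 f2 f3 f4 f5 f6 f7 f8 ps qt; grind
        · intro hh; have := edges _ g1 _ hw hh; clear * - this f1 f2 f3 f4 f5 f6 f7 f8 ps qt; grind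
        · intro hh; have := edges _ g3 _ hw hh; clear * - this f1 f2 f3 f4 f5 f6 f7 f8 ps qt; grind
      rcases cp with rfl | rfl <;> rcases cq with rfl | rfl
      · exact fin _ _ _ _ C.sw1.sw2 (cs.resolve_left ps.symm) rfl (ct.resolve_left qt.symm) rfl
          mb1 ma1 mb2 ma2 (by clear * - k1 k2 k3 k4; tauto) (by clear * - w1 w2 w3 w4; tauto)
      · exact fin _ _ _ _ C.sw1 (cs.resolve_left ps.symm) rfl (ct.resolve_right qt.symm) rfl
          mb1 ma1 ma2 mb2 (by clear * - k1 k2 k3 k4; tauto) (by clear * - w1 w2 w3 w4; tauto)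
      · exact fin _ _ _ _ C.sw2 (cs.resolve_right ps.symm) rfl (ct.resolve_left qt.symm) rfl
          ma1 mb1 mb2 ma2 (by clear * - k1 k2 k3 k4; tauto) (by clear * - w1 w2 w3 w4; tauto)
      · exact fin _ _ _ _ C (cs.resolve_right ps.symm) rfl (ct.resolve_right qt.symm) rfl
          ma1 mb1 ma2 mb2 (by clear * - k1 k2 k3 k4; tauto) (by clear * - w1 w2 w3 w4; tauto)
    · subst k1
      have hb : π b1 = π b2 := e1.symm.trans e2
      have fz : ∀ s ∈ P, π s = π a1 → s = a1 ∨ s = b1 ∨ s = b2 := by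
        intro s hs h1; have := fib s hs a1 ma1 h1; clear r ex exn exu fib; grind
      obtain ⟨w, hw, hbw⟩ := r.ub1
      obtain ⟨w', hw', hbw'⟩ := r.ub2
      have i1 := exn _ mb1 _ hw hbw
      have i2 := exn _ mb2 _ hw' hbw'
      have i3 : π w ≠ π w' := by
        intro hh
        exact k2 (exu _ mb2 _ hw' hbw' _ mb1 _ hw hbw hb hh).1
      have i4 : ∀ j, j = π b1 ∨ j = π w ∨ j = π w' := by
        rw [← hb] at i2
        generalize π b1 = z1 at *; generalize π w = z2 at *; generalize π w' = z3 at *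
        clear * - i1 i2 i3
        revert z1 z2 z3; decide
      have wne : w ≠ a1 ∧ w ≠ b1 ∧ w ≠ b2 := by
        refine ⟨?_, ?_, ?_⟩ <;> rintro rfl
        · exact i1 e1.symm
        · exact i1 rfl
        · exact i1 hb
      have wne' : w' ≠ a1 ∧ w' ≠ b1 ∧ w' ≠ b2 := by
        refine ⟨?_, ?_, ?_⟩ <;> rintro rfl
        · exact i2 e2.symm
        · exact i2 hb.symm
        · exact i2 rfl
      have fw : ∀ s ∈ P, π s = π w → s = w := by
        intro s hs h1; have := fib s hs w hw h1; clear r ex exn exu fib; grind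
      have fw' : ∀ s ∈ P, π s = π w' → s = w' := by
        intro s hs h1; have := fib s hs w' hw' h1; clear r ex exn exu fib; grind
      let φ : V → Fin 5 := fun t => if t = u1 ∨ t = u2 then 0 else if t = w then 3 else
        if t = w' then 2 else if t = b1 then 4 else 1
      have ow := out w hw
      have ow' := out w' hw'
      have oa := out a1 ma1
      have ob := out b1 mb1
      have ob2 := out b2 mb2
      have wz : w ≠ w' := fun hh => i3 (by rw [hh])
      have v1 : φ u1 = 0 := by simp [φ]
      have v2 : φ u2 = 0 := by simp [φ]
      have v3 : φ w = 3 := by simp [φ, ow]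
      have v4 : φ w' = 2 := by simp [φ, ow', wz.symm]
      have v5 : φ b1 = 4 := by simp [φ, ob, wne.2.1.symm, wne'.2.1.symm]
      have v6 : φ b2 = 1 := by simp [φ, ob2, wne.2.2.symm, wne'.2.2.symm, k2.symm]
      have v7 : φ a1 = 1 := by simp [φ, oa, wne.1.symm, wne'.1.symm, ab1]
      have outR : ∀ t ∈ R0, t ≠ x1 ∧ t ≠ x2 := by
        intro t ht
        exact ⟨by rintro rfl; exact hx1 ht, by rintro rfl; exact hx2 ht⟩
      have g1 : ∀ d ∈ R0, G.Adj u1 d → adj5 (φ u1) (φ d) := by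
        intro d hd h1
        rcases (C.nu1 d).1 h1 with rfl | rfl | rfl
        · exact absurd rfl (outR _ hd).1
        · rw [v1, v7]; decide
        · rw [v1, v5]; decide
      have g2 : ∀ d ∈ R0, G.Adj u2 d → adj5 (φ u2) (φ d) := by
        intro d hd h1
        rcases (C.nu2 d).1 h1 with rfl | rfl | rfl
        · exact absurd rfl (outR _ hd).2
        · rw [v2, v7]; decide
        · rw [v2, v6]; decide
      have g3 : ∀ c ∈ P, ∀ d ∈ P, G.Adj c d → (π c = π b1 ∨ (π c = π w ∧ π d = π w')) →
          adj5 (φ c) (φ d) := by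
        rintro c hc d hd hcd (j1 | ⟨j1, j2⟩)
        · rcases i4 (π d) with j2 | j2 | j2
          · exact absurd (j1.trans j2.symm) (exn c hc d hd hcd)
          · obtain ⟨rfl, rfl⟩ := exu _ mb1 _ hw hbw c hc d hd hcd j1 j2
            rw [v5, v3]; decide
          · obtain ⟨rfl, rfl⟩ := exu _ mb2 _ hw' hbw' c hc d hd hcd (j1.trans hb) j2
            rw [v6, v4]; decide
        · rw [fw c hc j1, fw' d hd j2, v3, v4]; decide
      refine C.star h h6 hu1 hu2 hv hQ (by omega) (φ := φ) ?_ (v1.trans v2.symm)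
      intro c d hc hd hcd
      rcases Finset.mem_insert.1 hc with rfl | hc'
      · exact g1 d hd hcd
      rcases Finset.mem_insert.1 hd with rfl | hd'
      · exact adj5_symm (g1 c hc hcd.symm)
      rcases Finset.mem_insert.1 hc' with rfl | hc''
      · exact g2 d hd hcd
      rcases Finset.mem_insert.1 hd' with rfl | hd''
      · exact adj5_symm (g2 c hc hcd.symm)
      have hne := exn c hc'' d hd'' hcd
      rcases i4 (π c) with j1 | j1 | j1
      · exact g3 c hc'' d hd'' hcd (Or.inl j1)
      · rcases i4 (π d) with j2 | j2 | j2
        · exact adj5_symm (g3 d hd'' c hc'' hcd.symm (Or.inl j2))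
        · exact absurd (j1.trans j2.symm) hne
        · exact g3 c hc'' d hd'' hcd (Or.inr ⟨j1, j2⟩)
      · rcases i4 (π d) with j2 | j2 | j2
        · exact adj5_symm (g3 d hd'' c hc'' hcd.symm (Or.inl j2))
        · exact adj5_symm (g3 d hd'' c hc'' hcd.symm (Or.inr ⟨j2, j1⟩))
        · exact absurd (j1.trans j2.symm) hne

end finish

section seven
variable {V : Type} {G : SimpleGraph V} {v x1 x2 u1 u2 a1 b1 a2 b2 w : V}
variable [DecidableEq V] [Fintype V]

/-- an edge between `S` and `R1` that is not seen by `K` costs four -/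
theorem GlueOut.tight {G' : SimpleGraph V} {R1 : Finset V} {φ : V → Fin 5} (o : GlueOut G' R1 φ)
    (hle : G' ≤ G) {a r : V} (ha : a ∈ o.S) (hr : r ∈ R1) (har : G.Adj a r)
    (hn : ¬ G'.Adj a r ∨ ¬ ∃ k k', o.K.Adj k k' ∧ o.f k = Sum.inl a ∧ o.f k' = Sum.inr (φ r)) :
    pR G (R1 ∪ o.S) + 4 ≤ pR G R1 + pot o.K - pR o.K o.X := by
  have haR : a ∉ R1 := fun h => Finset.disjoint_left.1 o.disj h ha
  have hc := o.count hle {(a, r), (r, a)} (by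
    intro p hp
    simp only [Finset.mem_insert, Finset.mem_singleton] at hp
    rcases hp with rfl | rfl
    · refine ⟨mem_darts.2 ⟨by simp [ha], by simp [hr], har⟩, fun h => haR (mem_darts.1 h).1, ?_⟩
      rcases hn with hn | hn
      · exact Or.inl hn
      · right
        intro k k' h1 h2 h3
        simp only [haR, hr, if_true, if_false] at h2 h3
        exact hn ⟨k, k', h1, h2.symm, h3.symm⟩
    · refine ⟨mem_darts.2 ⟨by simp [hr], by simp [ha], har.symm⟩, fun h => haR (mem_darts.1 h).2.1, ?_⟩
      rcases hn with hn | hn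
      · exact Or.inl (fun h => hn h.symm)
      · right
        intro k k' h1 h2 h3
        simp only [haR, hr, if_true, if_false] at h2 h3
        exact hn ⟨k', k, h1.symm, h3.symm, h2.symm⟩)
  rw [Finset.card_pair (by simp [har.ne])] at hc
  push_cast at hc
  omega

/-- the two middle vertices `a1`, `a2` cannot both have degree two -/
theorem T7.deg2 (T : T7 G v x1 x2 u1 u2 a1 b1 a2 b2 w) (C : Conf G v x1 x2 u1 u2 a1 b1 a2 b2)
    (h : SmallestCex G) (dg1 : ∀ t, G.Adj a1 t → t = u1 ∨ t = a2)
    (dg2 : ∀ t, G.Adj a2 t → t = a1 ∨ t = u2) : False := by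
  obtain ⟨d1, d2, d3, d4, d5, d6, d7, d8, d9, d10⟩ := C.dist5
  obtain ⟨wv, wx1, wx2, wu1, wu2⟩ := T.wn
  obtain ⟨wa1, wb1, wa2, wb2⟩ := T.wne
  obtain ⟨n1, n2, n3, n4⟩ := T.ne
  obtain ⟨p1, p2, p3, p4, p5⟩ := C.a1n
  obtain ⟨q1, q2, q3, q4, q5⟩ := C.b1n
  obtain ⟨r1, r2, r3, r4, r5⟩ := C.a2n
  obtain ⟨t1, t2, t3, t4, t5⟩ := C.b2n
  have ab1 := C.ab1
  have ab2 := C.ab2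
  let G' := cut G (fun c _ => c = u2 ∨ c = a1 ∨ c = a2 ∨ c = x2)
  have hle : G' ≤ G := cut_le
  let R1 : Finset V := {b2, w, b1, u1}
  let φ : V → Fin 5 := fun t => if t = b1 then 4 else if t = b2 then 1 else 0
  have f1 : φ u1 = 0 := by simp [φ, q4.symm, t4.symm]
  have f2 : φ b1 = 4 := by simp [φ]
  have f3 : φ w = 0 := by simp [φ, wb1, wb2]
  have f4 : φ b2 = 1 := by simp [φ, n4.symm]
  have hR1 : ∀ t, t ∈ R1 ↔ t = b2 ∨ t = w ∨ t = b1 ∨ t = u1 := by intro t; simp [R1]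
  have pot1 : pR G R1 ≤ 8 := by
    have e0 := pR_add0 (G := G) (R := ∅) (x := u1) (by simp)
    have e1 := pR_add1 (R := insert u1 ∅) (x := b1) (by simp [q4]) (a := u1) (by simp) C.ub1.symm
    have e2 := pR_add1 (R := insert b1 (insert u1 ∅)) (x := w) (by simp [wb1, wu1]) (a := b1) (by simp)
      T.bw1.symm
    have e3 := pR_add1 (R := insert w (insert b1 (insert u1 ∅))) (x := b2)
      (by simp [wb2.symm, n4.symm, t4]) (a := w) (by simp) T.bw2
    have e : pR G (∅ : Finset V) ≤ 0 := by simp [pR]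
    have : R1 = insert b2 (insert w (insert b1 (insert u1 ∅))) := rfl
    rw [this]
    omega
  have ubb : ¬ G.Adj u1 b2 := by
    intro hh
    rcases (C.nu1 _).1 hh with h | h | h
    · exact t2 h
    · exact n2 h.symm
    · exact n4 h.symm
  have uw : ¬ G.Adj u1 w := by
    intro hh
    rcases (C.nu1 _).1 hh with h | h | h
    · exact wx1 h
    · exact wa1 h
    · exact wb1 h
  have half : ∀ a b, (a = u1 ∧ b = b1) ∨ (a = w ∧ b = b1) ∨ (a = w ∧ b = b2) →
      adj5 (φ a) (φ b) := by
    rintro a b (⟨rfl, rfl⟩ | ⟨rfl, rfl⟩ | ⟨rfl, rfl⟩)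
    · rw [f1, f2]; decide
    · rw [f3, f2]; decide
    · rw [f3, f4]; decide
  obtain ⟨o⟩ := exists_glue G' R1 φ (by
    intro a b ha hb hab
    have hab := hab.1
    rcases (hR1 a).1 ha with rfl | rfl | rfl | rfl <;> rcases (hR1 b).1 hb with rfl | rfl | rfl | rfl
    · exact absurd hab G.irrefl
    · exact adj5_symm (half _ _ (by simp))
    · exact absurd hab.symm T.n3
    · exact absurd hab.symm ubb
    · exact half _ _ (by simp)
    · exact absurd hab G.irrefl
    · exact half _ _ (by simp)
    · exact absurd hab.symm uw
    · exact absurd hab T.n3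
    · exact adj5_symm (half _ _ (by simp))
    · exact absurd hab G.irrefl
    · exact adj5_symm (half _ _ (by simp))
    · exact absurd hab ubb
    · exact absurd hab uw
    · exact half _ _ (by simp)
    · exact absurd hab G.irrefl) (by
    intro g hg hgφ
    have gu1 : g u1 = 0 := by rw [hgφ u1 (by simp [R1]), f1]
    have gb1 : g b1 = 4 := by rw [hgφ b1 (by simp [R1]), f2]
    have gb2 : g b2 = 1 := by rw [hgφ b2 (by simp [R1]), f4]
    have hvx : adj5 (g v) (g x1) := hg v x1 ⟨C.vx1, by simp [d4, d2, p1.symm, r1.symm],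
      by simp [d7, d5, p2.symm, r2.symm]⟩
    have hxu : adj5 (g x1) 0 := gu1 ▸ hg x1 u1 ⟨C.xu1, by simp [d7, d5, p2.symm, r2.symm],
      by simp [C.uu, d8.symm, p4.symm, r4.symm]⟩
    have key : ∀ y m : Fin 5, adj5 y m → adj5 m 0 → ∃ c1 c2 μ ν α β : Fin 5, adj5 c1 4 ∧ adj5 c2 1 ∧
        adj5 μ y ∧ adj5 μ c1 ∧ adj5 ν y ∧ adj5 ν c2 ∧ adj5 α c1 ∧ adj5 β c2 ∧ adj5 β α := by
      have k2 : ∀ y m : Fin 5, adj5 y m → adj5 m 0 → ∃ c1 c2 : Fin 5, adj5 c1 4 ∧ adj5 c2 1 ∧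
        ¬ adj5 y c1 ∧ ¬ adj5 y c2 ∧ c1 ≠ c2 := by decide
      intro y m e1 e2
      obtain ⟨c1, c2, h1, h2, h3, h4, h5⟩ := k2 y m e1 e2
      obtain ⟨μ, i1, i2⟩ := mid5 y c1 h3
      obtain ⟨ν, i3, i4⟩ := mid5 y c2 h4
      have k3 : ∀ c d : Fin 5, c ≠ d → ∃ α β : Fin 5, adj5 α c ∧ adj5 β d ∧ adj5 β α := by decide
      obtain ⟨α, β, i5, i6, i7⟩ := k3 c1 c2 h5
      exact ⟨c1, c2, μ, ν, α, β, h1, h2, i1, i2, i3, i4, i5, i6, i7⟩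
    obtain ⟨c1, c2, μ, ν, α, β, k1, k2, k3, k4, k5, k6, k7, k8, k9⟩ := key _ _ hvx hxu
    have hp : PCol G [u1, u2, x1, x2, a1, a2] g := by
      intro c d hcd hc hd
      simp only [List.mem_cons, not_or] at hc hd
      exact hg c d ⟨hcd, by tauto, by tauto⟩
    have s1 := hp.ext c1 (by
      intro t ht hW
      rcases (C.nu1 t).1 ht with rfl | rfl | rfl
      · exact absurd (by simp) hW
      · exact absurd (by simp) hW
      · rw [gb1]; exact k1)
    set g1 := Function.update g u1 c1 with hg1
    have e1 : g1 u1 = c1 := Function.update_self _ _ _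
    have e1b : g1 b2 = 1 := by rw [hg1, Function.update_of_ne t4, gb2]
    have e1v : g1 v = g v := by rw [hg1, Function.update_of_ne d3]
    have s2 := s1.ext c2 (by
      intro t ht hW
      rcases (C.nu2 t).1 ht with rfl | rfl | rfl
      · exact absurd (by simp) hW
      · exact absurd (by simp) hW
      · rw [e1b]; exact k2)
    set g2 := Function.update g1 u2 c2 with hg2
    have e2 : g2 u2 = c2 := Function.update_self _ _ _
    have e2u : g2 u1 = c1 := by rw [hg2, Function.update_of_ne C.uu, e1]
    have e2v : g2 v = g v := by rw [hg2, Function.update_of_ne d4, e1v]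
    have s3 := s2.ext μ (by
      intro t ht _
      rcases (C.nx1 t).1 ht with rfl | rfl
      · rw [e2v]; exact k3
      · rw [e2u]; exact k4)
    set g3 := Function.update g2 x1 μ with hg3
    have e3 : g3 u2 = c2 := by rw [hg3, Function.update_of_ne d7.symm, e2]
    have e3u : g3 u1 = c1 := by rw [hg3, Function.update_of_ne d6.symm, e2u]
    have e3v : g3 v = g v := by rw [hg3, Function.update_of_ne d1, e2v]
    have s4 := s3.ext ν (by
      intro t ht _
      rcases (C.nx2 t).1 ht with rfl | rfl
      · rw [e3v]; exact k5
      · rw [e3]; exact k6)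
    set g4 := Function.update g3 x2 ν with hg4
    have e4 : g4 u2 = c2 := by rw [hg4, Function.update_of_ne d9.symm, e3]
    have e4u : g4 u1 = c1 := by rw [hg4, Function.update_of_ne d8.symm, e3u]
    have s5 := s4.ext α (by
      intro t ht hW
      rcases dg1 t ht with rfl | rfl
      · rw [e4u]; exact k7
      · exact absurd (by simp) hW)
    set g5 := Function.update g4 a1 α with hg5
    have e5 : g5 u2 = c2 := by rw [hg5, Function.update_of_ne p5.symm, e4]
    have e5a : g5 a1 = α := Function.update_self _ _ _
    refine (s5.ext β ?_).done h.crit.no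
    intro t ht _
    rcases dg2 t ht with rfl | rfl
    · rw [e5a]; exact k9
    · rw [e5]; exact k8)
  have hR : ∀ q, G.Adj v q → q ∉ R1 := by
    intro q hq hr
    rcases (hR1 q).1 hr with rfl | rfl | rfl | rfl
    · exact C.nvb2 h.crit hq
    · exact T.nvw hq
    · exact C.nvb1 h.crit hq
    · exact C.nvu1 hq
  have hvR : v ∉ R1 := by rw [hR1]; rintro (h | h | h | h) <;> simp_all
  have hXn := o.X_nonempty h.crit hle ⟨u1, by simp [R1]⟩
  have nR : u2 ∉ R1 ∧ a1 ∉ R1 ∧ a2 ∉ R1 ∧ x2 ∉ R1 ∧ x1 ∉ R1 := by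
    simp only [hR1, not_or]
    exact ⟨⟨t5.symm, wu2.symm, q5.symm, C.uu.symm⟩, ⟨n2, wa1.symm, ab1, p4⟩,
      ⟨ab2, wa2.symm, n3.symm, r4⟩, ⟨t3.symm, wx2.symm, q3.symm, d8⟩, ⟨t2.symm, wx1.symm, q2.symm, d6⟩⟩
  obtain ⟨nR1, nR2, nR3, nR4, nR5⟩ := nR
  have cR : R1.card = 4 := by
    simp only [R1]
    rw [Finset.card_insert_of_notMem (by simp [wb2.symm, n4.symm, t4]),
      Finset.card_insert_of_notMem (by simp [wb1, wu1]), Finset.card_pair q4]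
  have hm := o.m_lt (insert a1 (insert u2 R1)) (by
      rw [Finset.card_insert_of_notMem (by simp [nR2, p5]), Finset.card_insert_of_notMem nR1, cR]) (by
      intro a ha
      simp only [Finset.mem_insert] at ha
      rcases ha with rfl | rfl | ha
      · exact Or.inr (fun b hb => hb.2.1 (by simp))
      · exact Or.inr (fun b hb => hb.2.1 (by simp))
      · exact Or.inl ha)
  have hc := o.count0 hle
  obtain ⟨hx5, -⟩ := o.pX hXn
  have S1 : u2 ∉ o.S := GlueOut.not_S' (fun t ht => ht.2.1 (by simp))
  have S2 : a1 ∉ o.S := GlueOut.not_S' (fun t ht => ht.2.1 (by simp))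
  have S3 : a2 ∉ o.S := GlueOut.not_S' (fun t ht => ht.2.1 (by simp))
  have S4 : x2 ∉ o.S := GlueOut.not_S' (fun t ht => ht.2.1 (by simp))
  set R := R1 ∪ o.S with hRdef
  have m1 : u1 ∈ R := by simp [hRdef, R1]
  have m2 : b2 ∈ R := by simp [hRdef, R1]
  have k1 : u2 ∉ R := by simp [hRdef, nR1, S1]
  have k2 : a1 ∉ R := by simp [hRdef, nR2, S2]
  have k3 : a2 ∉ R := by simp [hRdef, nR3, S3]
  have k4 : x2 ∉ R := by simp [hRdef, nR4, S4]
  have cc : 4 ≤ R.card := cR ▸ Finset.card_le_card Finset.subset_union_left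
  have s1 : pR G (insert u2 R) ≤ pR G R + 1 := pR_add1 (a := b2) k1 m2 C.ub2
  have s2 : pR G (insert a1 (insert u2 R)) ≤ pR G (insert u2 R) + 1 :=
    pR_add1 (a := u1) (by simp [k2, p5]) (by simp [m1]) C.ua1.symm
  have s3 : pR G (insert a2 (insert a1 (insert u2 R))) ≤ pR G (insert a1 (insert u2 R)) - 3 :=
    pR_add2 (a := a1) (b := u2) (by simp [k3, r5, n1.symm]) (by simp) (by simp) p5 T.aa.symm C.ua2.symm
  have ccc : 6 ≤ (insert a2 (insert a1 (insert u2 R))).card := by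
    rw [Finset.card_insert_of_notMem (by simp [k3, r5, n1.symm]),
      Finset.card_insert_of_notMem (by simp [k2, p5]), Finset.card_insert_of_notMem k1]
    omega
  set R2 := insert a2 (insert a1 (insert u2 R)) with hR2
  have mu1 : u1 ∈ R2 := by simp [hR2, m1]
  have mu2 : u2 ∈ R2 := by simp [hR2]
  have mx2 : x2 ∉ R2 := by simp [hR2, k4, d9, p3.symm, r3.symm]
  by_cases hvS : v ∈ o.S
  · have hK : pot o.K ≤ 2 := by
      rcases h.cls3 o.crit hm with ⟨c1, -⟩ | ⟨-, c2, -⟩ | c3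
      · omega
      · omega
      · exfalso
        obtain ⟨k, hk⟩ := GlueOut.mem_S.1 hvS
        obtain ⟨k0, hk0⟩ := hXn
        obtain ⟨y, hy⟩ := GlueOut.mem_X.1 hk0
        obtain ⟨r, hr, -, hvr⟩ := o.hLR k k0 v y ((o.tri_card c3).2 k k0 (by
          rintro rfl; rw [hk] at hy; cases hy)) hk hy
        exact hR r hvr.1 hr
    have mv : v ∈ R2 := by simp [hR2, hRdef, hvS]
    have s4 : pR G (insert x1 R2) ≤ pR G R2 :=
      pR_add2' (a := v) (b := u1) mv mu1 d3 C.vx1.symm C.xu1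
    have s5 : pR G (insert x2 (insert x1 R2)) ≤ pR G (insert x1 R2) - 3 :=
      pR_add2 (a := v) (b := u2) (by simp [mx2, d5.symm]) (by simp [mv]) (by simp [mu2])
        d4 C.vx2.symm C.xu2
    have := h.P2 (R := insert x2 (insert x1 R2)) (by
      refine le_trans ccc (Finset.card_le_card ?_)
      intro t ht; simp [ht])
    omega
  · have hQS : ∀ q, G.Adj v q → q ∉ o.S := by
      intro q hq
      obtain ⟨r, hr⟩ := C.Qdeg hq
      exact GlueOut.not_S (fun t ht => hr t ht.1) hvR hvS
    have hK : pot o.K ≤ 3 := by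
      rcases h.cls3 o.crit hm with ⟨c1, -⟩ | ⟨-, c2, -⟩ | c3
      · omega
      · omega
      · exact c3.2.2.le
    have hQ2 : ∀ q, G.Adj v q → q ∉ R2 := by
      intro q hq hr
      simp only [hR2, hRdef, Finset.mem_insert, Finset.mem_union] at hr
      rcases hr with rfl | rfl | rfl | hr | hr
      · exact C.nva2 h.crit hq
      · exact C.nva1 h.crit hq
      · exact C.nvu2 hq
      · exact hR q hq hr
      · exact hQS q hq hr
    have mv : v ∉ R2 := by simp [hR2, hRdef, hvS, hvR, d4, p1.symm, r1.symm]
    have mx1 := hQ2 _ C.vx1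
    have s4 : pR G (insert x1 R2) ≤ pR G R2 + 1 := pR_add1 (a := u1) mx1 mu1 C.xu1
    have s5 : pR G (insert v (insert x1 R2)) ≤ pR G (insert x1 R2) + 1 :=
      pR_add1 (a := x1) (by simp [mv, d1]) (by simp) C.vx1
    have s6 : pR G (insert x2 (insert v (insert x1 R2))) ≤ pR G (insert v (insert x1 R2)) - 3 :=
      pR_add2 (a := v) (b := u2) (by simp [mx2, d5.symm, d2.symm]) (by simp) (by simp [mu2])
        d4 C.vx2.symm C.xu2
    refine C.Pkill h (R := insert x2 (insert v (insert x1 R2))) ?_ (by simp) ?_ (by omega)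
    · refine le_trans ccc (Finset.card_le_card ?_)
      intro t ht; simp [ht]
    · intro q hq h1 h2
      simp [hQ2 q hq, h1, h2, hq.ne']

end seven

section seven2
variable {V : Type} {G : SimpleGraph V} {v x1 x2 u1 u2 a1 b1 a2 b2 w : V}
variable [DecidableEq V] [Fintype V]

set_option maxHeartbeats 2000000 in
theorem T7.done (T : T7 G v x1 x2 u1 u2 a1 b1 a2 b2 w) (C : Conf G v x1 x2 u1 u2 a1 b1 a2 b2)
    (h : SmallestCex G) : False := by
  obtain ⟨d1, d2, d3, d4, d5, d6, d7, d8, d9, d10⟩ := C.dist5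
  obtain ⟨wv, wx1, wx2, wu1, wu2⟩ := T.wn
  obtain ⟨wa1, wb1, wa2, wb2⟩ := T.wne
  obtain ⟨n1, n2, n3, n4⟩ := T.ne
  obtain ⟨p1, p2, p3, p4, p5⟩ := C.a1n
  obtain ⟨q1, q2, q3, q4, q5⟩ := C.b1n
  obtain ⟨r1, r2, r3, r4, r5⟩ := C.a2n
  obtain ⟨t1, t2, t3, t4, t5⟩ := C.b2n
  have ab1 := C.ab1
  have ab2 := C.ab2
  let G' := cut G (fun c d => c = x2 ∨ (c = w ∧ d = b2))
  have hle : G' ≤ G := cut_le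
  let R1 : Finset V := {x1, b2, b1, u2, a2, a1, u1}
  let φ : V → Fin 5 := fun t => if t = u1 then 0 else if t = a1 then 4 else if t = a2 then 3 else
    if t = u2 then 2 else 1
  have f1 : φ u1 = 0 := by simp [φ]
  have f2 : φ a1 = 4 := by simp [φ, p4]
  have f3 : φ a2 = 3 := by simp [φ, r4, n1.symm]
  have f4 : φ u2 = 2 := by simp [φ, C.uu.symm, p5.symm, r5.symm]
  have f5 : φ b1 = 1 := by simp [φ, q4, q5, ab1.symm, n3]
  have f6 : φ b2 = 1 := by simp [φ, t4, t5, ab2.symm, n2.symm]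
  have f7 : φ x1 = 1 := by simp [φ, d6, d7, p2.symm, r2.symm]
  have hR1 : ∀ t, t ∈ R1 ↔ t = x1 ∨ t = b2 ∨ t = b1 ∨ t = u2 ∨ t = a2 ∨ t = a1 ∨ t = u1 := by
    intro t; simp [R1]
  have e0 := pR_add0 (G := G) (R := ∅) (x := u1) (by simp)
  have e1 := pR_add1 (R := insert u1 ∅) (x := a1) (by simp [p4]) (a := u1) (by simp) C.ua1.symm
  have e2 := pR_add1 (R := insert a1 (insert u1 ∅)) (x := a2) (by simp [n1.symm, r4]) (a := a1)
    (by simp) T.aa.symm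
  have e3 := pR_add1 (R := insert a2 (insert a1 (insert u1 ∅))) (x := u2)
    (by simp [r5.symm, p5.symm, C.uu.symm]) (a := a2) (by simp) C.ua2
  have e4 := pR_add1 (R := insert u2 (insert a2 (insert a1 (insert u1 ∅)))) (x := b1)
    (by simp [q5, n3, ab1.symm, q4]) (a := u1) (by simp) C.ub1.symm
  have i5 : b2 ∉ insert b1 (insert u2 (insert a2 (insert a1 (insert u1 (∅ : Finset V))))) := by
    simp [n4.symm, t5, ab2.symm, n2.symm, t4]
  have e5 := pR_add1 i5 (a := u2) (by simp) C.ub2.symm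
  have i6 : x1 ∉ insert b2 (insert b1 (insert u2 (insert a2 (insert a1 (insert u1 (∅ : Finset V)))))) := by
    simp [t2.symm, q2.symm, d7, r2.symm, p2.symm, d6]
  have e6 := pR_add1 i6 (a := u1) (by simp) C.xu1
  have pot1 : pR G R1 ≤ 11 := by
    have e : pR G (∅ : Finset V) ≤ 0 := by simp [pR]
    have : R1 = insert x1 (insert b2 (insert b1 (insert u2 (insert a2 (insert a1 (insert u1 ∅)))))) := rfl
    rw [this]
    omega
  have c7 : R1.card = 7 := by
    have : R1 = insert x1 (insert b2 (insert b1 (insert u2 (insert a2 (insert a1 (insert u1 ∅)))))) := rfl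
    rw [this, Finset.card_insert_of_notMem i6, Finset.card_insert_of_notMem i5,
      Finset.card_insert_of_notMem (by simp [q5, n3, ab1.symm, q4]),
      Finset.card_insert_of_notMem (by simp [r5.symm, p5.symm, C.uu.symm]),
      Finset.card_insert_of_notMem (by simp [n1.symm, r4]),
      Finset.card_insert_of_notMem (by simp [p4])]
    simp
  -- neighbours inside `R1`
  have ru1 : ∀ t, G.Adj u1 t → adj5 (φ u1) (φ t) := by
    intro t ht
    rcases (C.nu1 t).1 ht with rfl | rfl | rfl
    · rw [f1, f7]; decide
    · rw [f1, f2]; decide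
    · rw [f1, f5]; decide
  have ru2 : ∀ t ∈ R1, G.Adj u2 t → adj5 (φ u2) (φ t) := by
    intro t hR ht
    rcases (C.nu2 t).1 ht with rfl | rfl | rfl
    · exfalso
      rcases (hR1 t).1 hR with h | h | h | h | h | h | h
      exacts [d5 h.symm, t3 h.symm, q3 h.symm, d9 h, r3 h.symm, p3 h.symm, d8 h]
    · rw [f4, f3]; decide
    · rw [f4, f6]; decide
  have rx1 : ∀ t ∈ R1, G.Adj x1 t → t = u1 := by
    intro t hR ht
    rcases (C.nx1 t).1 ht with rfl | rfl
    · exfalso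
      rcases (hR1 t).1 hR with h | h | h | h | h | h | h
      exacts [d1 h, t1 h.symm, q1 h.symm, d4 h, r1 h.symm, p1 h.symm, d3 h]
    · rfl
  have rb : ∀ b t, (b = b1 ∨ b = b2) → t ∈ R1 → G.Adj b t → t = u1 ∨ t = u2 := by
    rintro b t hb hR ht
    have hx : t ≠ x1 := by
      rintro rfl
      have := rx1 b (by rw [hR1]; rcases hb with h | h <;> simp [h]) ht.symm
      rcases hb with rfl | rfl
      · exact q4 this
      · exact t4 this
    rcases (hR1 t).1 hR with h | h | h | h | h | h | h
    · exact absurd h hx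
    · subst h; rcases hb with rfl | rfl
      · exact absurd ht T.n3
      · exact absurd ht G.irrefl
    · subst h; rcases hb with rfl | rfl
      · exact absurd ht G.irrefl
      · exact absurd ht.symm T.n3
    · exact Or.inr h
    · subst h; rcases hb with rfl | rfl
      · exact absurd ht T.n2
      · exact absurd ht.symm C.nab2
    · subst h; rcases hb with rfl | rfl
      · exact absurd ht.symm C.nab1
      · exact absurd ht.symm T.n1
    · exact Or.inl h
  have ra : ∀ t ∈ R1, G.Adj a1 t → t = u1 ∨ t = a2 := by
    intro t hR ht
    rcases (hR1 t).1 hR with rfl | rfl | rfl | rfl | rfl | rfl | rfl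
    · exact absurd (rx1 a1 (by simp [R1]) ht.symm) p4
    · exact absurd ht T.n1
    · exact absurd ht C.nab1
    · rcases (C.nu2 a1).1 ht.symm with h | h | h
      exacts [absurd h p3, absurd h n1, absurd h n2]
    · exact Or.inr rfl
    · exact absurd ht G.irrefl
    · exact Or.inl rfl
  have ra' : ∀ t ∈ R1, G.Adj a2 t → t = a1 ∨ t = u2 := by
    intro t hR ht
    rcases (hR1 t).1 hR with rfl | rfl | rfl | rfl | rfl | rfl | rfl
    · exact absurd (rx1 a2 (by simp [R1]) ht.symm) r4
    · exact absurd ht C.nab2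
    · exact absurd ht.symm T.n2
    · exact Or.inr rfl
    · exact absurd ht G.irrefl
    · exact Or.inl rfl
    · rcases (C.nu1 a2).1 ht.symm with h | h | h
      exacts [absurd h r2, absurd h n1.symm, absurd h n3.symm]
  obtain ⟨o⟩ := exists_glue G' R1 φ (by
    intro a b ha hb hab
    have hab9 : G.Adj a b := hab.1
    have main : ∀ a b, a ∈ R1 → b ∈ R1 → G.Adj a b → (a = u1 ∨ a = u2 ∨ b = u1 ∨ b = u2) →
        adj5 (φ a) (φ b) := by
      rintro a b ha hb hab (rfl | rfl | rfl | rfl)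
      · exact ru1 b hab
      · exact ru2 b hb hab
      · exact adj5_symm (ru1 a hab.symm)
      · exact adj5_symm (ru2 a ha hab.symm)
    rcases (hR1 a).1 ha with rfl | rfl | rfl | rfl | rfl | rfl | rfl
    · exact main _ _ ha hb hab9 (Or.inr (Or.inr (Or.inl (rx1 b hb hab9))))
    · exact main _ _ ha hb hab9 (Or.inr (Or.inr (rb _ b (Or.inr rfl) hb hab9)))
    · exact main _ _ ha hb hab9 (Or.inr (Or.inr (rb _ b (Or.inl rfl) hb hab9)))
    · exact main _ _ ha hb hab9 (by simp)
    · rcases ra' b hb hab9 with rfl | rfl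
      · rw [f2, f3]; decide
      · exact main _ _ ha hb hab9 (by simp)
    · rcases ra b hb hab9 with rfl | rfl
      · exact main _ _ ha hb hab9 (by simp)
      · rw [f2, f3]; decide
    · exact main _ _ ha hb hab9 (by simp)) (by
    intro g hg hgφ
    have hbw : g b2 = g b1 := by
      rw [hgφ b1 (by simp [R1]), hgφ b2 (by simp [R1]), f5, f6]
    have hwb : adj5 (g w) (g b2) := by
      rw [hbw]
      exact hg w b1 ⟨T.bw1.symm, by simp [wx2, n4], by simp [q3, wb1.symm]⟩
    have hp : PCol G [x2] g := by
      intro c d hcd hc hd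
      simp only [List.mem_singleton] at hc hd
      by_cases h1 : c = w ∧ d = b2
      · rw [h1.1, h1.2]; exact hwb
      by_cases h2 : d = w ∧ c = b2
      · rw [h2.1, h2.2]; exact adj5_symm hwb
      exact hg c d ⟨hcd, by clear * - hc h1; tauto, by clear * - hd h2; tauto⟩
    refine (hp.ext (g x1) ?_).done h.crit.no
    intro t ht _
    rcases (C.nx2 t).1 ht with rfl | rfl
    · exact hg x1 t ⟨C.vx1.symm, by simp [d5, wx1.symm], by simp [d2, wv.symm]⟩
    · rw [hgφ t (by simp [R1]), hgφ x1 (by simp [R1]), f7, f4]; decide)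
  have hR : ∀ q, G.Adj v q → q ∈ R1 → q = x1 := by
    intro q hq hr
    rcases (hR1 q).1 hr with rfl | rfl | rfl | rfl | rfl | rfl | rfl
    · rfl
    · exact absurd hq (C.nvb2 h.crit)
    · exact absurd hq (C.nvb1 h.crit)
    · exact absurd hq C.nvu2
    · exact absurd hq (C.nva2 h.crit)
    · exact absurd hq (C.nva1 h.crit)
    · exact absurd hq C.nvu1
  have hvR : v ∉ R1 := by
    rw [hR1]; rintro (h | h | h | h | h | h | h)
    exacts [d1 h, t1 h.symm, q1 h.symm, d4 h, r1 h.symm, p1 h.symm, d3 h]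
  have hwR : w ∉ R1 := by
    rw [hR1]; rintro (h | h | h | h | h | h | h)
    exacts [wx1 h, wb2 h, wb1 h, wu2 h, wa2 h, wa1 h, wu1 h]
  have hx2R : x2 ∉ R1 := by
    rw [hR1]; rintro (h | h | h | h | h | h | h)
    exacts [d5 h.symm, t3 h.symm, q3 h.symm, d9 h, r3 h.symm, p3 h.symm, d8 h]
  have hXn := o.X_nonempty h.crit hle ⟨u1, by simp [R1]⟩
  have hm := o.m_lt R1 (by omega) (fun a ha => Or.inl ha)
  have hc := o.count0 hle
  obtain ⟨hx5, hx5'⟩ := o.pX hXn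
  have hx2S : x2 ∉ o.S := GlueOut.not_S' (fun t ht => ht.2.1 (by simp))
  have hcw : w ∈ o.S → pR G (R1 ∪ o.S) + 4 ≤ pR G R1 + pot o.K - pR o.K o.X := fun hw =>
    o.tight hle hw (r := b2) (by simp [R1]) T.bw2.symm (Or.inl (fun hh => hh.2.1 (by simp)))
  have mR1 : ∀ t ∈ R1, t ∈ R1 ∪ o.S := fun t ht => by simp [ht]
  have mu1 : u1 ∈ R1 ∪ o.S := mR1 _ (by simp [R1])
  have mu2 : u2 ∈ R1 ∪ o.S := mR1 _ (by simp [R1])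
  have mx1 : x1 ∈ R1 ∪ o.S := mR1 _ (by simp [R1])
  have mb1 : b1 ∈ R1 ∪ o.S := mR1 _ (by simp [R1])
  have mb2 : b2 ∈ R1 ∪ o.S := mR1 _ (by simp [R1])
  have mx2 : x2 ∉ R1 ∪ o.S := by simp [hx2R, hx2S]
  have hcard : R1.card ≤ (R1 ∪ o.S).card := Finset.card_le_card Finset.subset_union_left
  have hK : pot o.K ≤ 3 := by
    rcases h.cls3 o.crit hm with ⟨c1, -⟩ | ⟨-, c2, -⟩ | c3
    · omega
    · omega
    · exact c3.2.2.le
  by_cases hvS : v ∈ o.S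
  · have mv : v ∈ R1 ∪ o.S := by simp [hvS]
    have s2 : pR G (insert x2 (R1 ∪ o.S)) ≤ pR G (R1 ∪ o.S) - 3 :=
      pR_add2 (a := v) (b := u2) mx2 mv mu2 d4 C.vx2.symm C.xu2
    have c8 : 6 ≤ (insert x2 (R1 ∪ o.S)).card :=
      le_trans (by omega) (le_trans hcard (Finset.card_le_card (Finset.subset_insert _ _)))
    by_cases hwS : w ∈ o.S
    · have hK2 : pot o.K ≤ 2 := by
        rcases h.cls3 o.crit hm with ⟨c1, -⟩ | ⟨-, c2, -⟩ | c3
        · omega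
        · omega
        · exfalso
          obtain ⟨k, hk⟩ := GlueOut.mem_S.1 hvS
          obtain ⟨k', hk'⟩ := GlueOut.mem_S.1 hwS
          refine T.nvw (o.hLL k k' v w ((o.tri_card c3).2 k k' ?_) hk hk').1
          rintro rfl
          rw [hk] at hk'
          exact wv (Sum.inl_injective hk').symm
      have := h.P2 c8
      have := hcw hwS
      omega
    · have mw : w ∉ insert x2 (R1 ∪ o.S) := by simp [hwR, hwS, wx2]
      have s3 : pR G (insert w (insert x2 (R1 ∪ o.S))) ≤ pR G (insert x2 (R1 ∪ o.S)) - 3 :=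
        pR_add2 (a := b1) (b := b2) mw (by simp [mb1]) (by simp [mb2]) n4 T.bw1.symm T.bw2.symm
      have c9 : 6 ≤ (insert w (insert x2 (R1 ∪ o.S))).card :=
        le_trans c8 (Finset.card_le_card (Finset.subset_insert _ _))
      have low := h.P2 c9
      have huniv : insert w (insert x2 (R1 ∪ o.S)) = Finset.univ := by
        by_contra hne
        have := h.P4 c9 hne
        omega
      have hcov : ∀ t, t = w ∨ t = x2 ∨ t ∈ R1 ∨ t ∈ o.S := by
        intro t
        have : t ∈ insert w (insert x2 (R1 ∪ o.S)) := by rw [huniv]; exact Finset.mem_univ _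
        simpa only [Finset.mem_insert, Finset.mem_union] using this
      have hq : ∀ q, G.Adj v q → q ≠ x1 → q ≠ x2 → q ∈ o.S := by
        intro q hq h1 h2
        rcases hcov q with rfl | h3 | h3 | h3
        · exact absurd hq T.nvw
        · exact absurd h3 h2
        · exact absurd (hR q hq h3) h1
        · exact h3
      rcases h.cls3 o.crit hm with ⟨c1, -⟩ | ⟨⟨L, e, hL, hadj⟩, c2, -⟩ | c3
      · omega
      · have full : ∀ a r, a ∈ o.S → r ∈ R1 → G.Adj a r →
            ∃ k k', o.K.Adj k k' ∧ o.f k = Sum.inl a ∧ o.f k' = Sum.inr (φ r) := by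
          intro a r ha hr har
          by_contra hn
          have := o.tight hle ha hr har (Or.inr hn)
          omega
        have nw : ∀ t, G.Adj w t → t = b1 ∨ t = b2 := by
          intro t ht
          by_contra hn
          push Not at hn
          have := pR_add3 (a := b1) (b := b2) (c := t) mw (by simp [mb1]) (by simp [mb2])
            (by
              rcases hcov t with rfl | h3 | h3 | h3
              · exact absurd ht G.irrefl
              · simp [h3]
              · simp [h3]
              · simp [h3]) n4 hn.1.symm hn.2.symm T.bw1.symm T.bw2.symm ht
          omega
        -- an edge leaving one of `b1`, `b2`
        obtain ⟨b, s, hb, hbs, su1, su2, sw⟩ : ∃ b s, (b = b1 ∨ b = b2) ∧ G.Adj b s ∧ s ≠ u1 ∧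
            s ≠ u2 ∧ s ≠ w := by
          by_contra hn
          push Not at hn
          refine h.crit.no3 (p := u1) (x := b1) (y := w) (z := b2) (q := u2) ?_ nw ?_ T.bw1 n4
            T.bw2.symm ⟨wu1.symm, t4.symm⟩ ⟨q5.symm, wu2.symm⟩ C.ub1 C.ub2
          · intro t ht
            by_contra hh
            push Not at hh
            refine hh.2 (hn b1 t (Or.inl rfl) ht hh.1 ?_)
            rintro rfl
            rcases (C.nu2 b1).1 ht.symm with h | h | h
            exacts [q3 h, n3 h, n4 h]
          · intro t ht
            by_contra hh
            push Not at hh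
            refine hh.1 (hn b2 t (Or.inr rfl) ht ?_ hh.2)
            rintro rfl
            rcases (C.nu1 b2).1 ht.symm with h | h | h
            exacts [t2 h, n2 h.symm, n4 h.symm]
        have bR : b ∈ R1 := by rcases hb with rfl | rfl <;> simp [R1]
        have fb : φ b = 1 := by rcases hb with rfl | rfl <;> assumption
        have sS : s ∈ o.S := by
          rcases hcov s with h3 | h3 | h3 | h3
          · exact absurd h3 sw
          · subst h3
            rcases (C.nx2 b).1 hbs.symm with h | h
            · exact absurd (h ▸ bR) hvR
            · rcases hb with rfl | rfl
              · exact absurd h q5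
              · exact absurd h t5
          · rcases rb b s hb h3 hbs with h | h
            · exact absurd h su1
            · exact absurd h su2
          · exact h3
        have svne : s ≠ v := by
          rintro rfl
          rcases hb with rfl | rfl
          · exact C.nvb1 h.crit hbs.symm
          · exact C.nvb2 h.crit hbs.symm
        obtain ⟨k1, k2, ks1, ks2, ks3⟩ := full s b sS bR hbs.symm
        obtain ⟨k3, k4, kv1, kv2, kv3⟩ := full v x1 hvS (by simp [R1]) C.vx1
        rw [fb] at ks3
        rw [f7] at kv3
        have k24 : k4 = k2 := o.inj (kv3.trans ks3.symm)
        subst k24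
        rcases hx5' (by omega) with hX1 | hX5
        · have one : ∀ k y, o.f k = Sum.inr y → k = k4 := by
            intro k y hk
            have h1 : k ∈ o.X := GlueOut.mem_X.2 ⟨y, hk⟩
            have h2 : k4 ∈ o.X := GlueOut.mem_X.2 ⟨1, ks3⟩
            exact Finset.card_le_one.1 hX1.le k h1 k4 h2
          have no : ∀ a t, a ∈ R1 → φ a ≠ 1 → t ∈ o.S → ¬ G.Adj a t := by
            intro a t ha hfa ht hat
            obtain ⟨j, j', -, -, j3⟩ := full t a ht ha hat.symm
            have := one _ _ j3
            subst this
            rw [ks3] at j3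
            exact hfa (Sum.inr_injective j3).symm
          refine T.deg2 C h ?_ ?_
          · intro t ht
            rcases hcov t with h3 | h3 | h3 | h3
            · subst h3; exact absurd ht T.n4
            · subst h3
              rcases (C.nx2 a1).1 ht.symm with h | h
              · exact absurd h p1
              · exact absurd h p5
            · exact ra t h3 ht
            · exact absurd ht (no a1 t (by simp [R1]) (by rw [f2]; decide) h3)
          · intro t ht
            rcases hcov t with h3 | h3 | h3 | h3
            · subst h3; exact absurd ht T.n5
            · subst h3
              rcases (C.nx2 a2).1 ht.symm with h | h
              · exact absurd h r1
              · exact absurd h r5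
            · exact ra' t h3 ht
            · exact absurd ht (no a2 t (by simp [R1]) (by rw [f3]; decide) h3)
        · obtain ⟨j1, j0, i1, i2, i3⟩ := hX5 1 0 (by decide)
          obtain ⟨j1', j2, i4, i5, i6⟩ := hX5 1 2 (by decide)
          have hj1 : j1 = k4 := o.inj (i1.trans ks3.symm)
          have hj2 : j1' = k4 := o.inj (i4.trans ks3.symm)
          subst hj1
          subst hj2
          have ne : ∀ {c d : Fin o.m}, o.f c ≠ o.f d → e c ≠ e d :=
            fun hcd hh => hcd (by rw [e.injective hh])
          refine E_deg hL ((hadj _ _).1 ks1.symm) ((hadj _ _).1 kv1.symm) ((hadj _ _).1 i3)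
            ((hadj _ _).1 i6) (ne ?_) (ne ?_) (ne ?_) (ne ?_) (ne ?_) (ne ?_)
          · rw [ks2, kv2]; exact fun hh => svne (Sum.inl_injective hh)
          · rw [ks2, i2]; exact Sum.inl_ne_inr
          · rw [ks2, i5]; exact Sum.inl_ne_inr
          · rw [kv2, i2]; exact Sum.inl_ne_inr
          · rw [kv2, i5]; exact Sum.inl_ne_inr
          · rw [i2, i5]
            intro hh
            exact absurd (Sum.inr_injective hh) (by decide)
      · have hsx := o.card_SX
        have hm3 := c3.1
        have hXp : 0 < o.X.card := Finset.card_pos.2 hXn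
        have tri := (o.tri_card c3).2
        have S2 : ∀ s ∈ o.S, s ≠ v → ∀ t ∈ o.S, t ≠ v → s = t := by
          intro s hs hsv t ht htv
          by_contra hst
          have : ({v, s, t} : Finset V) ⊆ o.S := by
            intro z hz
            simp only [Finset.mem_insert, Finset.mem_singleton] at hz
            rcases hz with rfl | rfl | rfl <;> assumption
          have := Finset.card_le_card this
          rw [Finset.card_eq_three.2 ⟨v, s, t, hsv.symm, htv.symm, hst, rfl⟩] at this
          omega
        rcases C.cs with ⟨x3, u3, h3⟩ | ⟨y, y', e, z, z', f, e1, e2, e3, e4, e5, e6, 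
          e7, e8, e9, e10, e11, e12, -⟩
        · have vx3 : G.Adj v x3 := (h3.2.2.2.1 x3).2 (by simp)
          have hxS := hq x3 vx3 h3.1 h3.2.1
          obtain ⟨k, hk⟩ := GlueOut.mem_S.1 hvS
          obtain ⟨k', hk'⟩ := GlueOut.mem_S.1 hxS
          obtain ⟨k0, hk0⟩ := hXn
          obtain ⟨y, hy⟩ := GlueOut.mem_X.1 hk0
          obtain ⟨r, hr, hry, hvr⟩ := o.hLR k k0 v y (tri k k0 (by
            rintro rfl; rw [hk] at hy; cases hy)) hk hy
          obtain ⟨r', hr', hry', hxr⟩ := o.hLR k' k0 x3 y (tri k' k0 (by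
            rintro rfl; rw [hk'] at hy; cases hy)) hk' hy
          have := hR r hvr.1 hr
          subst this
          rw [f7] at hry
          subst hry
          have hxr9 : G.Adj x3 r' := hxr.1
          clear hxr
          rcases (hR1 r').1 hr' with g | g | g | g | g | g | g
          · subst g
            exact C.hT _ _ _ vx3 hxr9 C.vx1
          · subst g
            exact C.n5v _ _ _ _ vx3 hxr9 C.ub2.symm C.xu2.symm C.vx2.symm
          · subst g
            exact C.n5v _ _ _ _ vx3 hxr9 C.ub1.symm C.xu1.symm C.vx1.symm
          · rw [g, f4] at hry'; exact absurd hry' (by decide)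
          · rw [g, f3] at hry'; exact absurd hry' (by decide)
          · rw [g, f2] at hry'; exact absurd hry' (by decide)
          · rw [g, f1] at hry'; exact absurd hry' (by decide)
        · have vy : G.Adj v y := (e12 y).2 (by simp)
          have vz : G.Adj v z := (e12 z).2 (by simp)
          exact e1 (S2 y (hq y vy e2 e3) vy.ne' z (hq z vz e4 e5) vz.ne')
  · have hQS : ∀ q, G.Adj v q → q ∉ o.S := by
      intro q hq
      obtain ⟨r, hr⟩ := C.Qdeg hq
      exact GlueOut.not_S (fun t ht => hr t ht.1) hvR hvS
    have s2 : pR G (insert v (R1 ∪ o.S)) ≤ pR G (R1 ∪ o.S) + 1 :=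
      pR_add1 (a := x1) (by simp [hvR, hvS]) mx1 C.vx1
    have s3 : pR G (insert x2 (insert v (R1 ∪ o.S))) ≤ pR G (insert v (R1 ∪ o.S)) - 3 :=
      pR_add2 (a := v) (b := u2) (by simp [hx2R, hx2S, d2.symm]) (by simp) (by
        rw [Finset.mem_insert]; exact Or.inr mu2) d4 C.vx2.symm C.xu2
    have c8 : 6 ≤ (insert x2 (insert v (R1 ∪ o.S))).card := by
      refine le_trans (by omega) (le_trans hcard (Finset.card_le_card ?_))
      intro t ht
      rw [Finset.mem_insert, Finset.mem_insert]; exact Or.inr (Or.inr ht)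
    have hQ2 : ∀ q, G.Adj v q → q ≠ x1 → q ≠ x2 → q ∉ insert x2 (insert v (R1 ∪ o.S)) := by
      intro q hq h1 h2
      have : q ∉ R1 := fun hr => h1 (hR q hq hr)
      simp [this, hQS q hq, h2, hq.ne']
    by_cases hwS : w ∈ o.S
    · have := hcw hwS
      exact C.Pkill h (R := insert x2 (insert v (R1 ∪ o.S))) c8 (by simp) hQ2 (by omega)
    · have s4 : pR G (insert w (insert x2 (insert v (R1 ∪ o.S)))) ≤
          pR G (insert x2 (insert v (R1 ∪ o.S))) - 3 :=
        pR_add2 (a := b1) (b := b2) (by simp [hwR, hwS, wx2, wv])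
          (by rw [Finset.mem_insert, Finset.mem_insert]; exact Or.inr (Or.inr mb1))
          (by rw [Finset.mem_insert, Finset.mem_insert]; exact Or.inr (Or.inr mb2)) n4
          T.bw1.symm T.bw2.symm
      refine C.Pkill h (R := insert w (insert x2 (insert v (R1 ∪ o.S))))
        (le_trans c8 (Finset.card_le_card (Finset.subset_insert _ _))) (by simp) ?_ (by omega)
      intro q hq h1 h2
      rw [Finset.mem_insert, not_or]
      exact ⟨by rintro rfl; exact T.nvw hq, hQ2 q hq h1 h2⟩

end seven2

/-- a configuration cannot exist in a smallest counterexample -/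
theorem Conf.false {V : Type} [Fintype V] {G : SimpleGraph V} {v x1 x2 u1 u2 a1 b1 a2 b2 : V}
    (h : SmallestCex G) (C : Conf G v x1 x2 u1 u2 a1 b1 a2 b2) : False := by
  classical
  have key : ∀ a1 b1 a2 b2, Conf G v x1 x2 u1 u2 a1 b1 a2 b2 →
      ((a1 ≠ a2 ∧ a1 ≠ b2 ∧ b1 ≠ a2 ∧ b1 ≠ b2) ∨ a1 = a2) → False := by
    intro a1 b1 a2 b2 C H
    obtain ⟨m, K, π, P, hm, r⟩ := exists_red C h H
    exact Red.done hm r C h (fun _ _ _ _ _ C' T => T.done C' h)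
  by_cases h1 : a1 = a2
  · exact key _ _ _ _ C (Or.inr h1)
  by_cases h2 : a1 = b2
  · exact key _ _ _ _ C.sw2 (Or.inr h2)
  by_cases h3 : b1 = a2
  · exact key _ _ _ _ C.sw1 (Or.inr h3)
  by_cases h4 : b1 = b2
  · exact key _ _ _ _ C.sw1.sw2 (Or.inr h4)
  exact key _ _ _ _ C (Or.inl ⟨h1, h2, h3, h4⟩)

/-- Let `v` be a `(2,2,1,1)`-vertex or a `(1,1,1)`-vertex of a smallest
counterexample that is not contained in any 5-cycle. Then `v` has at most one friend that
has degree 3, is joined to `v` by a 1-string, and is not contained in any 5-cycle. -/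
theorem smallestCex_at_most_one_special_friend {V : Type} [Fintype V] (G : SimpleGraph V)
    (h : SmallestCex G) (v : V)
    (hv : IsVertex4 G v 2 2 1 1 ∨ IsVertex3 G v 1 1 1)
    (hnc : ¬ InFiveCycle G v) :
    {u : V | (∃ p : G.Walk v u, IsString G p ∧ p.length = 2) ∧ deg G u = 3 ∧
      ¬ InFiveCycle G u}.Subsingleton := by
  exact exists_conf h v hv hnc (fun _ _ _ _ _ _ _ _ C => C.false h)
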